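/- Let Ω ⊂⊂ ℂⁿ be a pseudoconvex domain with smooth boundary. If every boundary point of Ω is of finite type (in the sense of D'Angelo), then S(Ω) = 1. -/

import Mathlib

noncomputable section

open Complex Topology
open scoped ENNReal

/-- Wirtinger derivative `∂f/∂z_j`. -/
def dz {n : ℕ} (j : Fin n) (f : (Fin n → ℂ) → ℂ) (z : Fin n → ℂ) : ℂ :=
  (fderiv ℝ f z (Pi.single j 1) - Complex.I * fderiv ℝ f z (Pi.single j Complex.I)) / 2

/-- Wirtinger derivative `∂f/∂z̄_j`. -/
def dzbar {n : ℕ} (j : Fin n) (f : (Fin n → ℂ) → ℂ) (z : Fin n → ℂ) : ℂ :=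
  (fderiv ℝ f z (Pi.single j 1) + Complex.I * fderiv ℝ f z (Pi.single j Complex.I)) / 2

/-- Complexification of a real-valued function. -/
def cplx {n : ℕ} (ρ : (Fin n → ℂ) → ℝ) : (Fin n → ℂ) → ℂ := fun z => (ρ z : ℂ)

/-- The Levi form `L_ρ(X,Y)(z) = Σ_{j,k} ∂²ρ/∂z_j∂z̄_k (z) X_j conj(Y_k)`. -/
def levi {n : ℕ} (ρ : (Fin n → ℂ) → ℝ) (X Y : Fin n → ℂ) (z : Fin n → ℂ) : ℂ :=
  ∑ j, ∑ k, dz j (fun w => dzbar k (cplx ρ) w) z * X j * (starRingEnd ℂ) (Y k)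

/-- `Xf = Σ_j X_j ∂f/∂z_j` for a (1,0) vector `X`. -/
def dirDeriv {n : ℕ} (X : Fin n → ℂ) (f : (Fin n → ℂ) → ℂ) (z : Fin n → ℂ) : ℂ :=
  ∑ j, X j * dz j f z

/-- `X̄f = Σ_j conj(X_j) ∂f/∂z̄_j`. -/
def dirDerivBar {n : ℕ} (X : Fin n → ℂ) (f : (Fin n → ℂ) → ℂ) (z : Fin n → ℂ) : ℂ :=
  ∑ j, (starRingEnd ℂ) (X j) * dzbar j f z

/-- Derivative of `f` along the (1,0) vector field `X`. -/
def fieldDeriv {n : ℕ} (X : (Fin n → ℂ) → (Fin n → ℂ)) (f : (Fin n → ℂ) → ℂ)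
    (z : Fin n → ℂ) : ℂ :=
  dirDeriv (X z) f z

/-- Euclidean norm of the real gradient of `ρ`. -/
def gradNorm {n : ℕ} (ρ : (Fin n → ℂ) → ℝ) (z : Fin n → ℂ) : ℝ :=
  Real.sqrt (∑ j, ((fderiv ℝ ρ z (Pi.single j 1)) ^ 2 +
    (fderiv ℝ ρ z (Pi.single j Complex.I)) ^ 2))

/-- The complex normal field `N_ρ`. -/
def nfield {n : ℕ} (ρ : (Fin n → ℂ) → ℝ) (z : Fin n → ℂ) : Fin n → ℂ := fun j =>
  ((Real.sqrt (∑ k, Complex.normSq (dz k (cplx ρ) z)) : ℝ) : ℂ)⁻¹ * dzbar j (cplx ρ) z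

/-- Squared Euclidean norm of a vector in ℂⁿ. -/
def enormSq {n : ℕ} (X : Fin n → ℂ) : ℝ := ∑ j, Complex.normSq (X j)

/-- `f` is strictly plurisubharmonic on `S`. -/
def StrictPSHOn {n : ℕ} (f : (Fin n → ℂ) → ℝ) (S : Set (Fin n → ℂ)) : Prop :=
  ∀ z ∈ S, ∀ X : Fin n → ℂ, X ≠ 0 → 0 < (levi f X X z).re

/-- `ρ` is a (global smooth) defining function of `Ω` on the neighborhood `V` of `cl Ω`. -/
structure IsDefFn {n : ℕ} (Ω V : Set (Fin n → ℂ)) (ρ : (Fin n → ℂ) → ℝ) : Prop where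
  isOpen : IsOpen V
  subset : closure Ω ⊆ V
  smooth : ContDiffOn ℝ (⊤ : ℕ∞) ρ V
  eq : Ω = {z ∈ V | ρ z < 0}
  grad_ne : ∀ z ∈ frontier Ω, fderiv ℝ ρ z ≠ 0

/-- The Levi form of `ρ` is positive semidefinite on complex tangent vectors at `z`. -/
def LeviPseudoconvexAt {n : ℕ} (ρ : (Fin n → ℂ) → ℝ) (z : Fin n → ℂ) : Prop :=
  ∀ X : Fin n → ℂ, dirDeriv X (cplx ρ) z = 0 → 0 ≤ (levi ρ X X z).re

/-- `Ω` is a (smoothly bounded, Levi) pseudoconvex domain. -/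
def IsPseudoconvex {n : ℕ} (Ω : Set (Fin n → ℂ)) : Prop :=
  ∃ (V : Set (Fin n → ℂ)) (ρ : (Fin n → ℂ) → ℝ), IsDefFn Ω V ρ ∧
    ∀ p ∈ frontier Ω, LeviPseudoconvexAt ρ p

/-- The set of Steinness exponents of `ρ`. -/
def steinExpSet {n : ℕ} (Ω : Set (Fin n → ℂ)) (ρ : (Fin n → ℂ) → ℝ) : Set ℝ :=
  {η : ℝ | 1 < η ∧ ∃ W : Set (Fin n → ℂ), IsOpen W ∧ frontier Ω ⊆ W ∧
    StrictPSHOn (fun z => ρ z ^ η) ((closure Ω)ᶜ ∩ W)}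

/-- The Steinness exponent `η̃_ρ` of a defining function `ρ` (`∞` if none exists). -/
def steinExp {n : ℕ} (Ω : Set (Fin n → ℂ)) (ρ : (Fin n → ℂ) → ℝ) : ℝ≥0∞ :=
  sInf (ENNReal.ofReal '' steinExpSet Ω ρ)

/-- The Steinness index `S(Ω)`. -/
def steinIndex {n : ℕ} (Ω : Set (Fin n → ℂ)) : ℝ≥0∞ :=
  ⨅ (V : Set (Fin n → ℂ)) (ρ : (Fin n → ℂ) → ℝ) (_ : IsDefFn Ω V ρ), steinExp Ω ρ

/-- The set of Diederich–Fornæss exponents of `ρ`. -/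
def dfExpSet {n : ℕ} (Ω : Set (Fin n → ℂ)) (ρ : (Fin n → ℂ) → ℝ) : Set ℝ :=
  {η : ℝ | 0 < η ∧ η < 1 ∧ StrictPSHOn (fun z => -((-ρ z) ^ η)) Ω}

/-- The Diederich–Fornæss exponent of `ρ` (`0` if no exponent exists). -/
def dfExp {n : ℕ} (Ω : Set (Fin n → ℂ)) (ρ : (Fin n → ℂ) → ℝ) : ℝ :=
  sSup (insert 0 (dfExpSet Ω ρ))

/-- The Diederich–Fornæss index `DF(Ω)`. -/
def dfIndex {n : ℕ} (Ω : Set (Fin n → ℂ)) : ℝ :=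
  sSup {t : ℝ | ∃ V ρ, IsDefFn Ω V ρ ∧ t = dfExp Ω ρ}

/-- `L` is a smooth (1,0) tangent vector field for `ρ` on `A`. -/
def IsTangentField {n : ℕ} (ρ : (Fin n → ℂ) → ℝ) (L : (Fin n → ℂ) → (Fin n → ℂ))
    (A : Set (Fin n → ℂ)) : Prop :=
  ContDiffOn ℝ (⊤ : ℕ∞) L A ∧ ∀ z ∈ A, dirDeriv (L z) (cplx ρ) z = 0

/-- The key differential inequality
`(1/(η₂−1))|L_ρ(L,N)|²/‖∇ρ‖² − (1/2)(N L_ρ(L,L))/‖∇ρ‖ ≤ 0` at `p`. -/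
def keyIneqAt {n : ℕ} (ρ : (Fin n → ℂ) → ℝ) (L : (Fin n → ℂ) → (Fin n → ℂ)) (η₂ : ℝ)
    (p : Fin n → ℂ) : Prop :=
  1 / (η₂ - 1) * Complex.normSq (levi ρ (L p) (nfield ρ p) p) / (gradNorm ρ p) ^ 2 -
    1 / 2 * (fieldDeriv (nfield ρ) (fun w => levi ρ (L w) (L w) w) p).re / gradNorm ρ p ≤ 0

/-- The strict version of the key differential inequality. -/
def strictKeyIneqAt {n : ℕ} (ρ : (Fin n → ℂ) → ℝ) (L : (Fin n → ℂ) → (Fin n → ℂ)) (η₂ : ℝ)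
    (p : Fin n → ℂ) : Prop :=
  1 / (η₂ - 1) * Complex.normSq (levi ρ (L p) (nfield ρ p) p) / (gradNorm ρ p) ^ 2 -
    1 / 2 * (fieldDeriv (nfield ρ) (fun w => levi ρ (L w) (L w) w) p).re / gradNorm ρ p < 0

/-- `cl Ω` has a strong Stein neighborhood basis. -/
def HasStrongSteinBasis {n : ℕ} (Ω : Set (Fin n → ℂ)) : Prop :=
  ∃ (V : Set (Fin n → ℂ)) (ρ : (Fin n → ℂ) → ℝ), IsDefFn Ω V ρ ∧ ∃ ε₀ : ℝ, 0 < ε₀ ∧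
    (∀ z ∈ V, 0 ≤ ρ z → ρ z < ε₀ → fderiv ℝ ρ z ≠ 0) ∧
    ∀ ε : ℝ, 0 ≤ ε → ε < ε₀ → ∀ z ∈ V, ρ z = ε → LeviPseudoconvexAt ρ z

/-- Vanishing order at `0` of a holomorphic function `ℂ → ℂ` (`∞` if all derivatives vanish). -/
def orderC (h : ℂ → ℂ) : ℕ∞ :=
  sInf ((fun k : ℕ => (k : ℕ∞)) '' {k : ℕ | iteratedDeriv k h 0 ≠ 0})

/-- Vanishing order at `0` of a real-valued function on `ℂ`. -/
def orderR (g : ℂ → ℝ) : ℕ∞ :=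
  sInf ((fun k : ℕ => (k : ℕ∞)) '' {k : ℕ | iteratedFDeriv ℝ k g 0 ≠ 0})

/-- `ν(γ)`: minimal vanishing order at `0` of the components of `γ − p`. -/
def curveOrder {n : ℕ} (γ : ℂ → Fin n → ℂ) (p : Fin n → ℂ) : ℕ∞ :=
  ⨅ j, orderC (fun t => γ t j - p j)

/-- `p` is a boundary point of finite D'Angelo 1-type (w.r.t. the defining function `ρ`). -/
def FiniteTypePt {n : ℕ} (ρ : (Fin n → ℂ) → ℝ) (p : Fin n → ℂ) : Prop :=
  ∃ M : ℕ, ∀ γ : ℂ → Fin n → ℂ, (∀ j, AnalyticAt ℂ (fun t => γ t j) 0) → γ 0 = p →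
    ¬ (∀ᶠ t in nhds (0 : ℂ), γ t = p) →
    orderR (fun t => ρ (γ t)) ≤ (M : ℕ∞) * curveOrder γ p

/-- Commuting Wirtinger-type derivations `D j`, `Db j` with coordinates `z j` on a star algebra. -/
structure WirtingerSystem (n : ℕ) (R : Type*) [CommRing R] [StarRing R] [Algebra ℂ R]
    [StarModule ℂ R] where
  /-- The holomorphic derivations. -/
  D : Fin n → Derivation ℂ R R
  /-- The antiholomorphic derivations. -/
  Db : Fin n → Derivation ℂ R R
  /-- The coordinates. -/
  z : Fin n → R
  D_comm : ∀ i j f, D i (D j f) = D j (D i f)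
  D_Db_comm : ∀ i j f, D i (Db j f) = Db j (D i f)
  Db_star : ∀ j f, Db j (star f) = star (D j f)

namespace WirtingerSystem

variable {n : ℕ} {R : Type*} [CommRing R] [StarRing R] [Algebra ℂ R] [StarModule ℂ R]

/-- The conjugate derivation. -/
def bar (V : Derivation ℂ R R) : Derivation ℂ R R where
  toFun f := star (V (star f))
  map_add' f g := by simp
  map_smul' c f := by simp
  map_one_eq_zero' := by simp
  leibniz' f g := by simp

@[simp] lemma bar_apply (V : Derivation ℂ R R) (f : R) : bar V f = star (V (star f)) := rfl

@[simp] lemma bar_bar (V : Derivation ℂ R R) : bar (bar V) = V := by ext f; simp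

lemma bar_add (V W : Derivation ℂ R R) : bar (V + W) = bar V + bar W := by ext f; simp

lemma bar_smul (c : ℂ) (V : Derivation ℂ R R) : bar (c • V) = star c • bar V := by ext f; simp

lemma bar_lie (V W : Derivation ℂ R R) : bar ⁅V, W⁆ = ⁅bar V, bar W⁆ := by
  ext f; simp [Derivation.commutator_apply]

variable (S : WirtingerSystem n R)

lemma Db_comm (i j : Fin n) (f : R) : S.Db i (S.Db j f) = S.Db j (S.Db i f) := by
  obtain ⟨g, rfl⟩ : ∃ g, f = star g := ⟨star f, by simp⟩
  simp [S.Db_star, S.D_comm i j]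

instance : LeftCommutative (fun j (f : R) => S.D j f) := ⟨fun i j f => S.D_comm i j f⟩
instance : LeftCommutative (fun j (f : R) => S.Db j f) := ⟨fun i j f => S.Db_comm i j f⟩

/-- The mixed derivative `D^s Db^t G`. -/
def jet (G : R) (s t : Multiset (Fin n)) : R :=
  s.foldr (fun j f => S.D j f) (t.foldr (fun j f => S.Db j f) G)

@[simp] lemma jet_zero (G : R) : S.jet G 0 0 = G := by simp [jet]

lemma jet_cons (G : R) (j : Fin n) (s t : Multiset (Fin n)) :
    S.jet G (j ::ₘ s) t = S.D j (S.jet G s t) := by simp [jet]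

lemma jet_cons' (G : R) (j : Fin n) (s t : Multiset (Fin n)) :
    S.jet G s (j ::ₘ t) = S.Db j (S.jet G s t) := by
  induction s using Multiset.induction with
  | empty => simp [jet]
  | cons a s ih => rw [jet_cons, jet_cons, ih, S.D_Db_comm]

lemma jet_D (G : R) (j : Fin n) (s t : Multiset (Fin n)) :
    S.jet (S.D j G) s t = S.jet G (j ::ₘ s) t := by
  induction s using Multiset.induction generalizing t with
  | empty =>
    induction t using Multiset.induction with
    | empty => simp [jet]
    | cons a t ih => rw [jet_cons', ih, jet_cons, jet_cons, jet_cons', S.D_Db_comm]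
  | cons a s ih => rw [jet_cons, ih, jet_cons, jet_cons, jet_cons, S.D_comm]

lemma jet_Db (G : R) (j : Fin n) (s t : Multiset (Fin n)) :
    S.jet (S.Db j G) s t = S.jet G s (j ::ₘ t) := by
  induction s using Multiset.induction generalizing t with
  | empty =>
    induction t using Multiset.induction with
    | empty => simp [jet]
    | cons a t ih => rw [jet_cons', ih, jet_cons', jet_cons', jet_cons', S.Db_comm]
  | cons a s ih => rw [jet_cons, ih, jet_cons]

lemma star_jet {G : R} (hG : star G = G) (s t : Multiset (Fin n)) :
    star (S.jet G s t) = S.jet G t s := by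
  induction s using Multiset.induction generalizing t with
  | empty =>
    induction t using Multiset.induction with
    | empty => simp [hG]
    | cons a t ih =>
      have := S.Db_star a (star (S.jet G 0 t))
      rw [star_star] at this
      rw [jet_cons', jet_cons, ← ih, this, star_star]
  | cons a s ih => rw [jet_cons, ← S.Db_star, ih, jet_cons']

/-- Formal polynomials in the holomorphic derivatives. -/
abbrev Poly (n : ℕ) (R : Type*) [CommRing R] := Multiset (Fin n) →₀ R

/-- The action of a derivation on formal polynomials: differentiate the coefficients and multiply
by the symbol. -/
def act (V : Derivation ℂ R R) : Poly n R →+ Poly n R :=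
  Finsupp.liftAddHom fun s => (Finsupp.singleAddHom s).comp V.toLinearMap.toAddMonoidHom +
    ∑ j, (Finsupp.singleAddHom (j ::ₘ s)).comp (AddMonoidHom.mulRight (V (S.z j)))

lemma act_single (V : Derivation ℂ R R) (s : Multiset (Fin n)) (c : R) :
    S.act V (Finsupp.single s c) =
      Finsupp.single s (V c) + ∑ j, Finsupp.single (j ::ₘ s) (c * V (S.z j)) := by
  simp [act]

lemma act_add (V W : Derivation ℂ R R) (P : Poly n R) :
    S.act (V + W) P = S.act V P + S.act W P := by
  induction P using Finsupp.induction_linear with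
  | zero => simp
  | add f g hf hg => rw [map_add, hf, hg, map_add, map_add]; abel
  | single s c =>
    simp only [act_single, Derivation.add_apply, mul_add, Finsupp.single_add,
      Finset.sum_add_distrib]
    abel

lemma act_smul (k : ℂ) (V : Derivation ℂ R R) (P : Poly n R) :
    S.act (k • V) P = k • S.act V P := by
  induction P using Finsupp.induction_linear with
  | zero => simp
  | add f g hf hg => rw [map_add, hf, hg, map_add, smul_add]
  | single s c =>
    simp only [act_single, Derivation.smul_apply, smul_add, Finset.smul_sum,
      Finsupp.smul_single, mul_smul_comm]

lemma act_smul_poly (k : ℂ) (V : Derivation ℂ R R) (P : Poly n R) :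
    S.act V (k • P) = k • S.act V P := by
  induction P using Finsupp.induction_linear with
  | zero => simp
  | add f g hf hg => rw [smul_add, map_add, hf, hg, map_add, smul_add]
  | single s c =>
    simp only [act_single, smul_add, Finset.smul_sum, Finsupp.smul_single,
      Derivation.map_smul, smul_mul_assoc]

lemma act_leibniz (V : Derivation ℂ R R) (f : R) (P : Poly n R) :
    S.act V (f • P) = V f • P + f • S.act V P := by
  induction P using Finsupp.induction_linear with
  | zero => simp
  | add p q hp hq => rw [smul_add, map_add, hp, hq, map_add, smul_add, smul_add]; abel
  | single s c =>
    simp only [act_single, smul_add, Finset.smul_sum, Finsupp.smul_single, smul_eq_mul,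
      Derivation.leibniz, Finsupp.single_add, mul_assoc, mul_comm c]
    abel

lemma act_lie (V W : Derivation ℂ R R) (P : Poly n R) :
    S.act ⁅V, W⁆ P = S.act V (S.act W P) - S.act W (S.act V P) := by
  induction P using Finsupp.induction_linear with
  | zero => simp
  | add p q hp hq => simp only [map_add, hp, hq]; abel
  | single s c =>
    simp only [act_single, map_add, map_sum, Derivation.commutator_apply, Derivation.leibniz,
      smul_eq_mul, Finsupp.single_add, Finset.sum_add_distrib, mul_sub, Finsupp.single_sub,
      Finset.sum_sub_distrib]
    rw [Finset.sum_comm (f := fun x i => Finsupp.single (i ::ₘ x ::ₘ s) (c * W (S.z x) * V (S.z i)))]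
    simp only [Multiset.cons_swap _ _ s, mul_right_comm c (W _) (V _), mul_comm (W _) (V c),
      mul_comm (V _) (W c)]
    abel

/-- The sesquilinear pairing of formal polynomials induced by `G`. -/
def pair (G : R) : Poly n R →+ Poly n R →+ R :=
  Finsupp.liftAddHom fun s => AddMonoidHom.mk' (fun c => Finsupp.liftAddHom fun t =>
    AddMonoidHom.mk' (fun d => c * star d * S.jet G s t) (fun d e => by simp; ring))
    (fun c d => by ext; simp; ring)

lemma pair_single (G : R) (s t : Multiset (Fin n)) (c d : R) :
    S.pair G (Finsupp.single s c) (Finsupp.single t d) = c * star d * S.jet G s t := by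
  simp [pair]

omit [StarRing R] [Algebra ℂ R] [StarModule ℂ R] in
lemma pair_induction {p : Poly n R → Poly n R → Prop}
    (h0 : ∀ Q, p 0 Q) (h0' : ∀ P, p P 0)
    (hadd : ∀ P P' Q, p P Q → p P' Q → p (P + P') Q)
    (hadd' : ∀ P Q Q', p P Q → p P Q' → p P (Q + Q'))
    (hs : ∀ s t c d, p (Finsupp.single s c) (Finsupp.single t d)) (P Q : Poly n R) : p P Q := by
  induction P using Finsupp.induction_linear with
  | zero => exact h0 Q
  | add f g hf hg => exact hadd _ _ _ hf hg
  | single s c =>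
    induction Q using Finsupp.induction_linear with
    | zero => exact h0' _
    | add f g hf hg => exact hadd' _ _ _ hf hg
    | single t d => exact hs s t c d

lemma pair_smul_left (G f : R) (P Q : Poly n R) : S.pair G (f • P) Q = f * S.pair G P Q := by
  revert P Q
  refine pair_induction ?_ ?_ ?_ ?_ ?_
  · simp
  · simp
  · intro P P' Q h h'; simp [h, h', mul_add]
  · intro P P' Q h h'; simp [h, h', mul_add]
  · intro s t c d; simp only [Finsupp.smul_single, smul_eq_mul, pair_single]; ring

lemma pair_smul_right (G f : R) (P Q : Poly n R) :
    S.pair G P (f • Q) = star f * S.pair G P Q := by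
  revert P Q
  refine pair_induction ?_ ?_ ?_ ?_ ?_
  · simp
  · simp
  · intro P P' Q h h'; simp [h, h', mul_add]
  · intro P P' Q h h'; simp [h, h', mul_add]
  · intro s t c d; simp only [Finsupp.smul_single, smul_eq_mul, pair_single, star_mul]; ring

lemma star_pair {G : R} (hG : star G = G) (P Q : Poly n R) :
    star (S.pair G P Q) = S.pair G Q P := by
  revert P Q
  refine pair_induction ?_ ?_ ?_ ?_ ?_
  · simp
  · simp
  · intro P P' Q h h'; simp [h, h']
  · intro P P' Q h h'; simp [h, h']
  · intro s t c d; simp [pair_single, S.star_jet hG]; ring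

/-- First-order derivations that obey the chain rule with respect to the coordinates. -/
def Good (V : Derivation ℂ R R) : Prop :=
  ∀ f, V f = ∑ j, (V (S.z j) * S.D j f + V (star (S.z j)) * S.Db j f)

lemma Good.apply_pair {V : Derivation ℂ R R} (hV : S.Good V) (G : R) (P Q : Poly n R) :
    V (S.pair G P Q) = S.pair G (S.act V P) Q + S.pair G P (S.act (bar V) Q) := by
  revert P Q
  refine pair_induction ?_ ?_ ?_ ?_ ?_
  · simp
  · simp
  · intro P P' Q h h'; simp only [map_add, AddMonoidHom.add_apply, h, h']; abel
  · intro P P' Q h h'; simp only [map_add, h, h']; abel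
  · intro s t c d
    simp only [pair_single, act_single, map_add, AddMonoidHom.add_apply, map_sum,
      AddMonoidHom.finsetSum_apply, jet_cons, jet_cons', bar_apply, star_mul, star_star,
      Derivation.leibniz, smul_eq_mul, hV (S.jet G s t), Finset.mul_sum, mul_add,
      Finset.sum_add_distrib]
    have e1 : ∀ x, c * star d * (V (S.z x) * (S.D x) (S.jet G s t)) =
      c * V (S.z x) * star d * S.D x (S.jet G s t) := fun x => by ring
    have e2 : ∀ x, c * star d * (V (star (S.z x)) * (S.Db x) (S.jet G s t)) =
      c * (V (star (S.z x)) * star d) * S.Db x (S.jet G s t) := fun x => by ring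
    simp only [e1, e2]
    ring

lemma Good.add {V W : Derivation ℂ R R} (hV : S.Good V) (hW : S.Good W) : S.Good (V + W) := by
  intro f
  simp only [Derivation.add_apply]
  rw [hV f, hW f, ← Finset.sum_add_distrib]
  exact Finset.sum_congr rfl fun j _ => by ring

lemma Good.smul {V : Derivation ℂ R R} (hV : S.Good V) (c : ℂ) : S.Good (c • V) := by
  intro f
  simp only [Derivation.smul_apply]
  rw [hV f, Finset.smul_sum]
  exact Finset.sum_congr rfl fun j _ => by simp [smul_add]

lemma Good.zero : S.Good 0 := by intro f; simp

lemma Good.lie {V W : Derivation ℂ R R} (hV : S.Good V) (hW : S.Good W) : S.Good ⁅V, W⁆ := by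
  intro f
  have key : ∀ {V W : Derivation ℂ R R}, S.Good V → S.Good W → V (W f) =
      ∑ j, (V (W (S.z j)) * S.D j f + V (W (star (S.z j))) * S.Db j f) +
      ∑ j, ∑ i, (W (S.z j) * V (S.z i) * S.D i (S.D j f)
        + W (S.z j) * V (star (S.z i)) * S.Db i (S.D j f)
        + W (star (S.z j)) * V (S.z i) * S.D i (S.Db j f)
        + W (star (S.z j)) * V (star (S.z i)) * S.Db i (S.Db j f)) := by
    intro V W hV hW
    rw [hW f, map_sum, ← Finset.sum_add_distrib]
    refine Finset.sum_congr rfl fun j _ => ?_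
    rw [map_add, Derivation.leibniz, Derivation.leibniz, hV (S.D j f), hV (S.Db j f)]
    simp only [smul_eq_mul, Finset.mul_sum, Finset.sum_add_distrib, mul_add, mul_assoc]
    ring
  rw [Derivation.commutator_apply, key hV hW, key hW hV]
  rw [Finset.sum_comm (f := fun j i => V (S.z j) * W (S.z i) * S.D i (S.D j f)
        + V (S.z j) * W (star (S.z i)) * S.Db i (S.D j f)
        + V (star (S.z j)) * W (S.z i) * S.D i (S.Db j f)
        + V (star (S.z j)) * W (star (S.z i)) * S.Db i (S.Db j f))]
  have : ∀ j i, W (S.z j) * V (S.z i) * S.D i (S.D j f)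
        + W (S.z j) * V (star (S.z i)) * S.Db i (S.D j f)
        + W (star (S.z j)) * V (S.z i) * S.D i (S.Db j f)
        + W (star (S.z j)) * V (star (S.z i)) * S.Db i (S.Db j f) =
        V (S.z i) * W (S.z j) * S.D j (S.D i f)
        + V (S.z i) * W (star (S.z j)) * S.Db j (S.D i f)
        + V (star (S.z i)) * W (S.z j) * S.D j (S.Db i f)
        + V (star (S.z i)) * W (star (S.z j)) * S.Db j (S.Db i f) := by
    intro j i
    rw [S.D_comm i j, S.Db_comm i j, ← S.D_Db_comm j i, ← S.D_Db_comm i j]; ring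
  simp only [this, add_sub_add_right_eq_sub, ← Finset.sum_sub_distrib,
    Derivation.commutator_apply]
  exact Finset.sum_congr rfl fun j _ => by ring

lemma Good.bar {V : Derivation ℂ R R} (hV : S.Good V) : S.Good (bar V) := by
  intro f
  have h2 : ∀ j, star (S.Db j (star f)) = S.D j f := fun j => by rw [S.Db_star, star_star]
  have h1 : ∀ j, star (S.D j (star f)) = S.Db j f := fun j => by
    rw [← S.Db_star, star_star]
  simp only [bar_apply]
  rw [hV (star f), star_sum]
  refine Finset.sum_congr rfl fun j _ => ?_
  simp only [star_add, star_mul, star_star, h1, h2]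
  ring

/-- The formal polynomial `1`. -/
def vac : Poly n R := Finsupp.single 0 1

/-- The formal polynomial obtained by letting a word of derivations act on `1`. -/
def word (u : List (Derivation ℂ R R)) : Poly n R := u.foldr (fun V P => S.act V P) vac

@[simp] lemma word_nil : S.word [] = vac := rfl
@[simp] lemma word_cons (V : Derivation ℂ R R) (u) : S.word (V :: u) = S.act V (S.word u) := rfl

lemma act_vac (V : Derivation ℂ R R) :
    S.act V vac = ∑ j, Finsupp.single {j} (V (S.z j)) := by
  simp [vac, act_single]

end WirtingerSystem

/-- Linear coefficient of a symmetric multilinear function along a line. -/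
lemma exists_line_polynomial {M : Type*} [AddCommGroup M] [Module ℂ M]
    (r : ℕ) (φ : List M → ℂ)
    (hperm : ∀ u v : List M, u.length = r → u.Perm v → φ u = φ v)
    (hadd : ∀ x y u, u.length + 1 = r → φ ((x + y) :: u) = φ (x :: u) + φ (y :: u))
    (hsmul : ∀ (c : ℂ) x u, u.length + 1 = r → φ ((c • x) :: u) = c * φ (x :: u))
    (x y : M) (m : ℕ) (w : List M) (hw : m + w.length = r) :
    ∃ P : Polynomial ℂ, (∀ s : ℂ, φ (List.replicate m (x + s • y) ++ w) = P.eval s) ∧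
      P.coeff 0 = φ (List.replicate m x ++ w) ∧
      P.coeff 1 = m * φ (y :: (List.replicate (m - 1) x ++ w)) := by
  induction m generalizing w with
  | zero => exact ⟨Polynomial.C (φ w), by simp, by simp, by simp⟩
  | succ m ih =>
    obtain ⟨P, hP, hP0, hP1⟩ := ih (x :: w) (by simp; omega)
    obtain ⟨Q, hQ, hQ0, hQ1⟩ := ih (y :: w) (by simp; omega)
    refine ⟨P + Polynomial.X * Q, fun s => ?_, ?_, ?_⟩
    · rw [List.replicate_succ, List.cons_append, hadd _ _ _ (by simp; omega),
        hsmul _ _ _ (by simp; omega)]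
      simp only [Polynomial.eval_add, Polynomial.eval_mul, Polynomial.eval_X, ← hP, ← hQ]
      rw [hperm (x :: _) _ (by simp; omega) List.perm_middle.symm,
        hperm (y :: _) _ (by simp; omega) List.perm_middle.symm]
    · simp only [Polynomial.coeff_add, Polynomial.mul_coeff_zero, Polynomial.coeff_X_zero,
        zero_mul, add_zero, hP0, List.replicate_succ, List.cons_append]
      exact hperm _ _ (by simp; omega) List.perm_middle
    · have e := Polynomial.coeff_X_mul Q 0
      simp only [zero_add] at e
      rw [Polynomial.coeff_add, e, hP1, hQ0]
      rw [hperm (List.replicate m x ++ y :: w) _ (by simp; omega) List.perm_middle]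
      rcases m with _ | m
      · simp
      · simp only [Nat.add_sub_cancel]
        rw [hperm (y :: (List.replicate m x ++ x :: w))
          (y :: (List.replicate (m + 1) x ++ w)) (by simp; omega)
          (by rw [List.replicate_succ, List.cons_append]; exact (List.perm_middle).cons y)]
        push_cast; ring

/-- Polarization for symmetric multilinear functions on words. -/
lemma polarization {M : Type*} [AddCommGroup M] [Module ℂ M] (A : M → Prop)
    (hA : ∀ x y, A x → A y → ∀ s : ℝ, A (x + (s : ℂ) • y))
    (hB : ∀ y, ∃ y₁ y₂, A y₁ ∧ A y₂ ∧ y = y₁ + I • y₂)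
    (r : ℕ) (φ : List M → ℂ)
    (hperm : ∀ u v : List M, u.length = r → u.Perm v → φ u = φ v)
    (hadd : ∀ x y u, u.length + 1 = r → φ ((x + y) :: u) = φ (x :: u) + φ (y :: u))
    (hsmul : ∀ (c : ℂ) x u, u.length + 1 = r → φ ((c • x) :: u) = c * φ (x :: u))
    (hdiag : ∀ x, A x → φ (List.replicate r x) = 0) :
    ∀ u : List M, u.length = r → φ u = 0 := by
  induction r generalizing φ with
  | zero =>
    intro u hu
    obtain ⟨x, y, hx, -, -⟩ := hB 0
    rw [List.length_eq_zero_iff.mp hu]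
    exact hdiag x hx
  | succ r ih =>
    have hreal : ∀ y, A y → ∀ u : List M, u.length = r → φ (y :: u) = 0 := by
      intro y hy
      refine ih (fun u => φ (y :: u)) ?_ ?_ ?_ ?_
      · intro u v hl huv
        exact hperm _ _ (by simp [hl]) (huv.cons y)
      · intro x x' u hu
        have hs : ∀ a, φ (y :: a :: u) = φ (a :: y :: u) := fun a =>
          hperm _ _ (by simp; omega) (List.Perm.swap _ _ _)
        simp only [hs]
        exact hadd _ _ _ (by simp; omega)
      · intro c x u hu
        have hs : ∀ a, φ (y :: a :: u) = φ (a :: y :: u) := fun a =>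
          hperm _ _ (by simp; omega) (List.Perm.swap _ _ _)
        simp only [hs]
        exact hsmul _ _ _ (by simp; omega)
      · intro x hx
        obtain ⟨P, hP, hP0, hP1⟩ := exists_line_polynomial (r + 1) φ hperm hadd hsmul x y (r + 1) []
          (by simp)
        have hz : P = 0 := by
          refine Polynomial.eq_zero_of_infinite_isRoot P ?_
          refine Set.Infinite.mono (s := Set.range (fun s : ℝ => (s : ℂ))) ?_
            (Set.infinite_range_of_injective Complex.ofReal_injective)
          rintro _ ⟨s, rfl⟩
          change P.eval (s : ℂ) = 0
          rw [← hP, List.append_nil]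
          exact hdiag _ (hA x y hx hy s)
        rw [hz] at hP1
        simp only [Polynomial.coeff_zero, Nat.add_sub_cancel, List.append_nil] at hP1
        exact (mul_eq_zero.mp hP1.symm).resolve_left (by exact_mod_cast Nat.succ_ne_zero r)
    intro u hu
    match u, hu with
    | y :: u, hu =>
      obtain ⟨y₁, y₂, h1, h2, rfl⟩ := hB y
      have hu' : u.length = r := by simpa using hu
      rw [hadd _ _ _ (by simpa using hu), hsmul _ _ _ (by simpa using hu),
        hreal _ h1 u hu', hreal _ h2 u hu']
      simp

namespace WirtingerSystem

variable {n : ℕ} {R : Type*} [CommRing R] [StarRing R] [Algebra ℂ R] [StarModule ℂ R]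

/-- The Lie algebra generated by `L` and its conjugate. -/
def genAlg (L : Derivation ℂ R R) : LieSubalgebra ℂ (Derivation ℂ R R) :=
  LieSubalgebra.lieSpan ℂ _ {L, bar L}

lemma self_mem_genAlg (L : Derivation ℂ R R) : L ∈ genAlg L :=
  LieSubalgebra.subset_lieSpan (by simp)

lemma bar_self_mem_genAlg (L : Derivation ℂ R R) : bar L ∈ genAlg L :=
  LieSubalgebra.subset_lieSpan (by simp)

lemma bar_mem_genAlg {L V : Derivation ℂ R R} (hV : V ∈ genAlg L) : bar V ∈ genAlg L := by
  refine LieSubalgebra.lieSpan_induction (p := fun V _ => bar V ∈ genAlg L) ℂ ?_ ?_ ?_ ?_ ?_ hV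
  · rintro x (rfl | rfl)
    · exact bar_self_mem_genAlg _
    · rw [bar_bar]; exact self_mem_genAlg _
  · have : bar (0 : Derivation ℂ R R) = 0 := by ext; simp
    rw [this]; exact zero_mem _
  · intro x y _ _ hx hy; rw [bar_add]; exact add_mem hx hy
  · intro a x _ hx; rw [bar_smul]; exact (genAlg L).smul_mem _ hx
  · intro x y _ _ hx hy; rw [bar_lie]; exact (genAlg L).lie_mem hx hy

variable {T : Type*}

/-- The value at `q` of the pairing of two words. -/
def beta (S : WirtingerSystem n R) (ρ : R) (ev : T → R →⋆ₐ[ℂ] ℂ) (q : T)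
    (u v : List (Derivation ℂ R R)) : ℂ :=
  ev q (S.pair ρ (S.word u) (S.word v))

/-- Data for the propagation of flatness along the Lie algebra generated by `L`. -/
structure CRSystem (S : WirtingerSystem n R) (ρ : R) (ev : T → R →⋆ₐ[ℂ] ℂ)
    (L : Derivation ℂ R R) : Prop where
  real : star ρ = ρ
  good : S.Good L
  hol : ∀ j, L (star (S.z j)) = 0
  ideal : ∀ f, (∀ q, ev q f = 0) → ∀ q, ev q (L f) = 0
  ideal_bar : ∀ f, (∀ q, ev q f = 0) → ∀ q, ev q (bar L f) = 0
  vanish : ∀ q, ev q ρ = 0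
  null : ∀ q, ∀ U ∈ genAlg L, S.beta ρ ev q [U] [] = 0 → S.beta ρ ev q [U] [L] = 0
  pos : ∀ q, ∀ V ∈ genAlg L, bar V = V → ∀ U ∈ genAlg L, ∀ N : ℕ, Odd N →
    (∀ a c, a + c ≤ N → S.beta ρ ev q (List.replicate a V) (List.replicate c V) = 0) →
    (∀ a c, a + c ≤ N → S.beta ρ ev q (List.replicate a V ++ [U]) (List.replicate c V) = 0) →
    (∀ a c, a + c < N → S.beta ρ ev q (List.replicate a V ++ [U]) (List.replicate c V ++ [U]) = 0) →
    (∑ p ∈ Finset.HasAntidiagonal.antidiagonal N, I ^ p.1 * (-I) ^ p.2 / (p.1.factorial * p.2.factorial) *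
      S.beta ρ ev q (List.replicate p.1 V ++ [U]) (List.replicate p.2 V ++ [U])).re = 0

section
variable {S : WirtingerSystem n R} {ρ : R} {ev : T → R →⋆ₐ[ℂ] ℂ} {L : Derivation ℂ R R}

lemma beta_add (q : T) (x y : Derivation ℂ R R) (u v) :
    S.beta ρ ev q ((x + y) :: u) v = S.beta ρ ev q (x :: u) v + S.beta ρ ev q (y :: u) v := by
  simp [beta, act_add]

lemma pair_smul_complex (G : R) (c : ℂ) (P Q : Poly n R) :
    S.pair G (c • P) Q = c • S.pair G P Q := by
  have : c • P = (algebraMap ℂ R c) • P := by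
    ext; simp [Algebra.smul_def]
  rw [this, pair_smul_left, Algebra.smul_def]

lemma beta_smul (q : T) (c : ℂ) (x : Derivation ℂ R R) (u v) :
    S.beta ρ ev q ((c • x) :: u) v = c * S.beta ρ ev q (x :: u) v := by
  simp [beta, act_smul, pair_smul_complex]

lemma beta_lie (q : T) (x y : Derivation ℂ R R) (u v) :
    S.beta ρ ev q (⁅x, y⁆ :: u) v = S.beta ρ ev q (x :: y :: u) v - S.beta ρ ev q (y :: x :: u) v := by
  simp [beta, act_lie]

namespace CRSystem

variable (h : CRSystem S ρ ev L)
include h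

lemma good_mem {V : Derivation ℂ R R} (hV : V ∈ genAlg L) : S.Good V := by
  refine LieSubalgebra.lieSpan_induction (p := fun V _ => S.Good V) ℂ ?_ ?_ ?_ ?_ ?_ hV
  · rintro x (rfl | rfl)
    · exact h.good
    · exact h.good.bar
  · exact Good.zero S
  · intro x y _ _ hx hy; exact hx.add S hy
  · intro a x _ hx; exact hx.smul S a
  · intro x y _ _ hx hy; exact hx.lie S hy

lemma ideal_mem {V : Derivation ℂ R R} (hV : V ∈ genAlg L) :
    ∀ f, (∀ q, ev q f = 0) → ∀ q, ev q (V f) = 0 := by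
  refine LieSubalgebra.lieSpan_induction
    (p := fun V _ => ∀ f, (∀ q, ev q f = 0) → ∀ q, ev q (V f) = 0) ℂ ?_ ?_ ?_ ?_ ?_ hV
  · rintro x (rfl | rfl)
    · exact h.ideal
    · exact h.ideal_bar
  · simp
  · intro x y _ _ hx hy f hf q
    simp [hx f hf q, hy f hf q]
  · intro a x _ hx f hf q
    simp [hx f hf q]
  · intro x y _ _ hx hy f hf q
    simp [Derivation.commutator_apply, hx _ (hy f hf) q, hy _ (hx f hf) q]

lemma star_beta (q : T) (u v) : star (S.beta ρ ev q u v) = S.beta ρ ev q v u := by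
  rw [beta, ← map_star, star_pair _ h.real, beta]

/-- Moving a derivation to the other side, provided the lower order pairing vanishes on `T`. -/
lemma transfer {V : Derivation ℂ R R} (hV : V ∈ genAlg L) (u v)
    (h0 : ∀ q, S.beta ρ ev q u v = 0) (q : T) :
    S.beta ρ ev q u (V :: v) = - S.beta ρ ev q (bar V :: u) v := by
  have h1 := h.ideal_mem (bar_mem_genAlg hV) _ h0 q
  rw [(h.good_mem (bar_mem_genAlg hV)).apply_pair, bar_bar, map_add] at h1
  simp only [beta, word_cons]
  linear_combination h1

lemma beta_bar_last (q : T) (u v) : S.beta ρ ev q (u ++ [bar L]) v = 0 := by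
  have h0 : S.word [bar L] = 0 := by
    simp [act_vac, h.hol]
  have : S.word (u ++ [bar L]) = 0 := by
    induction u with
    | nil => exact h0
    | cons a u ih => rw [List.cons_append, word_cons, ih, map_zero]
  simp [beta, this]

end CRSystem

/-- All pairings of words of total order less than `b` vanish. -/
def Flat (S : WirtingerSystem n R) (ρ : R) (ev : T → R →⋆ₐ[ℂ] ℂ) (L : Derivation ℂ R R)
    (b : ℕ) : Prop :=
  ∀ u : List (Derivation ℂ R R), (∀ V ∈ u, V ∈ genAlg L) → u.length < b →
    ∀ q, S.beta ρ ev q u [] = 0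

namespace CRSystem

variable (h : CRSystem S ρ ev L)
include h

lemma flat_pair {b : ℕ} (hb : Flat S ρ ev L b) (v : List (Derivation ℂ R R)) :
    ∀ u : List (Derivation ℂ R R), (∀ V ∈ u, V ∈ genAlg L) →
    (∀ V ∈ v, V ∈ genAlg L) → u.length + v.length < b → ∀ q, S.beta ρ ev q u v = 0 := by
  induction v with
  | nil => intro u hu _ hl; exact hb u hu (by simpa using hl)
  | cons V v ih =>
    intro u hu hv hl q
    have hV := hv V (by simp)
    have hv' : ∀ V ∈ v, V ∈ genAlg L := fun W hW => hv W (by simp [hW])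
    simp only [List.length_cons] at hl
    rw [h.transfer hV u v (ih u hu hv' (by omega)),
      ih (bar V :: u) (by simpa using ⟨bar_mem_genAlg hV, hu⟩) hv' (by simp; omega), neg_zero]

lemma perm_of_lower {m : ℕ} {w : List (Derivation ℂ R R)}
    (hb : ∀ u v : List (Derivation ℂ R R), (∀ V ∈ u, V ∈ genAlg L) → (∀ V ∈ v, V ∈ genAlg L) →
      u.length + v.length < m → ∀ q, S.beta ρ ev q u (v ++ w) = 0)
    {u u' : List (Derivation ℂ R R)} (hp : u.Perm u') :
    ∀ v : List (Derivation ℂ R R), (∀ V ∈ u, V ∈ genAlg L) →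
    (∀ V ∈ v, V ∈ genAlg L) → u.length + v.length ≤ m → ∀ q,
    S.beta ρ ev q u (v ++ w) = S.beta ρ ev q u' (v ++ w) := by
  induction hp with
  | nil => intros; rfl
  | @cons x l l' hl ih =>
    intro v hu hv hlen q
    have hx := hu x (by simp)
    have hu' : ∀ V ∈ l, V ∈ genAlg L := fun W hW => hu W (by simp [hW])
    have hu'' : ∀ V ∈ l', V ∈ genAlg L := fun W hW => hu' W (hl.mem_iff.mpr hW)
    have hle := hl.length_eq
    simp only [List.length_cons] at hlen
    have e1 := h.transfer (bar_mem_genAlg hx) l (v ++ w) (hb l v hu' hv (by omega)) q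
    have e2 := h.transfer (bar_mem_genAlg hx) l' (v ++ w) (hb l' v hu'' hv (by omega)) q
    rw [bar_bar] at e1 e2
    have e3 := ih (bar x :: v) hu' (by simpa using ⟨bar_mem_genAlg hx, hv⟩)
      (by simp; omega) q
    rw [← neg_eq_iff_eq_neg] at e1 e2
    rw [← e1, ← e2, ← List.cons_append, e3]
  | swap x y l =>
    intro v hu hv hlen q
    rw [← sub_eq_zero, ← beta_lie]
    refine hb _ _ ?_ hv (by simp at hlen ⊢; omega) q
    intro V hV
    rcases List.mem_cons.mp hV with rfl | hV
    · exact (genAlg L).lie_mem (hu y (by simp)) (hu x (by simp))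
    · exact hu V (by simp [hV])
  | trans h1 h2 ih1 ih2 =>
    intro v hu hv hlen q
    rw [ih1 v hu hv hlen q, ih2 v (fun V hV => hu V (h1.mem_iff.mpr hV)) hv
      (by rw [← h1.length_eq]; exact hlen) q]

lemma flat_perm {b : ℕ} (hb : Flat S ρ ev L b) {u u' : List (Derivation ℂ R R)} (hp : u.Perm u')
    (v : List (Derivation ℂ R R)) (hu : ∀ V ∈ u, V ∈ genAlg L)
    (hv : ∀ V ∈ v, V ∈ genAlg L) (hl : u.length + v.length ≤ b) (q : T) :
    S.beta ρ ev q u v = S.beta ρ ev q u' v := by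
  have := h.perm_of_lower (m := b) (w := []) (fun u v hu hv hl q => by
    rw [List.append_nil]; exact h.flat_pair hb v u hu hv hl q) hp v hu hv hl q
  simpa using this

/-- At top order, everything can be moved to the left. -/
lemma flat_move {b : ℕ} (hb : Flat S ρ ev L b) (v : List (Derivation ℂ R R)) :
    ∀ u : List (Derivation ℂ R R), (∀ V ∈ u, V ∈ genAlg L) →
    (∀ V ∈ v, V ∈ genAlg L) → u.length + v.length ≤ b → ∀ q,
    S.beta ρ ev q u v = (-1) ^ v.length * S.beta ρ ev q (v.map bar ++ u) [] := by
  induction v with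
  | nil => intros; simp
  | cons V v ih =>
    intro u hu hv hl q
    have hV := hv V (by simp)
    have hv' : ∀ V ∈ v, V ∈ genAlg L := fun W hW => hv W (by simp [hW])
    have hvb : ∀ W ∈ v.map bar, W ∈ genAlg L := by
      intro W hW
      obtain ⟨X, hX, rfl⟩ := List.mem_map.mp hW
      exact bar_mem_genAlg (hv' X hX)
    simp only [List.length_cons] at hl
    have hu' : ∀ W ∈ bar V :: u, W ∈ genAlg L := by simpa using ⟨bar_mem_genAlg hV, hu⟩
    rw [h.transfer hV u v (h.flat_pair hb v u hu hv' (by omega)),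
      ih (bar V :: u) hu' hv' (by simp; omega), List.length_cons, pow_succ]
    rw [h.flat_perm hb (List.perm_middle : (v.map bar ++ bar V :: u).Perm _) []
      (by intro W hW; rcases List.mem_append.mp hW with hW | hW
          · exact hvb W hW
          · exact hu' W hW) (by simp) (by simp; omega)]
    simp

end CRSystem
end
end WirtingerSystem

namespace WirtingerSystem

variable {n : ℕ} {R : Type*} [CommRing R] [StarRing R] [Algebra ℂ R] [StarModule ℂ R]
  {T : Type*} {S : WirtingerSystem n R} {ρ : R} {ev : T → R →⋆ₐ[ℂ] ℂ} {L : Derivation ℂ R R}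

/-- Derivations whose top order pairings vanish. -/
def Top (S : WirtingerSystem n R) (ρ : R) (ev : T → R →⋆ₐ[ℂ] ℂ) (L : Derivation ℂ R R)
    (b : ℕ) (U : Derivation ℂ R R) : Prop :=
  U ∈ genAlg L ∧ ∀ u : List (Derivation ℂ R R), (∀ V ∈ u, V ∈ genAlg L) → u.length + 1 = b →
    ∀ q, S.beta ρ ev q (U :: u) [] = 0

lemma mem_map_bar {v : List (Derivation ℂ R R)} (hv : ∀ V ∈ v, V ∈ genAlg L) :
    ∀ V ∈ v.map bar, V ∈ genAlg L := by
  intro W hW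
  obtain ⟨X, hX, rfl⟩ := List.mem_map.mp hW
  exact bar_mem_genAlg (hv X hX)

lemma mem_replicate_genAlg {V : Derivation ℂ R R} (hV : V ∈ genAlg L) (a : ℕ) :
    ∀ W ∈ List.replicate a V, W ∈ genAlg L := by
  intro W hW
  rw [List.eq_of_mem_replicate hW]; exact hV

lemma mem_append_genAlg {u v : List (Derivation ℂ R R)} (hu : ∀ V ∈ u, V ∈ genAlg L)
    (hv : ∀ V ∈ v, V ∈ genAlg L) : ∀ V ∈ u ++ v, V ∈ genAlg L := by
  intro W hW
  rcases List.mem_append.mp hW with hW | hW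
  exacts [hu W hW, hv W hW]

lemma mem_singleton_genAlg {V : Derivation ℂ R R} (hV : V ∈ genAlg L) :
    ∀ W ∈ [V], W ∈ genAlg L := by simpa using hV

namespace CRSystem
variable (h : CRSystem S ρ ev L)
include h

lemma top_bar {b : ℕ} (hb : Flat S ρ ev L b) {U : Derivation ℂ R R} (hU : Top S ρ ev L b U) :
    Top S ρ ev L b (bar U) := by
  refine ⟨bar_mem_genAlg hU.1, fun u hu hl q => ?_⟩
  rw [← star_eq_zero, h.star_beta, h.flat_move hb _ [] (by simp)
    (by simpa using ⟨bar_mem_genAlg hU.1, hu⟩) (by simp; omega)]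
  simp only [List.map_cons, bar_bar, List.append_nil]
  rw [hU.2 _ (mem_map_bar hu) (by simpa using hl), mul_zero]

lemma top_bar_self {b : ℕ} (hb : Flat S ρ ev L b) : Top S ρ ev L b (bar L) := by
  refine ⟨bar_self_mem_genAlg L, fun u hu hl q => ?_⟩
  rw [h.flat_perm hb (u' := u ++ [bar L]) (by simpa using (List.perm_append_comm (l₁ := [bar L]) (l₂ := u)))
    [] (by simpa using ⟨bar_self_mem_genAlg L, hu⟩) (by simp) (by simp; omega)]
  exact h.beta_bar_last q u []

lemma top_self {b : ℕ} (hb : Flat S ρ ev L b) : Top S ρ ev L b L := by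
  simpa using h.top_bar hb (h.top_bar_self hb)

/-- Pairings of total order `b` containing a top derivation on the left vanish. -/
lemma top_left {b : ℕ} (hb : Flat S ρ ev L b) {U : Derivation ℂ R R} (hU : Top S ρ ev L b U)
    {u v : List (Derivation ℂ R R)} (hu : ∀ V ∈ u, V ∈ genAlg L) (hv : ∀ V ∈ v, V ∈ genAlg L)
    (hl : u.length + v.length ≤ b) (hmem : U ∈ u) (q : T) : S.beta ρ ev q u v = 0 := by
  rcases hl.lt_or_eq with hl | hl
  · exact h.flat_pair hb v u hu hv hl q
  obtain ⟨s, t, rfl⟩ := List.append_of_mem hmem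
  have hs : ∀ V ∈ s, V ∈ genAlg L := fun V hV => hu V (by simp [hV])
  have ht : ∀ V ∈ t, V ∈ genAlg L := fun V hV => hu V (by simp [hV])
  rw [h.flat_move hb v _ hu hv hl.le, h.flat_perm hb (u' := U :: (v.map bar ++ (s ++ t))) ?_ []
    (mem_append_genAlg (mem_map_bar hv) hu) (by simp) (by simp at hl ⊢; omega),
    hU.2 _ (mem_append_genAlg (mem_map_bar hv) (mem_append_genAlg hs ht))
      (by simp at hl ⊢; omega), mul_zero]
  rw [← List.append_assoc, ← List.append_assoc]
  exact List.perm_middle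

lemma top_right {b : ℕ} (hb : Flat S ρ ev L b) {U : Derivation ℂ R R} (hU : Top S ρ ev L b U)
    {u v : List (Derivation ℂ R R)} (hu : ∀ V ∈ u, V ∈ genAlg L) (hv : ∀ V ∈ v, V ∈ genAlg L)
    (hl : u.length + v.length ≤ b) (hmem : U ∈ v) (q : T) : S.beta ρ ev q u v = 0 := by
  rw [← star_eq_zero, h.star_beta]
  exact h.top_left hb hU hv hu (by omega) hmem q

/-- Polarization of words of order `b`. -/
lemma polarize {b : ℕ} (hb : Flat S ρ ev L b) (w : List (Derivation ℂ R R))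
    (hw : ∀ V ∈ w, V ∈ genAlg L) (r : ℕ) (hr : r + w.length = b) (q : T)
    (hdiag : ∀ V ∈ genAlg L, bar V = V → S.beta ρ ev q (List.replicate r V ++ w) [] = 0)
    (u : List (Derivation ℂ R R)) (hu : ∀ V ∈ u, V ∈ genAlg L) (hl : u.length = r) :
    S.beta ρ ev q (u ++ w) [] = 0 := by
  have hmem : ∀ l : List (genAlg L), ∀ V ∈ l.map (Subtype.val), V ∈ genAlg L := by
    intro l V hV
    obtain ⟨X, _, rfl⟩ := List.mem_map.mp hV
    exact X.2
  have key := polarization (M := genAlg L) (fun x => bar x.1 = x.1) ?_ ?_ r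
    (fun l => S.beta ρ ev q (l.map Subtype.val ++ w) []) ?_ ?_ ?_ ?_ (u.attachWith _ hu) (by simpa using hl)
  · simpa using key
  · intro x y hx hy s
    change bar (x.1 + (s : ℂ) • y.1) = x.1 + (s : ℂ) • y.1
    rw [bar_add, bar_smul, hx, hy]
    simp
  · intro y
    have hy := bar_mem_genAlg y.2
    refine ⟨(1 / 2 : ℂ) • (y + ⟨bar y.1, hy⟩), (-I / 2) • (y - ⟨bar y.1, hy⟩), ?_, ?_, ?_⟩
    · ext f
      simp [add_comm]
    · change bar ((-I / 2) • (y.1 - bar y.1)) = (-I / 2) • (y.1 - bar y.1)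
      ext f
      simp only [bar_apply, Derivation.smul_apply,
        Derivation.sub_apply, star_smul, star_sub, star_star]
      have : star (-I / 2) = I / 2 := by simp
      rw [this, ← neg_sub (y.1 f), smul_neg, ← neg_smul, neg_div]
    · rw [smul_smul]
      have : I * (-I / 2) = 1 / 2 := by
        rw [mul_div_assoc', mul_neg, I_mul_I, neg_neg]
      rw [this]; module
  · intro l l' hl hp
    exact h.flat_perm hb ((hp.map _).append_right w) [] (mem_append_genAlg (hmem l) hw) (by simp)
      (by simp; omega) q
  · intro x y l _
    simp [beta_add]
  · intro c x l _
    simp [beta_smul]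
  · intro V hV
    simpa using hdiag V.1 V.2 hV

end CRSystem
end WirtingerSystem

namespace WirtingerSystem

variable {n : ℕ} {R : Type*} [CommRing R] [StarRing R] [Algebra ℂ R] [StarModule ℂ R]
  {T : Type*} {S : WirtingerSystem n R} {ρ : R} {ev : T → R →⋆ₐ[ℂ] ℂ} {L : Derivation ℂ R R}

lemma sum_antidiagonal_inv_factorial_ne_zero (N : ℕ) :
    ∑ p ∈ Finset.HasAntidiagonal.antidiagonal N,
      (I ^ N / (p.1.factorial * p.2.factorial) : ℂ) ≠ 0 := by
  have h1 : ∑ p ∈ Finset.HasAntidiagonal.antidiagonal N,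
      (I ^ N / (p.1.factorial * p.2.factorial) : ℂ) = I ^ N *
      ((∑ p ∈ Finset.HasAntidiagonal.antidiagonal N,
        (1 / (p.1.factorial * p.2.factorial) : ℝ) : ℝ) : ℂ) := by
    push_cast
    rw [Finset.mul_sum]
    exact Finset.sum_congr rfl fun p _ => by ring
  rw [h1]
  refine mul_ne_zero (pow_ne_zero _ I_ne_zero) ?_
  rw [Ne, ofReal_eq_zero]
  refine (Finset.sum_pos (fun p _ => by positivity) ⟨(0, N), by simp⟩).ne'

/-- The weighted sum of pairings of order `N`. -/
def kappa (S : WirtingerSystem n R) (ρ : R) (ev : T → R →⋆ₐ[ℂ] ℂ) (q : T) (N : ℕ)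
    (V X Y : Derivation ℂ R R) : ℂ :=
  ∑ p ∈ Finset.HasAntidiagonal.antidiagonal N, I ^ p.1 * (-I) ^ p.2 / (p.1.factorial * p.2.factorial) *
    S.beta ρ ev q (List.replicate p.1 V ++ [X]) (List.replicate p.2 V ++ [Y])

lemma word_append_add (u : List (Derivation ℂ R R)) (X Y : Derivation ℂ R R) (y : ℂ) :
    S.word (u ++ [X + y • Y]) = S.word (u ++ [X]) + y • S.word (u ++ [Y]) := by
  induction u with
  | nil => simp [act_add, act_smul]
  | cons a u ih => simp only [List.cons_append, word_cons, ih, map_add, act_smul_poly]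

lemma kappa_eq (N : ℕ) (q : T) {V X Y : Derivation ℂ R R} {B : ℂ}
    (hB : ∀ a c, a + c = N → S.beta ρ ev q (List.replicate a V ++ [X]) (List.replicate c V ++ [Y]) =
      (-1) ^ c * B) :
    S.kappa ρ ev q N V X Y = (∑ p ∈ Finset.HasAntidiagonal.antidiagonal N,
      (I ^ N / (p.1.factorial * p.2.factorial) : ℂ)) * B := by
  rw [kappa, Finset.sum_mul]
  refine Finset.sum_congr rfl fun p hp => ?_
  have hp' := Finset.HasAntidiagonal.mem_antidiagonal.mp hp
  rw [hB _ _ hp', neg_pow, ← hp', pow_add]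
  have : ((-1 : ℂ) ^ p.2) * (-1) ^ p.2 = 1 := by rw [← mul_pow]; simp
  linear_combination (I ^ p.1 * I ^ p.2 / (p.1.factorial * p.2.factorial) * B) * this

namespace CRSystem
variable (h : CRSystem S ρ ev L)
include h

lemma pair_smul_complex_right (c : ℂ) (P Q : Poly n R) :
    S.pair ρ P (c • Q) = star c • S.pair ρ P Q := by
  rw [← star_star (S.pair ρ P (c • Q)), star_pair _ h.real, pair_smul_complex, star_smul,
    star_pair _ h.real]

lemma star_kappa (q : T) (N : ℕ) {V X Y : Derivation ℂ R R} :
    star (S.kappa ρ ev q N V X Y) = S.kappa ρ ev q N V Y X := by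
  rw [kappa, kappa, star_sum]
  rw [← Finset.sum_equiv (Equiv.prodComm ℕ ℕ) (s := Finset.HasAntidiagonal.antidiagonal N)]
  · intro p; simp [add_comm]
  · intro p _
    rw [star_mul', h.star_beta]
    simp only [Equiv.prodComm_apply, Prod.fst_swap, Prod.snd_swap]
    congr 1
    simp [mul_comm]

lemma kappa_add (q : T) (N : ℕ) {V X Y : Derivation ℂ R R} (y : ℂ) :
    S.kappa ρ ev q N V (X + y • Y) (X + y • Y) = S.kappa ρ ev q N V X X +
      star y * S.kappa ρ ev q N V X Y + y * S.kappa ρ ev q N V Y X +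
      y * star y * S.kappa ρ ev q N V Y Y := by
  simp only [kappa, Finset.mul_sum, ← Finset.sum_add_distrib]
  refine Finset.sum_congr rfl fun p _ => ?_
  simp only [beta, word_append_add, map_add, AddMonoidHom.add_apply, pair_smul_complex,
    h.pair_smul_complex_right, map_smul, smul_eq_mul]
  ring

lemma kappa_zero {N : ℕ} (hN : Odd N) (hb : Flat S ρ ev L (N + 1)) {V : Derivation ℂ R R}
    (hV : V ∈ genAlg L) (hVr : bar V = V) {X Y : Derivation ℂ R R}
    (hX : Top S ρ ev L (N + 1) X) (hY : Top S ρ ev L (N + 1) Y) (q : T) :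
    S.kappa ρ ev q N V X Y = 0 := by
  have hr := mem_replicate_genAlg hV
  have hpos : ∀ y : ℂ, (S.kappa ρ ev q N V (X + y • Y) (X + y • Y)).re = 0 := by
    intro y
    have hU : Top S ρ ev L (N + 1) (X + y • Y) := by
      refine ⟨add_mem hX.1 ((genAlg L).smul_mem _ hY.1), fun u hu hl q => ?_⟩
      rw [beta_add, beta_smul, hX.2 u hu hl, hY.2 u hu hl]; simp
    have hs := mem_singleton_genAlg hU.1
    refine h.pos q V hV hVr _ hU.1 N hN ?_ ?_ ?_
    · intro a c hac
      exact h.flat_pair hb _ _ (hr a) (hr c) (by simp; omega) q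
    · intro a c hac
      exact h.top_left hb hU (mem_append_genAlg (hr a) hs) (hr c) (by simp; omega) (by simp) q
    · intro a c hac
      exact h.top_left hb hU (mem_append_genAlg (hr a) hs) (mem_append_genAlg (hr c) hs)
        (by simp; omega) (by simp) q
  have h0 := hpos 0
  have h1 := hpos 1
  have h2 := hpos (-1)
  have h3 := hpos I
  have h4 := hpos (-I)
  rw [h.kappa_add, ← h.star_kappa q N (X := X) (Y := Y)] at h0 h1 h2 h3 h4
  apply Complex.ext
  · simp at h0 h1 h2 ⊢; linarith
  · simp at h0 h3 h4 ⊢; linarith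

lemma lie_top_one {W : Derivation ℂ R R}
    (hW : Top S ρ ev L 1 W) : Top S ρ ev L 1 ⁅bar L, W⁆ := by
  refine ⟨(genAlg L).lie_mem (bar_self_mem_genAlg L) hW.1, fun u hu hl q => ?_⟩
  obtain rfl : u = [] := by simpa using hl
  have h0 : ∀ q, S.beta ρ ev q [W] [] = 0 := fun q => hW.2 [] (by simp) rfl q
  have e := h.transfer (self_mem_genAlg L) [W] [] h0 q
  rw [beta_lie, show [W, bar L] = [W] ++ [bar L] from rfl, h.beta_bar_last q [W] [], sub_zero, ← neg_eq_zero, ← e]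
  exact h.null q W hW.1 (h0 q)

lemma lie_top_even {N : ℕ} (hN : Odd N) (hb : Flat S ρ ev L (N + 1)) {W : Derivation ℂ R R}
    (hW : Top S ρ ev L (N + 1) W) : Top S ρ ev L (N + 1) ⁅bar L, W⁆ := by
  have hZ : ⁅bar L, W⁆ ∈ genAlg L := (genAlg L).lie_mem (bar_self_mem_genAlg L) hW.1
  have hLt := h.top_self hb
  have hWs := mem_singleton_genAlg hW.1
  have hLs := mem_singleton_genAlg (self_mem_genAlg L)
  suffices hbar : Top S ρ ev L (N + 1) (bar ⁅bar L, W⁆) by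
    simpa using h.top_bar hb hbar
  refine ⟨bar_mem_genAlg hZ, fun u hu hl q => ?_⟩
  rw [h.flat_perm hb (u' := u ++ [bar ⁅bar L, W⁆])
    (by simpa using (List.perm_append_comm (l₁ := [bar ⁅bar L, W⁆]) (l₂ := u)))
    [] (by simpa using ⟨bar_mem_genAlg hZ, hu⟩) (by simp) (by simp; omega)]
  refine h.polarize hb _ (by simpa using bar_mem_genAlg hZ) N (by simp) q ?_ u hu (by omega)
  intro V hV hVr
  have hr := mem_replicate_genAlg hV
  have hk := h.kappa_zero hN hb hV hVr hLt hW q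
  have hB : ∀ c a, a + c = N → S.beta ρ ev q (List.replicate a V ++ [L]) (List.replicate c V ++ [W]) =
      (-1) ^ c * S.beta ρ ev q (List.replicate N V ++ [L]) [W] := by
    intro c
    induction c with
    | zero => intro a ha; simp [← ha]
    | succ c ih =>
      intro a ha
      rw [List.replicate_succ, List.cons_append, h.transfer hV _ _ ?_ q, hVr,
        ← List.cons_append, ← List.replicate_succ, ih (a + 1) (by omega)]
      · ring
      · exact fun q => h.top_left hb hLt (mem_append_genAlg (hr a) hLs)
          (mem_append_genAlg (hr c) hWs) (by simp; omega) (by simp) q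
  rw [kappa_eq N q (fun a c hac => hB c a hac)] at hk
  have hk' := (mul_eq_zero.mp hk).resolve_left (sum_antidiagonal_inv_factorial_ne_zero N)
  have hlow : ∀ u v : List (Derivation ℂ R R), (∀ V ∈ u, V ∈ genAlg L) →
      (∀ V ∈ v, V ∈ genAlg L) → u.length + v.length < N + 1 →
      ∀ q, S.beta ρ ev q u (v ++ [W]) = 0 := fun u v hu hv hl q =>
    h.top_right hb hW hu (mem_append_genAlg hv hWs) (by simp; omega) (by simp) q
  have e1 := h.perm_of_lower hlow (u := List.replicate N V ++ [L]) (u' := L :: List.replicate N V)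
    (by simpa using (List.perm_append_comm (l₁ := List.replicate N V) (l₂ := [L]))) []
    (mem_append_genAlg (hr N) hLs) (by simp) (by simp) q
  rw [List.nil_append, hk'] at e1
  have e2 := h.transfer (bar_self_mem_genAlg L) (List.replicate N V) [W]
    (fun q => hlow (List.replicate N V) [] (hr N) (by simp) (by simp) q) q
  rw [bar_bar, ← e1, neg_zero] at e2
  have e3 : S.beta ρ ev q (List.replicate N V) [⁅bar L, W⁆] = 0 := by
    rw [← star_eq_zero, h.star_beta, beta_lie, ← h.star_beta, e2,
      show [W, bar L] = [W] ++ [bar L] from rfl, h.beta_bar_last q [W]]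
    simp
  rw [h.flat_move hb _ _ (hr N) (by simpa using hZ) (by simp)] at e3
  have e4 : S.beta ρ ev q (bar ⁅bar L, W⁆ :: List.replicate N V) [] = 0 := by
    simpa using e3
  rw [← e4]
  exact h.flat_perm hb (by simpa using
    (List.perm_append_comm (l₂ := [bar ⁅bar L, W⁆]) (l₁ := List.replicate N V))) []
    (mem_append_genAlg (hr N) (by simpa using bar_mem_genAlg hZ)) (by simp) (by simp) q

lemma flat_succ_of_lie {b : ℕ} (hb1 : 1 ≤ b) (hb : Flat S ρ ev L b)
    (hlie : ∀ W, Top S ρ ev L b W → Top S ρ ev L b ⁅bar L, W⁆) : Flat S ρ ev L (b + 1) := by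
  have hlie' : ∀ W, Top S ρ ev L b W → Top S ρ ev L b ⁅L, W⁆ := fun W hW => by
    have := h.top_bar hb (hlie _ (h.top_bar hb hW))
    rwa [bar_lie, bar_bar, bar_bar] at this
  have hadd : ∀ X Y, Top S ρ ev L b X → Top S ρ ev L b Y → Top S ρ ev L b (X + Y) := by
    intro X Y hX hY
    refine ⟨add_mem hX.1 hY.1, fun u hu hl q => ?_⟩
    rw [beta_add, hX.2 u hu hl, hY.2 u hu hl, add_zero]
  have hsmul : ∀ (c : ℂ) X, Top S ρ ev L b X → Top S ρ ev L b (c • X) := by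
    intro c X hX
    refine ⟨(genAlg L).smul_mem c hX.1, fun u hu hl q => ?_⟩
    rw [beta_smul, hX.2 u hu hl, mul_zero]
  have hzero : Top S ρ ev L b 0 := by
    simpa using hsmul 0 _ (h.top_self hb)
  have hideal : ∀ V ∈ genAlg L, ∀ W, Top S ρ ev L b W → Top S ρ ev L b ⁅V, W⁆ := by
    intro V hV
    refine LieSubalgebra.lieSpan_induction
      (p := fun V _ => ∀ W, Top S ρ ev L b W → Top S ρ ev L b ⁅V, W⁆) ℂ ?_ ?_ ?_ ?_ ?_ hV
    · rintro x (rfl | rfl)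
      exacts [hlie', hlie]
    · intro W _; rw [zero_lie]; exact hzero
    · intro x y _ _ hx hy W hW; rw [add_lie]; exact hadd _ _ (hx W hW) (hy W hW)
    · intro a x _ hx W hW; rw [smul_lie]; exact hsmul _ _ (hx W hW)
    · intro x y _ _ hx hy W hW
      rw [lie_lie, sub_eq_add_neg, ← neg_one_smul ℂ]
      exact hadd _ _ (hx _ (hy W hW)) (hsmul _ _ (hy _ (hx W hW)))
  have hall : ∀ V ∈ genAlg L, Top S ρ ev L b V := by
    intro V hV
    refine LieSubalgebra.lieSpan_induction
      (p := fun V _ => Top S ρ ev L b V) ℂ ?_ ?_ ?_ ?_ ?_ hV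
    · rintro x (rfl | rfl)
      exacts [h.top_self hb, h.top_bar_self hb]
    · exact hzero
    · intro x y _ _ hx hy; exact hadd _ _ hx hy
    · intro a x _ hx; exact hsmul _ _ hx
    · intro x y hx _ _ hy; exact hideal x hx y hy
  intro u hu hl q
  rcases (Nat.lt_succ_iff.mp hl).lt_or_eq with hl | hl
  · exact hb u hu hl q
  match u, hl with
  | [], hl => simp at hl; omega
  | V :: u, hl =>
    exact (hall V (hu V (by simp))).2 u (fun W hW => hu W (by simp [hW])) (by simpa using hl) q

lemma flat_succ_odd {N : ℕ} (hN : Odd N) (hb : Flat S ρ ev L (N + 2)) :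
    Flat S ρ ev L (N + 2 + 1) := by
  intro u hu hl q
  rcases (Nat.lt_succ_iff.mp hl).lt_or_eq with hl | hl
  · exact hb u hu hl q
  rw [← List.append_nil u]
  refine h.polarize hb [] (by simp) (N + 2) (by simp) q ?_ u hu hl
  intro V hV hVr
  rw [List.append_nil]
  have hr := mem_replicate_genAlg hV
  have hs := mem_singleton_genAlg hV
  have hpos : (S.kappa ρ ev q N V V V).re = 0 := by
    refine h.pos q V hV hVr V hV N hN ?_ ?_ ?_
    · intro a c hac
      exact h.flat_pair hb _ _ (hr a) (hr c) (by simp; omega) q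
    · intro a c hac
      exact h.flat_pair hb _ _ (mem_append_genAlg (hr a) hs) (hr c) (by simp; omega) q
    · intro a c hac
      exact h.flat_pair hb _ _ (mem_append_genAlg (hr a) hs) (mem_append_genAlg (hr c) hs)
        (by simp; omega) q
  have hmv : ∀ a c, a + c = N + 2 → S.beta ρ ev q (List.replicate a V) (List.replicate c V) =
      (-1) ^ c * S.beta ρ ev q (List.replicate (N + 2) V) [] := by
    intro a c hac
    rw [h.flat_move hb _ _ (hr a) (hr c) (by simp; omega)]
    simp [hVr, hac.symm, add_comm]
  rw [kappa_eq (B := -S.beta ρ ev q (List.replicate (N + 2) V) []) N q] at hpos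
  · have hconj : star (S.beta ρ ev q (List.replicate (N + 2) V) []) =
        - S.beta ρ ev q (List.replicate (N + 2) V) [] := by
      rw [h.star_beta]
      have := hmv 0 (N + 2) (by omega)
      rw [List.replicate_zero] at this
      rw [this, (hN.add_even (by decide : Even 2)).neg_one_pow]; ring
    have hre : (S.beta ρ ev q (List.replicate (N + 2) V) []).re = 0 := by
      have := congrArg Complex.re hconj
      simp at this; linarith
    set Kc := ∑ p ∈ Finset.HasAntidiagonal.antidiagonal N,
      (I ^ N / (p.1.factorial * p.2.factorial) : ℂ) with hKc
    have hK0 : Kc ≠ 0 := sum_antidiagonal_inv_factorial_ne_zero N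
    have hKre : Kc.re = 0 := by
      have : star Kc = -Kc := by
        rw [hKc, star_sum, ← Finset.sum_neg_distrib]
        refine Finset.sum_congr rfl fun p _ => ?_
        simp only [RCLike.star_def, map_div₀, map_pow, conj_I, map_mul, map_natCast, hN.neg_pow]
        ring
      have := congrArg Complex.re this
      simp at this; linarith
    have hKim : Kc.im ≠ 0 := fun h' => hK0 (Complex.ext hKre h')
    rw [Complex.mul_re, hKre, zero_mul, zero_sub, neg_im, mul_neg, neg_neg] at hpos
    exact Complex.ext hre ((mul_eq_zero.mp hpos).resolve_left hKim)
  · intro a c hac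
    have e : ∀ a : ℕ, List.replicate a V ++ [V] = List.replicate (a + 1) V := fun a =>
      (List.replicate_succ' ..).symm
    rw [e, e, hmv _ _ (by omega), pow_succ]; ring

/-- All pairings of words in the generated Lie algebra vanish. -/
theorem beta_eq_zero (q : T) (u v : List (Derivation ℂ R R)) (hu : ∀ V ∈ u, V ∈ genAlg L)
    (hv : ∀ V ∈ v, V ∈ genAlg L) : S.beta ρ ev q u v = 0 := by
  have hflat : ∀ b, Flat S ρ ev L (b + 1) := by
    intro b
    induction b with
    | zero =>
      intro u _ hl q
      obtain rfl : u = [] := by simpa using hl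
      simp [beta, vac, pair_single, h.vanish]
    | succ b ih =>
      rcases Nat.even_or_odd b with hev | hodd
      · rcases b with _ | _ | b
        · exact h.flat_succ_of_lie le_rfl ih fun W hW => h.lie_top_one hW
        · exact absurd hev (by decide)
        · have : Odd (b + 1) := by
            rcases hev with ⟨k, hk⟩; exact ⟨k - 1, by omega⟩
          exact h.flat_succ_odd this ih
      · exact h.flat_succ_of_lie (by omega) ih fun W hW => h.lie_top_even hodd ih hW
  exact h.flat_pair (hflat (u.length + v.length)) v u hu hv (by omega) q

end CRSystem
end WirtingerSystem

/-- The star algebra of smooth complex-valued functions. -/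
def smoothAlg (n : ℕ) : StarSubalgebra ℂ ((Fin n → ℂ) → ℂ) where
  carrier := {f | ContDiff ℝ (⊤ : ℕ∞) f}
  mul_mem' {f g} (hf : ContDiff ℝ _ f) (hg : ContDiff ℝ _ g) :=
    show ContDiff ℝ (⊤ : ℕ∞) _ from ContDiff.mul hf hg
  add_mem' {f g} (hf : ContDiff ℝ _ f) (hg : ContDiff ℝ _ g) :=
    show ContDiff ℝ (⊤ : ℕ∞) _ from ContDiff.add hf hg
  algebraMap_mem' c := show ContDiff ℝ (⊤ : ℕ∞) fun _ => c from contDiff_const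
  star_mem' {f} (hf : ContDiff ℝ _ f) :=
    show ContDiff ℝ (⊤ : ℕ∞) _ from Complex.conjCLE.contDiff.comp hf

namespace smoothAlg
variable {n : ℕ}

protected lemma contDiff (f : smoothAlg n) : ContDiff ℝ (⊤ : ℕ∞) (f : (Fin n → ℂ) → ℂ) := f.2

protected lemma differentiable (f : smoothAlg n) : Differentiable ℝ (f : (Fin n → ℂ) → ℂ) :=
  (smoothAlg.contDiff f).differentiable (by simp)

lemma contDiff_fderiv_apply {F : Type*} [NormedAddCommGroup F] [NormedSpace ℝ F]
    {f : (Fin n → ℂ) → F} (hf : ContDiff ℝ (⊤ : ℕ∞) f) (v : Fin n → ℂ) :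
    ContDiff ℝ (⊤ : ℕ∞) fun z => fderiv ℝ f z v :=
  (hf.fderiv_right (m := (⊤ : ℕ∞)) (by simp)).clm_apply contDiff_const

/-- The directional derivative as a derivation. -/
def dirDer (v : Fin n → ℂ) : Derivation ℂ (smoothAlg n) (smoothAlg n) where
  toFun f := ⟨fun z => fderiv ℝ (f : (Fin n → ℂ) → ℂ) z v, contDiff_fderiv_apply (smoothAlg.contDiff f) v⟩
  map_add' f g := by
    ext z
    exact DFunLike.congr_fun (fderiv_add (smoothAlg.differentiable f z) (smoothAlg.differentiable g z)) v
  map_smul' c f := by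
    ext z
    exact DFunLike.congr_fun (fderiv_const_smul (smoothAlg.differentiable f z) c) v
  map_one_eq_zero' := by
    ext z
    exact DFunLike.congr_fun (fderiv_const_apply (𝕜 := ℝ) (x := z) (1 : ℂ)) v
  leibniz' f g := by
    ext z
    have := DFunLike.congr_fun (fderiv_mul (smoothAlg.differentiable f z) (smoothAlg.differentiable g z)) v
    exact this

lemma dirDer_apply (v : Fin n → ℂ) (f : smoothAlg n) (z : Fin n → ℂ) :
    (dirDer v f : (Fin n → ℂ) → ℂ) z = fderiv ℝ (f : (Fin n → ℂ) → ℂ) z v := rfl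

lemma dirDer_comm (v w : Fin n → ℂ) (f : smoothAlg n) :
    dirDer v (dirDer w f) = dirDer w (dirDer v f) := by
  ext z
  have hs : IsSymmSndFDerivAt ℝ (f : (Fin n → ℂ) → ℂ) z :=
    (smoothAlg.contDiff f).contDiffAt.isSymmSndFDerivAt (by
      rw [minSmoothness_of_isRCLikeNormedField]; exact WithTop.coe_le_coe.mpr le_top)
  have hd : DifferentiableAt ℝ (fderiv ℝ (f : (Fin n → ℂ) → ℂ)) z :=
    ((smoothAlg.contDiff f).fderiv_right (m := (⊤ : ℕ∞)) (by simp)).differentiable (by simp) z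
  have key : ∀ a b, (dirDer a (dirDer b f) : (Fin n → ℂ) → ℂ) z =
      fderiv ℝ (fderiv ℝ (f : (Fin n → ℂ) → ℂ)) z a b := by
    intro a b
    change fderiv ℝ (fun y => fderiv ℝ (f : (Fin n → ℂ) → ℂ) y b) z a = _
    rw [fderiv_clm_apply hd (differentiableAt_const b)]
    simp
  rw [key, key]
  exact hs v w

lemma dirDer_star (v : Fin n → ℂ) (f : smoothAlg n) : dirDer v (star f) = star (dirDer v f) := by
  ext z
  change fderiv ℝ (fun y => Complex.conjCLE ((f : (Fin n → ℂ) → ℂ) y)) z v = _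
  rw [show (fun y => Complex.conjCLE ((f : (Fin n → ℂ) → ℂ) y)) = Complex.conjCLE ∘ f from rfl,
    ContinuousLinearEquiv.comp_fderiv]
  simp [dirDer_apply]

/-- The Wirtinger derivations on smooth functions. -/
def wirt (n : ℕ) : WirtingerSystem n (smoothAlg n) where
  D j := (1 / 2 : ℂ) • (dirDer (Pi.single j 1) - I • dirDer (Pi.single j I))
  Db j := (1 / 2 : ℂ) • (dirDer (Pi.single j 1) + I • dirDer (Pi.single j I))
  z j := ⟨fun z => z j, show ContDiff ℝ (⊤ : ℕ∞) _ from contDiff_apply ℝ ℂ j⟩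
  D_comm i j f := by
    simp only [Derivation.smul_apply, Derivation.sub_apply, map_smul, map_sub, Derivation.map_smul,
      dirDer_comm (Pi.single i _)]
    module
  D_Db_comm i j f := by
    simp only [Derivation.smul_apply, Derivation.sub_apply, Derivation.add_apply, map_add,
      map_sub, Derivation.map_smul, dirDer_comm (Pi.single i _)]
    module
  Db_star j f := by
    simp [dirDer_star, smul_neg, sub_eq_add_neg]

lemma D_apply (j : Fin n) (f : smoothAlg n) (z : Fin n → ℂ) :
    ((wirt n).D j f : (Fin n → ℂ) → ℂ) z = dz j (f : (Fin n → ℂ) → ℂ) z := by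
  change (1 / 2 : ℂ) * (fderiv ℝ (f : (Fin n → ℂ) → ℂ) z (Pi.single j 1) -
    I * fderiv ℝ (f : (Fin n → ℂ) → ℂ) z (Pi.single j I)) = _
  rw [dz]; ring

lemma Db_apply (j : Fin n) (f : smoothAlg n) (z : Fin n → ℂ) :
    ((wirt n).Db j f : (Fin n → ℂ) → ℂ) z = dzbar j (f : (Fin n → ℂ) → ℂ) z := by
  change (1 / 2 : ℂ) * (fderiv ℝ (f : (Fin n → ℂ) → ℂ) z (Pi.single j 1) +
    I * fderiv ℝ (f : (Fin n → ℂ) → ℂ) z (Pi.single j I)) = _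
  rw [dzbar]; ring

@[simp] lemma z_apply (j : Fin n) (z : Fin n → ℂ) :
    ((wirt n).z j : (Fin n → ℂ) → ℂ) z = z j := rfl

/-- Evaluation at a point. -/
def ev (q : Fin n → ℂ) : smoothAlg n →⋆ₐ[ℂ] ℂ where
  toFun f := (f : (Fin n → ℂ) → ℂ) q
  map_one' := rfl
  map_mul' _ _ := rfl
  map_zero' := rfl
  map_add' _ _ := rfl
  commutes' _ := rfl
  map_star' _ := rfl

lemma ev_apply (q : Fin n → ℂ) (f : smoothAlg n) : ev q f = (f : (Fin n → ℂ) → ℂ) q := rfl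

end smoothAlg

section wirtinger
variable {n : ℕ}

/-- A real-linear functional in terms of its Wirtinger components. -/
lemma fderiv_eq_dz (f : (Fin n → ℂ) → ℂ) (z v : Fin n → ℂ) :
    fderiv ℝ f z v = ∑ j, (v j * dz j f z + (starRingEnd ℂ) (v j) * dzbar j f z) := by
  have hv : v = ∑ j, ((v j).re • (Pi.single j 1 : Fin n → ℂ) + (v j).im • (Pi.single j I : Fin n → ℂ)) := by
    ext k
    simp only [Finset.sum_apply, Pi.add_apply, Pi.smul_apply, Pi.single_apply, smul_ite, smul_zero]
    rw [Finset.sum_eq_single k]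
    · simp
    · intro b _ hb; simp [hb.symm]
    · simp
  conv_lhs => rw [hv]
  rw [map_sum]
  refine Finset.sum_congr rfl fun j _ => ?_
  rw [map_add, map_smul, map_smul, dz, dzbar]
  have h1 : (v j) = (v j).re + (v j).im * I := (re_add_im _).symm
  have h2 : (starRingEnd ℂ) (v j) = (v j).re - (v j).im * I := by
    apply Complex.ext <;> simp
  rw [h2]
  conv_rhs => rw [h1]
  simp only [real_smul]
  simp only [add_re, ofReal_re, mul_re, ofReal_im, I_re, I_im, add_im, mul_im]
  push_cast
  ring_nf
  simp only [I_sq]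
  ring

lemma fderiv_eq_dirDeriv (f : (Fin n → ℂ) → ℂ) (z v : Fin n → ℂ) :
    fderiv ℝ f z v = dirDeriv v f z + dirDerivBar v f z := by
  rw [fderiv_eq_dz, Finset.sum_add_distrib]; rfl

end wirtinger

/-- `f` has the asymptotic expansion `φ` at `0`, up to an error of order `N`. -/
def HasExp (N : ℕ) (f : ℝ → ℂ) (φ : PowerSeries ℂ) : Prop :=
  ∃ p : Polynomial ℂ, (∀ k < N, p.coeff k = PowerSeries.coeff k φ) ∧
    (fun s : ℝ => f s - p.eval (s : ℂ)) =O[𝓝 0] fun s : ℝ => s ^ N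

lemma isBigO_eval_of_coeff_eq_zero {N : ℕ} {p : Polynomial ℂ} (hp : ∀ k < N, p.coeff k = 0) :
    (fun s : ℝ => p.eval (s : ℂ)) =O[𝓝 0] fun s : ℝ => s ^ N := by
  obtain ⟨r, rfl⟩ := Polynomial.X_pow_dvd_iff.mpr hp
  have h1 : (fun s : ℝ => r.eval (s : ℂ)) =O[𝓝 0] fun _ : ℝ => (1 : ℝ) := by
    exact ((r.continuous.comp continuous_ofReal).tendsto 0).isBigO_one ℝ
  have h2 : (fun s : ℝ => ((s : ℂ)) ^ N) =O[𝓝 0] fun s : ℝ => s ^ N := by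
    refine Asymptotics.IsBigO.of_norm_left (Asymptotics.IsBigO.of_norm_right ?_)
    simpa using Asymptotics.isBigO_refl _ _
  simpa using h2.mul h1

namespace HasExp
variable {N : ℕ} {f g : ℝ → ℂ} {φ ψ : PowerSeries ℂ}

lemma trunc (h : HasExp N f φ) :
    (fun s : ℝ => f s - (PowerSeries.trunc N φ).eval (s : ℂ)) =O[𝓝 0] fun s : ℝ => s ^ N := by
  obtain ⟨p, hp, hO⟩ := h
  have := isBigO_eval_of_coeff_eq_zero (N := N) (p := p - PowerSeries.trunc N φ) (fun k hk => by
    simp [PowerSeries.coeff_trunc, hk, hp k hk])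
  refine (hO.add this).congr_left fun s => ?_
  simp

lemma isBigO_one (h : HasExp N f φ) : f =O[𝓝 0] fun _ : ℝ => (1 : ℝ) := by
  obtain ⟨p, hp, hO⟩ := h
  have h1 : (fun s : ℝ => p.eval (s : ℂ)) =O[𝓝 0] fun _ : ℝ => (1 : ℝ) :=
    ((p.continuous.comp continuous_ofReal).tendsto 0).isBigO_one ℝ
  have h2 : (fun s : ℝ => s ^ N) =O[𝓝 0] fun _ : ℝ => (1 : ℝ) :=
    ((continuous_pow N).tendsto 0).isBigO_one ℝ
  refine ((hO.trans h2).add h1).congr_left fun s => ?_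
  simp

lemma add (hf : HasExp N f φ) (hg : HasExp N g ψ) : HasExp N (fun s => f s + g s) (φ + ψ) := by
  obtain ⟨p, hp, hO⟩ := hf
  obtain ⟨q, hq, hO'⟩ := hg
  refine ⟨p + q, fun k hk => by simp [hp k hk, hq k hk], (hO.add hO').congr_left fun s => ?_⟩
  simp; ring

lemma zero (N : ℕ) : HasExp N (fun _ => 0) 0 :=
  ⟨0, by simp, by simpa using Asymptotics.isBigO_zero _ _⟩

lemma sum {ι : Type*} (t : Finset ι) {F : ι → ℝ → ℂ} {Φ : ι → PowerSeries ℂ}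
    (h : ∀ i ∈ t, HasExp N (F i) (Φ i)) : HasExp N (fun s => ∑ i ∈ t, F i s) (∑ i ∈ t, Φ i) := by
  classical
  induction t using Finset.induction_on with
  | empty => simpa using zero N
  | insert a t ha ih =>
    simp only [Finset.sum_insert ha]
    exact (h a (by simp)).add (ih fun i hi => h i (by simp [hi]))

lemma mul (hf : HasExp N f φ) (hg : HasExp N g ψ) : HasExp N (fun s => f s * g s) (φ * ψ) := by
  have hg1 := hg.isBigO_one
  obtain ⟨p, hp, hO⟩ := hf
  obtain ⟨q, hq, hO'⟩ := hg
  refine ⟨p * q, fun k hk => ?_, ?_⟩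
  · rw [Polynomial.coeff_mul, PowerSeries.coeff_mul]
    refine Finset.sum_congr rfl fun x hx => ?_
    have := Finset.HasAntidiagonal.mem_antidiagonal.mp hx
    rw [hp _ (by omega), hq _ (by omega)]
  · have h1 : (fun s : ℝ => p.eval (s : ℂ)) =O[𝓝 0] fun _ : ℝ => (1 : ℝ) :=
      ((p.continuous.comp continuous_ofReal).tendsto 0).isBigO_one ℝ
    have := (hO.mul hg1).add ((h1.mul hO').congr_right (g₂ := fun s => s ^ N * 1) fun s => by ring)
    refine (this.congr_left fun s => ?_).congr_right fun s => by ring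
    simp; ring

lemma conj (hf : HasExp N f φ) :
    HasExp N (fun s => (starRingEnd ℂ) (f s)) (PowerSeries.map (starRingEnd ℂ) φ) := by
  obtain ⟨p, hp, hO⟩ := hf
  refine ⟨p.map (starRingEnd ℂ), fun k hk => by simp [hp k hk], ?_⟩
  refine hO.norm_left.congr_left (fun s => ?_) |>.of_norm_left
  rw [← Complex.norm_conj, map_sub]
  congr 2
  conv_rhs => rw [← Complex.conj_ofReal s]
  rw [Polynomial.eval_map, Polynomial.eval₂_hom]

lemma eval (p : Polynomial ℂ) (h : ∀ k < N, p.coeff k = PowerSeries.coeff k φ) :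
    HasExp N (fun s => p.eval (s : ℂ)) φ :=
  ⟨p, h, by simpa using Asymptotics.isBigO_zero _ _⟩

lemma const (N : ℕ) (c : ℂ) : HasExp N (fun _ => c) (PowerSeries.C c) := by
  have := eval (N := N) (φ := PowerSeries.C c) (Polynomial.C c) (fun k _ => by
    rw [← Polynomial.coeff_coe, Polynomial.coe_C])
  simpa using this

lemma of_deriv {f' : ℝ → ℂ} (hd : ∀ s, HasDerivAt f (f' s) s)
    (h : HasExp N f' (PowerSeries.derivative ℂ φ)) (h0 : f 0 = PowerSeries.constantCoeff φ) :
    HasExp (N + 1) f φ := by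
  refine ⟨PowerSeries.trunc (N + 1) φ, fun k hk => by simp [PowerSeries.coeff_trunc, hk], ?_⟩
  set P := PowerSeries.trunc (N + 1) φ with hP
  obtain ⟨p, hp, hO⟩ := h
  have h1 : (fun s : ℝ => f' s - P.derivative.eval (s : ℂ)) =O[𝓝 0] fun s : ℝ => s ^ N := by
    have := isBigO_eval_of_coeff_eq_zero (N := N) (p := p - P.derivative) (fun k hk => by
      simp [hP, Polynomial.coeff_derivative, PowerSeries.coeff_trunc, hk, hp k hk,
        PowerSeries.coeff_derivative])
    refine (hO.add this).congr_left fun s => ?_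
    simp
  obtain ⟨C, hC⟩ := h1.bound
  obtain ⟨ε, hε, hball⟩ := Metric.eventually_nhds_iff_ball.mp hC
  refine Asymptotics.IsBigO.of_bound C ?_
  filter_upwards [Metric.ball_mem_nhds (0 : ℝ) hε] with s hs
  have hF : ∀ x : ℝ, HasDerivAt (fun s : ℝ => f s - P.eval (s : ℂ))
      (f' x - P.derivative.eval (x : ℂ)) x := fun x =>
    (hd x).sub ((P.hasDerivAt (x : ℂ)).comp_ofReal)
  have hzero : f 0 - P.eval ((0 : ℝ) : ℂ) = 0 := by
    rw [h0, hP, ofReal_zero, ← Polynomial.coeff_zero_eq_eval_zero]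
    simp [PowerSeries.coeff_trunc]
  have key := Convex.norm_image_sub_le_of_norm_hasDerivWithin_le
    (f := fun s : ℝ => f s - P.eval (s : ℂ)) (s := Set.uIcc 0 s) (x := 0) (y := s)
    (C := C * ‖s‖ ^ N) (fun x _ => (hF x).hasDerivWithinAt) (fun x hx => ?_) (convex_uIcc _ _)
    Set.left_mem_uIcc Set.right_mem_uIcc
  · simp only [hzero, sub_zero] at key
    refine key.trans (le_of_eq ?_)
    rw [norm_pow, pow_succ]; ring
  · have hxs : ‖x‖ ≤ ‖s‖ := by
      have := Set.abs_sub_left_of_mem_uIcc hx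
      simpa using this
    have hx' : x ∈ Metric.ball (0 : ℝ) ε := by
      rw [mem_ball_zero_iff] at hs ⊢; exact hxs.trans_lt hs
    have hb := hball x hx'
    rw [norm_pow] at hb
    have hC0 : 0 ≤ C ∨ ‖x‖ ^ N = 0 := by
      by_cases h : ‖x‖ ^ N = 0
      · exact Or.inr h
      · left
        have hpos : 0 < ‖x‖ ^ N := lt_of_le_of_ne (by positivity) (Ne.symm h)
        by_contra hneg
        push Not at hneg
        have := norm_nonneg (f' x - P.derivative.eval (x : ℂ))
        nlinarith
    have hC0' : 0 ≤ C := by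
      have h2 := hball (ε / 2) (by rw [mem_ball_zero_iff, Real.norm_eq_abs, abs_of_pos (by positivity)]; linarith)
      by_contra hneg
      push Not at hneg
      have hp : 0 < ‖(ε / 2) ^ N‖ := by rw [norm_pos_iff]; positivity
      have := norm_nonneg (f' (ε / 2) - P.derivative.eval (((ε / 2 : ℝ)) : ℂ))
      nlinarith
    exact hb.trans (mul_le_mul_of_nonneg_left (pow_le_pow_left₀ (norm_nonneg _) hxs _) hC0')

/-- The lowest coefficient is a limit. -/
lemma tendsto_coeff {N : ℕ} (h : HasExp (N + 1) f φ) (hlow : ∀ k < N, PowerSeries.coeff k φ = 0) :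
    (fun s : ℝ => f s - PowerSeries.coeff N φ * (s : ℂ) ^ N) =O[𝓝 0] fun s : ℝ => s ^ (N + 1) := by
  obtain ⟨p, hp, hO⟩ := h
  have := isBigO_eval_of_coeff_eq_zero (N := N + 1)
    (p := p - Polynomial.C (PowerSeries.coeff N φ) * Polynomial.X ^ N) (fun k hk => by
      rw [Polynomial.coeff_sub, Polynomial.coeff_C_mul_X_pow, hp k hk]
      split_ifs with h
      · simp [h]
      · rw [hlow k (by omega)]; simp)
  refine (hO.add this).congr_left fun s => ?_
  simp

lemma isBigO_of_coeff_eq_zero (h : HasExp N f φ) (hlow : ∀ k < N, PowerSeries.coeff k φ = 0) :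
    f =O[𝓝 0] fun s : ℝ => s ^ N := by
  obtain ⟨p, hp, hO⟩ := h
  have := isBigO_eval_of_coeff_eq_zero (N := N) (p := p) (fun k hk => by rw [hp k hk, hlow k hk])
  refine (hO.add this).congr_left fun s => ?_
  simp

end HasExp

set_option linter.unusedSectionVars false

namespace WirtingerSystem

variable {n : ℕ} {R : Type*} [CommRing R] [StarRing R] [Algebra ℂ R] [StarModule ℂ R]
  (S : WirtingerSystem n R) (e : R →⋆ₐ[ℂ] ℂ) (V : Derivation ℂ R R) (w : ℂ)

/-- The formal flow of `V`, acting on functions. -/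
def flowSeries (f : R) : PowerSeries ℂ :=
  PowerSeries.mk fun a => w ^ a / a.factorial * e (V^[a] f)

/-- The formal expansion of the pairing along the flow. -/
def pairSeries (G : R) (P Q : Poly n R) : PowerSeries ℂ :=
  PowerSeries.mk fun N => ∑ p ∈ Finset.HasAntidiagonal.antidiagonal N,
    w ^ p.1 * (starRingEnd ℂ w) ^ p.2 / (p.1.factorial * p.2.factorial) *
      e (S.pair G ((S.act V)^[p.1] P) ((S.act V)^[p.2] Q))

lemma coeff_flowSeries_zero (f : R) : PowerSeries.coeff 0 (flowSeries e V w f) = e f := by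
  simp [flowSeries]

lemma coeff_flowSeries_succ (f : R) (a : ℕ) :
    (a + 1 : ℂ) * PowerSeries.coeff (a + 1) (flowSeries e V w f) =
      w * PowerSeries.coeff a (flowSeries e V w (V f)) := by
  have h1 : (a + 1 : ℂ) ≠ 0 := by exact_mod_cast a.succ_ne_zero
  have h2 : (a.factorial : ℂ) ≠ 0 := by exact_mod_cast a.factorial_ne_zero
  simp only [flowSeries, PowerSeries.coeff_mk, Function.iterate_succ_apply, Nat.factorial_succ]
  push_cast
  field_simp
  ring

lemma derivative_flowSeries (f : R) :
    PowerSeries.derivative ℂ (flowSeries e V w f) = PowerSeries.C w * flowSeries e V w (V f) := by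
  ext a
  rw [PowerSeries.coeff_derivative, PowerSeries.coeff_C_mul, ← coeff_flowSeries_succ, mul_comm]

lemma coeff_pairSeries_zero (G : R) (P Q : Poly n R) :
    PowerSeries.coeff 0 (S.pairSeries e V w G P Q) = e (S.pair G P Q) := by
  simp [pairSeries]

lemma coeff_pairSeries_succ (G : R) (P Q : Poly n R) (N : ℕ) :
    (N + 1 : ℂ) * PowerSeries.coeff (N + 1) (S.pairSeries e V w G P Q) =
      w * PowerSeries.coeff N (S.pairSeries e V w G (S.act V P) Q) +
      starRingEnd ℂ w * PowerSeries.coeff N (S.pairSeries e V w G P (S.act V Q)) := by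
  simp only [pairSeries, PowerSeries.coeff_mk]
  set F : ℕ × ℕ → ℂ := fun p => w ^ p.1 * (starRingEnd ℂ w) ^ p.2 /
    (p.1.factorial * p.2.factorial) * e (S.pair G ((S.act V)^[p.1] P) ((S.act V)^[p.2] Q)) with hF
  have hsplit : (N + 1 : ℂ) * ∑ p ∈ Finset.HasAntidiagonal.antidiagonal (N + 1), F p =
      ∑ p ∈ Finset.HasAntidiagonal.antidiagonal (N + 1), (p.1 : ℂ) * F p +
      ∑ p ∈ Finset.HasAntidiagonal.antidiagonal (N + 1), (p.2 : ℂ) * F p := by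
    rw [Finset.mul_sum, ← Finset.sum_add_distrib]
    refine Finset.sum_congr rfl fun p hp => ?_
    have := Finset.HasAntidiagonal.mem_antidiagonal.mp hp
    have h2 : (N + 1 : ℂ) = (p.1 : ℂ) + p.2 := by exact_mod_cast this.symm
    rw [h2]; ring
  rw [hsplit, Finset.Nat.sum_antidiagonal_succ, Finset.Nat.sum_antidiagonal_succ' (f := fun p => (p.2 : ℂ) * F p)]
  simp only [Nat.cast_zero, zero_mul, zero_add, Finset.mul_sum]
  congr 1 <;>
  · refine Finset.sum_congr rfl fun p _ => ?_
    have f1 : (p.1.factorial : ℂ) ≠ 0 := by exact_mod_cast p.1.factorial_ne_zero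
    have f2 : (p.2.factorial : ℂ) ≠ 0 := by exact_mod_cast p.2.factorial_ne_zero
    have g1 : (p.1 + 1 : ℂ) ≠ 0 := by exact_mod_cast p.1.succ_ne_zero
    have g2 : (p.2 + 1 : ℂ) ≠ 0 := by exact_mod_cast p.2.succ_ne_zero
    simp only [hF, Function.iterate_succ_apply, Nat.factorial_succ]
    push_cast
    field_simp
    ring

lemma derivative_pairSeries (G : R) (P Q : Poly n R) :
    PowerSeries.derivative ℂ (S.pairSeries e V w G P Q) =
      PowerSeries.C w * S.pairSeries e V w G (S.act V P) Q +
      PowerSeries.C (starRingEnd ℂ w) * S.pairSeries e V w G P (S.act V Q) := by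
  ext a
  rw [PowerSeries.coeff_derivative, map_add, PowerSeries.coeff_C_mul, PowerSeries.coeff_C_mul,
    ← coeff_pairSeries_succ, mul_comm]

lemma pairSeries_add_left (G : R) (P P' Q : Poly n R) : S.pairSeries e V w G (P + P') Q =
    S.pairSeries e V w G P Q + S.pairSeries e V w G P' Q := by
  ext N
  simp only [pairSeries, PowerSeries.coeff_mk, map_add, ← Finset.sum_add_distrib, ← mul_add]
  simp only [iterate_map_add, map_add, AddMonoidHom.add_apply]

lemma pairSeries_add_right (G : R) (P Q Q' : Poly n R) : S.pairSeries e V w G P (Q + Q') =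
    S.pairSeries e V w G P Q + S.pairSeries e V w G P Q' := by
  ext N
  simp only [pairSeries, PowerSeries.coeff_mk, map_add, ← Finset.sum_add_distrib, ← mul_add]
  simp only [iterate_map_add, map_add]

lemma pairSeries_sum_left {ι : Type*} (t : Finset ι) (G : R) (P : ι → Poly n R) (Q : Poly n R) :
    S.pairSeries e V w G (∑ i ∈ t, P i) Q = ∑ i ∈ t, S.pairSeries e V w G (P i) Q :=
  map_sum (AddMonoidHom.mk' (fun P => S.pairSeries e V w G P Q)
    (fun P P' => pairSeries_add_left S e V w G P P' Q)) P t

lemma pairSeries_sum_right {ι : Type*} (t : Finset ι) (G : R) (P : Poly n R) (Q : ι → Poly n R) :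
    S.pairSeries e V w G P (∑ i ∈ t, Q i) = ∑ i ∈ t, S.pairSeries e V w G P (Q i) :=
  map_sum (AddMonoidHom.mk' (fun Q => S.pairSeries e V w G P Q)
    (fun Q Q' => pairSeries_add_right S e V w G P Q Q')) Q t

lemma pairSeries_smul_left (G f : R) (P Q : Poly n R) : S.pairSeries e V w G (f • P) Q =
    flowSeries e V w f * S.pairSeries e V w G P Q := by
  ext N
  induction N generalizing f P Q with
  | zero =>
    rw [PowerSeries.coeff_mul, Finset.Nat.antidiagonal_zero, Finset.sum_singleton, coeff_pairSeries_zero, coeff_flowSeries_zero,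
      coeff_pairSeries_zero, pair_smul_left, map_mul]
  | succ N ih =>
    have h1 : (N + 1 : ℂ) ≠ 0 := by exact_mod_cast N.succ_ne_zero
    apply mul_right_cancel₀ h1
    rw [← PowerSeries.coeff_derivative, ← PowerSeries.coeff_derivative, derivative_pairSeries,
      Derivation.leibniz, derivative_pairSeries, derivative_flowSeries, act_leibniz,
      pairSeries_add_left, smul_eq_mul, smul_eq_mul]
    have e1 := ih (V f) P Q
    have e2 := ih f (S.act V P) Q
    have e3 := ih f P (S.act V Q)
    simp only [mul_add, map_add, mul_left_comm _ (PowerSeries.C _), PowerSeries.coeff_C_mul]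
    rw [e1, e2, e3, mul_comm (pairSeries _ _ _ _ _ _ _)]
    ring

lemma pairSeries_smul_right (G f : R) (P Q : Poly n R) : S.pairSeries e V w G P (f • Q) =
    PowerSeries.map (starRingEnd ℂ) (flowSeries e V w f) * S.pairSeries e V w G P Q := by
  have hder : ∀ f, PowerSeries.derivative ℂ (PowerSeries.map (starRingEnd ℂ) (flowSeries e V w f)) =
      PowerSeries.C (starRingEnd ℂ w) * PowerSeries.map (starRingEnd ℂ) (flowSeries e V w (V f)) := by
    intro f
    ext a
    rw [PowerSeries.coeff_derivative, PowerSeries.coeff_C_mul, PowerSeries.coeff_map,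
      PowerSeries.coeff_map, ← map_mul, ← coeff_flowSeries_succ, map_mul, mul_comm]
    simp
  ext N
  induction N generalizing f P Q with
  | zero =>
    rw [PowerSeries.coeff_mul, Finset.Nat.antidiagonal_zero, Finset.sum_singleton, coeff_pairSeries_zero, PowerSeries.coeff_map,
      coeff_flowSeries_zero, coeff_pairSeries_zero, pair_smul_right, map_mul, map_star]
    rfl
  | succ N ih =>
    have h1 : (N + 1 : ℂ) ≠ 0 := by exact_mod_cast N.succ_ne_zero
    apply mul_right_cancel₀ h1
    rw [← PowerSeries.coeff_derivative, ← PowerSeries.coeff_derivative, derivative_pairSeries,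
      Derivation.leibniz, derivative_pairSeries, hder, act_leibniz,
      pairSeries_add_right, smul_eq_mul, smul_eq_mul]
    have e1 := ih (V f) P Q
    have e2 := ih f (S.act V P) Q
    have e3 := ih f P (S.act V Q)
    simp only [mul_add, map_add, mul_left_comm _ (PowerSeries.C _), PowerSeries.coeff_C_mul]
    rw [e1, e2, e3, mul_comm (pairSeries _ _ _ _ _ _ _)]
    ring

/-- Multiplication by a formal variable. -/
def shift (j : Fin n) : Poly n R →+ Poly n R := Finsupp.mapDomain.addMonoidHom (j ::ₘ ·)

omit [StarRing R] [Algebra ℂ R] [StarModule ℂ R] in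
lemma shift_single (j : Fin n) (s : Multiset (Fin n)) (c : R) :
    shift j (Finsupp.single s c) = Finsupp.single (j ::ₘ s) c := by
  simp [shift, Finsupp.mapDomain_single]

lemma act_shift (j : Fin n) (P : Poly n R) : S.act V (shift j P) = shift j (S.act V P) := by
  induction P using Finsupp.induction_linear with
  | zero => simp
  | add f g hf hg => simp only [map_add, hf, hg]
  | single s c => simp only [act_single, shift_single, map_add, map_sum, Multiset.cons_swap]

lemma act_iterate_shift (j : Fin n) (a : ℕ) (P : Poly n R) :
    (S.act V)^[a] (shift j P) = shift j ((S.act V)^[a] P) :=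
  (Function.Commute.iterate_left (f := S.act V) (g := shift j) (fun P => S.act_shift V j P) a) P

lemma pair_shift_left (G : R) (j : Fin n) (P Q : Poly n R) :
    S.pair G (shift j P) Q = S.pair (S.D j G) P Q := by
  revert P Q
  refine pair_induction ?_ ?_ ?_ ?_ ?_
  · simp
  · simp
  · intro P P' Q h h'; simp [h, h']
  · intro P P' Q h h'; simp [h, h']
  · intro s t c d; rw [shift_single, pair_single, pair_single, jet_D]

lemma pair_shift_right (G : R) (j : Fin n) (P Q : Poly n R) :
    S.pair G P (shift j Q) = S.pair (S.Db j G) P Q := by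
  revert P Q
  refine pair_induction ?_ ?_ ?_ ?_ ?_
  · simp
  · simp
  · intro P P' Q h h'; simp [h, h']
  · intro P P' Q h h'; simp [h, h']
  · intro s t c d; rw [shift_single, pair_single, pair_single, jet_Db]

lemma pairSeries_shift_left (G : R) (j : Fin n) (P Q : Poly n R) :
    S.pairSeries e V w G (shift j P) Q = S.pairSeries e V w (S.D j G) P Q := by
  ext N; simp only [pairSeries, act_iterate_shift, pair_shift_left]

lemma pairSeries_shift_right (G : R) (j : Fin n) (P Q : Poly n R) :
    S.pairSeries e V w G P (shift j Q) = S.pairSeries e V w (S.Db j G) P Q := by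
  ext N; simp only [pairSeries, act_iterate_shift, pair_shift_right]

lemma act_vac_eq (U : Derivation ℂ R R) :
    S.act U vac = ∑ j, U (S.z j) • shift j (vac : Poly n R) := by
  rw [act_vac]
  exact Finset.sum_congr rfl fun j _ => by simp [vac, shift_single]

lemma pairSeries_act_left (G : R) (U : Derivation ℂ R R) (Q : Poly n R) :
    S.pairSeries e V w G (S.act U vac) Q =
      ∑ j, flowSeries e V w (U (S.z j)) * S.pairSeries e V w (S.D j G) vac Q := by
  simp only [act_vac_eq, pairSeries_sum_left, pairSeries_smul_left, pairSeries_shift_left]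

lemma pairSeries_act_right (G : R) (U : Derivation ℂ R R) (P : Poly n R) :
    S.pairSeries e V w G P (S.act U vac) =
      ∑ j, PowerSeries.map (starRingEnd ℂ) (flowSeries e V w (U (S.z j))) *
        S.pairSeries e V w (S.Db j G) P vac := by
  simp only [act_vac_eq, pairSeries_sum_right, pairSeries_smul_right, pairSeries_shift_right]

lemma word_replicate (a : ℕ) (u : List (Derivation ℂ R R)) :
    S.word (List.replicate a V ++ u) = (S.act V)^[a] (S.word u) := by
  induction a with
  | zero => rfl
  | succ a ih => rw [List.replicate_succ, List.cons_append, word_cons, ih,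
      Function.iterate_succ_apply']

end WirtingerSystem

namespace smoothAlg

open WirtingerSystem

variable {n : ℕ} (q : Fin n → ℂ) (V : Derivation ℂ (smoothAlg n) (smoothAlg n)) (m : ℕ)

/-- The Taylor polynomial of the coefficients `f` along the formal flow of `V`. -/
def polyCurve (f : Fin n → smoothAlg n) (t : ℂ) : Fin n → ℂ := fun j =>
  (PowerSeries.trunc (m + 1) (flowSeries (ev q) V 1 (f j))).eval t

/-- The Taylor polynomial of the formal integral curve of `V`. -/
def curve : ℂ → Fin n → ℂ := polyCurve q V m (wirt n).z

variable {q V m}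

lemma flowSeries_coeff_rescale (w : ℂ) (f : smoothAlg n) (k : ℕ) :
    PowerSeries.coeff k (flowSeries (ev q) V 1 f) * w ^ k =
      PowerSeries.coeff k (flowSeries (ev q) V w f) := by
  simp only [flowSeries, PowerSeries.coeff_mk]
  ring

lemma hasExp_polyCurve (w : ℂ) (f : Fin n → smoothAlg n) (j : Fin n) {N : ℕ} (hN : N ≤ m + 1) :
    HasExp N (fun s => polyCurve q V m f (w * s) j) (flowSeries (ev q) V w (f j)) := by
  have := HasExp.eval (N := N) (φ := flowSeries (ev q) V w (f j))
    ((PowerSeries.trunc (m + 1) (flowSeries (ev q) V 1 (f j))).comp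
      (Polynomial.C w * Polynomial.X)) (fun k hk => by
      rw [Polynomial.comp_C_mul_X_coeff, PowerSeries.coeff_trunc, if_pos (by omega),
        flowSeries_coeff_rescale])
  simpa [polyCurve, Polynomial.eval_comp] using this

lemma curve_zero : curve q V m 0 = q := by
  ext j
  simp [curve, polyCurve, ← Polynomial.coeff_zero_eq_eval_zero, PowerSeries.coeff_trunc,
    coeff_flowSeries_zero, ev_apply, -PowerSeries.coeff_zero_eq_constantCoeff]

lemma continuous_curve : Continuous (curve q V m) :=
  continuous_pi fun _ => Polynomial.continuous _

lemma continuous_polyCurve (f : Fin n → smoothAlg n) : Continuous (polyCurve q V m f) :=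
  continuous_pi fun _ => Polynomial.continuous _

lemma hasExp_comp_curve (w : ℂ) {N : ℕ} (hN : N ≤ m + 1) (G : smoothAlg n) :
    HasExp N (fun s => (G : (Fin n → ℂ) → ℂ) (curve q V m (w * s)))
      ((wirt n).pairSeries (ev q) V w G vac vac) := by
  induction N generalizing G with
  | zero =>
    refine ⟨0, by simp, ?_⟩
    have : Continuous fun s : ℝ => (G : (Fin n → ℂ) → ℂ) (curve q V m (w * s)) :=
      (smoothAlg.contDiff G).continuous.comp (continuous_curve.comp (by fun_prop))
    simpa using (this.tendsto 0).isBigO_one ℝ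
  | succ N ih =>
    set p : Fin n → Polynomial ℂ := fun j =>
      PowerSeries.trunc (m + 1) (flowSeries (ev q) V 1 ((wirt n).z j)) with hp
    have hc : ∀ t j, curve q V m t j = (p j).eval t := fun _ _ => rfl
    set c' : ℝ → Fin n → ℂ := fun s j => w * (p j).derivative.eval (w * s) with hc'
    have hder : ∀ s : ℝ, HasDerivAt (fun s : ℝ => curve q V m (w * s)) (c' s) s := by
      intro s
      rw [hasDerivAt_pi]
      intro j
      have h1 : HasDerivAt (fun t : ℂ => (p j).eval (w * t)) ((p j).derivative.eval (w * s) * w)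
          (s : ℂ) := by
        have := (p j).hasDerivAt (w * (s : ℂ))
        exact this.comp (s : ℂ) (by simpa using (hasDerivAt_id (s : ℂ)).const_mul w)
      have := h1.comp_ofReal
      simpa only [hc', hc, mul_comm w] using this
    have hexp' : ∀ j, HasExp N (fun s => c' s j)
        (PowerSeries.C w * flowSeries (ev q) V w (V ((wirt n).z j))) := by
      intro j
      refine (HasExp.const N w).mul ?_
      have := HasExp.eval (N := N) (φ := flowSeries (ev q) V w (V ((wirt n).z j)))
        ((p j).derivative.comp (Polynomial.C w * Polynomial.X)) (fun k hk => by
          rw [Polynomial.comp_C_mul_X_coeff, Polynomial.coeff_derivative, hp,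
            PowerSeries.coeff_trunc, if_pos (by omega), mul_comm _ ((k : ℂ) + 1),
            coeff_flowSeries_succ, one_mul, flowSeries_coeff_rescale])
      simpa [Polynomial.eval_comp] using this
    refine HasExp.of_deriv (f' := fun s => ∑ j,
      (c' s j * ((wirt n).D j G : (Fin n → ℂ) → ℂ) (curve q V m (w * s)) +
        (starRingEnd ℂ) (c' s j) * ((wirt n).Db j G : (Fin n → ℂ) → ℂ) (curve q V m (w * s))))
      ?_ ?_ ?_
    · intro s
      have h1 := ((smoothAlg.differentiable G) (curve q V m (w * s))).hasFDerivAt.comp_hasDerivAt s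
        (hder s)
      rw [fderiv_eq_dz] at h1
      simp only [D_apply, Db_apply]
      exact h1
    · rw [derivative_pairSeries, pairSeries_act_left, pairSeries_act_right, Finset.mul_sum,
        Finset.mul_sum, ← Finset.sum_add_distrib]
      refine HasExp.sum _ fun j _ => HasExp.add ?_ ?_
      · rw [← mul_assoc]
        exact (hexp' j).mul (ih (by omega) _)
      · rw [← mul_assoc]
        have := (hexp' j).conj.mul (ih (by omega) ((wirt n).Db j G))
        rwa [map_mul, PowerSeries.map_C] at this
    · rw [← PowerSeries.coeff_zero_eq_constantCoeff_apply, coeff_pairSeries_zero]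
      simp [vac, pair_single, ev_apply, curve_zero]

lemma hasExp_dirDeriv (w : ℂ) (G : smoothAlg n) (U : Derivation ℂ (smoothAlg n) (smoothAlg n)) :
    HasExp (m + 1) (fun s => dirDeriv (polyCurve q V m (fun j => U ((wirt n).z j)) (w * s))
      (G : (Fin n → ℂ) → ℂ) (curve q V m (w * s)))
      ((wirt n).pairSeries (ev q) V w G ((wirt n).act U vac) vac) := by
  rw [pairSeries_act_left]
  refine HasExp.sum _ fun j _ => ?_
  simp only [← D_apply]
  exact (hasExp_polyCurve w _ j le_rfl).mul (hasExp_comp_curve w le_rfl _)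

/-- The Levi form of an element of the smooth algebra. -/
lemma hasExp_levi (w : ℂ) (G : smoothAlg n) (U : Derivation ℂ (smoothAlg n) (smoothAlg n)) :
    HasExp (m + 1) (fun s => ∑ j, ∑ k, ((wirt n).D j ((wirt n).Db k G) : (Fin n → ℂ) → ℂ)
        (curve q V m (w * s)) * polyCurve q V m (fun j => U ((wirt n).z j)) (w * s) j *
        (starRingEnd ℂ) (polyCurve q V m (fun j => U ((wirt n).z j)) (w * s) k))
      ((wirt n).pairSeries (ev q) V w G ((wirt n).act U vac) ((wirt n).act U vac)) := by
  rw [pairSeries_act_left]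
  refine HasExp.sum _ fun j _ => ?_
  rw [pairSeries_act_right, Finset.mul_sum]
  refine HasExp.sum _ fun k _ => ?_
  rw [← (wirt n).D_Db_comm]
  rw [show flowSeries (ev q) V w (U ((wirt n).z j)) * (PowerSeries.map (starRingEnd ℂ)
    (flowSeries (ev q) V w (U ((wirt n).z k))) * (wirt n).pairSeries (ev q) V w
      ((wirt n).D j ((wirt n).Db k G)) vac vac) = (wirt n).pairSeries (ev q) V w
      ((wirt n).D j ((wirt n).Db k G)) vac vac * flowSeries (ev q) V w (U ((wirt n).z j)) *
      PowerSeries.map (starRingEnd ℂ) (flowSeries (ev q) V w (U ((wirt n).z k))) by ring]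
  exact ((hasExp_comp_curve w le_rfl _).mul (hasExp_polyCurve w _ j le_rfl)).mul
    (hasExp_polyCurve w _ k le_rfl).conj

end smoothAlg

/-- The lower bound for the Levi form near a pseudoconvex boundary point. -/
def LeviLowerBound {n : ℕ} (r : (Fin n → ℂ) → ℝ) (q : Fin n → ℂ) : Prop :=
  ∃ C : ℝ, 0 ≤ C ∧ ∀ᶠ z in 𝓝 q, ∀ X : Fin n → ℂ,
    -C * (|r z| * ‖X‖ ^ 2 + ‖X‖ * ‖dirDeriv X (cplx r) z‖) ≤ (levi r X X z).re

lemma eq_zero_of_odd_expansion {f : ℝ → ℝ} {c : ℝ} {N : ℕ} (hN : Odd N)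
    (hf : (fun s => f s - c * s ^ N) =O[𝓝 0] fun s : ℝ => s ^ (N + 1))
    {g : ℝ → ℝ} (hg : g =O[𝓝 0] fun s : ℝ => s ^ (N + 1)) (hfg : ∀ᶠ s in 𝓝 0, -g s ≤ f s) :
    c = 0 := by
  obtain ⟨A, hA0, hA⟩ := hf.exists_pos
  obtain ⟨B, hB0, hB⟩ := hg.exists_pos
  obtain ⟨ε, hε, hball⟩ := Metric.eventually_nhds_iff_ball.mp (hA.bound.and (hB.bound.and hfg))
  have key : ∀ s : ℝ, |s| < ε → -(A + B) * |s| ^ (N + 1) ≤ c * s ^ N := by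
    intro s hs
    obtain ⟨h1, h2, h3⟩ := hball s (by simpa using hs)
    rw [Real.norm_eq_abs, norm_pow, Real.norm_eq_abs] at h1 h2
    have := abs_le.mp h1
    have := abs_le.mp h2
    linarith [this.1, this.2]
  have main : ∀ d : ℝ, (∀ s : ℝ, 0 < s → s < ε → -(A + B) * s ^ (N + 1) ≤ d * s ^ N) → 0 ≤ d := by
    intro d hd
    by_contra hneg
    push Not at hneg
    set s := min (ε / 2) (-d / (2 * (A + B))) with hs
    have hs0 : 0 < s := lt_min (by positivity) (by apply div_pos <;> linarith)
    have h1 := hd s hs0 (lt_of_le_of_lt (min_le_left _ _) (by linarith))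
    have h2 : s ≤ -d / (2 * (A + B)) := min_le_right _ _
    rw [le_div_iff₀ (by positivity)] at h2
    have h3 : 0 < s ^ N := by positivity
    rw [pow_succ] at h1
    have h4 : 0 ≤ s ^ N * (d + (A + B) * s) := by linarith
    have h5 : 0 ≤ d + (A + B) * s := nonneg_of_mul_nonneg_right h4 h3
    linarith
  apply le_antisymm
  · have := main (-c) (fun s hs hsε => by
      have := key (-s) (by rwa [abs_neg, abs_of_pos hs])
      rw [abs_neg, abs_of_pos hs, hN.neg_pow] at this
      linarith)
    linarith
  · exact main c (fun s hs hsε => by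
      have := key s (by rwa [abs_of_pos hs])
      rwa [abs_of_pos hs] at this)

namespace smoothAlg

open WirtingerSystem

variable {n : ℕ}

/-- A real-valued smooth function as an element of the smooth algebra. -/
def ofReal (r : (Fin n → ℂ) → ℝ) (hr : ContDiff ℝ (⊤ : ℕ∞) r) : smoothAlg n :=
  ⟨cplx r, Complex.ofRealCLM.contDiff.comp hr⟩

lemma ofReal_apply (r : (Fin n → ℂ) → ℝ) (hr : ContDiff ℝ (⊤ : ℕ∞) r) (z : Fin n → ℂ) :
    (ofReal r hr : (Fin n → ℂ) → ℂ) z = r z := rfl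

lemma coe_ofReal (r : (Fin n → ℂ) → ℝ) (hr : ContDiff ℝ (⊤ : ℕ∞) r) :
    (ofReal r hr : (Fin n → ℂ) → ℂ) = cplx r := rfl

lemma star_ofReal (r : (Fin n → ℂ) → ℝ) (hr : ContDiff ℝ (⊤ : ℕ∞) r) :
    star (ofReal r hr) = ofReal r hr := by
  ext z
  exact Complex.conj_ofReal (r z)

lemma levi_eq (r : (Fin n → ℂ) → ℝ) (hr : ContDiff ℝ (⊤ : ℕ∞) r) (X Y z : Fin n → ℂ) :
    levi r X Y z = ∑ j, ∑ k, ((wirt n).D j ((wirt n).Db k (ofReal r hr)) : (Fin n → ℂ) → ℂ) z *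
      X j * (starRingEnd ℂ) (Y k) := by
  have : ∀ k, ((wirt n).Db k (ofReal r hr) : (Fin n → ℂ) → ℂ) = fun w => dzbar k (cplx r) w :=
    fun k => funext fun w => Db_apply k _ w
  simp only [D_apply, this]
  rfl

variable (r : (Fin n → ℂ) → ℝ) (hr : ContDiff ℝ (⊤ : ℕ∞) r) (q : Fin n → ℂ)

lemma coeff_pairSeries_eq_zero {V : Derivation ℂ (smoothAlg n) (smoothAlg n)} {w : ℂ}
    {G : smoothAlg n} {u v : List (Derivation ℂ (smoothAlg n) (smoothAlg n))} {k : ℕ}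
    (h : ∀ a c, a + c = k → (wirt n).beta G ev q (List.replicate a V ++ u)
      (List.replicate c V ++ v) = 0) :
    PowerSeries.coeff k
      ((wirt n).pairSeries (ev q) V w G ((wirt n).word u) ((wirt n).word v)) = 0 := by
  rw [pairSeries, PowerSeries.coeff_mk]
  refine Finset.sum_eq_zero fun p hp => ?_
  have := h p.1 p.2 (Finset.HasAntidiagonal.mem_antidiagonal.mp hp)
  rw [beta, word_replicate, word_replicate] at this
  rw [this, mul_zero]

lemma pos_of_leviLowerBound (hL : LeviLowerBound r q)
    (V U : Derivation ℂ (smoothAlg n) (smoothAlg n)) (N : ℕ) (hN : Odd N)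
    (h1 : ∀ a c, a + c ≤ N →
      (wirt n).beta (ofReal r hr) ev q (List.replicate a V) (List.replicate c V) = 0)
    (h2 : ∀ a c, a + c ≤ N →
      (wirt n).beta (ofReal r hr) ev q (List.replicate a V ++ [U]) (List.replicate c V) = 0)
    (h3 : ∀ a c, a + c < N →
      (wirt n).beta (ofReal r hr) ev q (List.replicate a V ++ [U]) (List.replicate c V ++ [U]) = 0) :
    (∑ p ∈ Finset.HasAntidiagonal.antidiagonal N,
      I ^ p.1 * (-I) ^ p.2 / (p.1.factorial * p.2.factorial) *
      (wirt n).beta (ofReal r hr) ev q (List.replicate p.1 V ++ [U])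
        (List.replicate p.2 V ++ [U])).re = 0 := by
  set X : ℝ → Fin n → ℂ := fun s => polyCurve q V N (fun j => U ((wirt n).z j)) (I * s) with hX
  set c : ℝ → Fin n → ℂ := fun s => curve q V N (I * s) with hc
  have e1 : (fun s => ((r (c s) : ℝ) : ℂ)) =O[𝓝 0] fun s : ℝ => s ^ (N + 1) :=
    (hasExp_comp_curve (m := N) I le_rfl (ofReal r hr)).isBigO_of_coeff_eq_zero fun k hk =>
      coeff_pairSeries_eq_zero q (u := []) (v := []) fun a c hac => by
        simpa using h1 a c (by omega)
  have e2 : (fun s => dirDeriv (X s) (cplx r) (c s)) =O[𝓝 0] fun s : ℝ => s ^ (N + 1) :=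
    (hasExp_dirDeriv (m := N) I (ofReal r hr) U).isBigO_of_coeff_eq_zero fun k hk =>
      coeff_pairSeries_eq_zero q (u := [U]) (v := []) fun a c hac => by
        simpa using h2 a c (by omega)
  have e3 := (hasExp_levi (q := q) (V := V) (m := N) I (ofReal r hr) U).tendsto_coeff fun k hk =>
      coeff_pairSeries_eq_zero q (u := [U]) (v := [U]) fun a c hac => h3 a c (by omega)
  simp only [← levi_eq r hr] at e3
  set κ := PowerSeries.coeff N ((wirt n).pairSeries (ev q) V I (ofReal r hr)
    ((wirt n).act U vac) ((wirt n).act U vac)) with hκ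
  have hgoal : (∑ p ∈ Finset.HasAntidiagonal.antidiagonal N,
      I ^ p.1 * (-I) ^ p.2 / (p.1.factorial * p.2.factorial) *
      (wirt n).beta (ofReal r hr) ev q (List.replicate p.1 V ++ [U])
        (List.replicate p.2 V ++ [U])) = κ := by
    rw [hκ, pairSeries, PowerSeries.coeff_mk]
    refine Finset.sum_congr rfl fun p _ => ?_
    rw [beta, word_replicate, word_replicate, conj_I]
    rfl
  rw [hgoal]
  have e4 : (fun s : ℝ => (levi r (X s) (X s) (c s)).re - κ.re * s ^ N) =O[𝓝 0]
      fun s : ℝ => s ^ (N + 1) := by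
    refine Asymptotics.IsBigO.trans (Asymptotics.IsBigO.of_norm_le fun s => ?_) e3.norm_left
    have := Complex.abs_re_le_norm (levi r (X s) (X s) (c s) - κ * (s : ℂ) ^ N)
    simpa [← Complex.ofReal_pow] using this
  obtain ⟨C, hC0, hC⟩ := hL
  have hcc : Continuous c := continuous_curve.comp (by fun_prop)
  have hXc : Continuous X := (continuous_polyCurve _).comp (by fun_prop)
  have hX1 : (fun s => ‖X s‖) =O[𝓝 0] fun _ : ℝ => (1 : ℝ) := (hXc.norm.tendsto 0).isBigO_one ℝ
  have htend : Filter.Tendsto c (𝓝 0) (𝓝 q) := by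
    have := hcc.tendsto 0
    rwa [show c 0 = q by simp [hc, curve_zero]] at this
  refine eq_zero_of_odd_expansion hN e4
    (g := fun s => C * (|r (c s)| * ‖X s‖ ^ 2 + ‖X s‖ * ‖dirDeriv (X s) (cplx r) (c s)‖)) ?_ ?_
  · have e1' : (fun s => |r (c s)|) =O[𝓝 0] fun s : ℝ => s ^ (N + 1) := by
      refine e1.norm_left.congr_left fun s => ?_
      simp
    have f1 := (e1'.mul (hX1.pow 2)).congr_right (g₂ := fun s : ℝ => s ^ (N + 1)) fun s => by simp
    have f2 := (hX1.mul e2.norm_left).congr_right (g₂ := fun s : ℝ => s ^ (N + 1)) fun s => by simp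
    exact (f1.add f2).const_mul_left C
  · filter_upwards [htend.eventually hC] with s hs
    have := hs (X s)
    linarith

end smoothAlg

lemma iteratedDeriv_eq_zero_of_isBigO {h : ℝ → ℂ} (hh : ContDiff ℝ (⊤ : ℕ∞) h) {m : ℕ}
    (hO : h =O[𝓝 0] fun s : ℝ => s ^ (m + 1)) (k : ℕ) (hk : k ≤ m) : iteratedDeriv k h 0 = 0 := by
  induction k using Nat.strong_induction_on with
  | _ k ih =>
    have h1 := taylor_isLittleO_univ (x₀ := (0 : ℝ)) (n := k) (f := h)
      (hh.of_le (WithTop.coe_le_coe.mpr le_top))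
    have h2 : ∀ x, taylorWithinEval h k Set.univ 0 x =
        ((k.factorial : ℝ)⁻¹ * x ^ k) • iteratedDeriv k h 0 := by
      intro x
      rw [taylor_within_apply, Finset.sum_range_succ, Finset.sum_eq_zero, zero_add]
      · simp [iteratedDerivWithin_univ]
      · intro i hi
        rw [Finset.mem_range] at hi
        rw [iteratedDerivWithin_univ, ih i hi (by omega), smul_zero]
    have h3 : (fun s : ℝ => s ^ (m + 1)) =o[𝓝 0] fun s : ℝ => s ^ k :=
      Asymptotics.isLittleO_pow_pow (by omega)
    have h4 : (fun x : ℝ => ((k.factorial : ℝ)⁻¹ * x ^ k) • iteratedDeriv k h 0) =o[𝓝 0]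
        fun x : ℝ => x ^ k := by
      have := (hO.trans_isLittleO h3).sub (by simpa using h1)
      refine this.congr_left fun x => ?_
      rw [h2]; simp
    by_contra hne
    have h5 : (fun x : ℝ => x ^ k) =O[𝓝 0]
        fun x : ℝ => ((k.factorial : ℝ)⁻¹ * x ^ k) • iteratedDeriv k h 0 := by
      refine Asymptotics.IsBigO.of_bound ((k.factorial : ℝ) * ‖iteratedDeriv k h 0‖⁻¹) ?_
      refine Filter.Eventually.of_forall fun x => ?_
      rw [norm_smul, norm_mul, norm_inv, Real.norm_natCast]
      have f1 : (k.factorial : ℝ) ≠ 0 := by exact_mod_cast k.factorial_ne_zero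
      have f2 : ‖iteratedDeriv k h 0‖ ≠ 0 := norm_ne_zero_iff.mpr hne
      field_simp
      exact le_rfl
    have h6 := h5.trans_isLittleO h4
    replace h6 : ∀ᶠ x in 𝓝 (0 : ℝ), x ^ k = 0 := by
      filter_upwards [h6.def (c := 1 / 2) (by norm_num)] with x hx
      exact norm_le_zero_iff.mp (by linarith)
    have h7 : ∃ᶠ x in 𝓝[≠] (0 : ℝ), x ∈ ({0}ᶜ : Set ℝ) :=
      Filter.Eventually.frequently self_mem_nhdsWithin
    obtain ⟨x, hx, hx'⟩ := (h7.and_eventually (h6.filter_mono nhdsWithin_le_nhds)).exists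
    exact hx (eq_zero_of_pow_eq_zero hx')

namespace smoothAlg

open WirtingerSystem

variable {n : ℕ}

lemma iteratedFDeriv_apply_eq (f : smoothAlg n) (k : ℕ) (v : Fin k → Fin n → ℂ)
    (x : Fin n → ℂ) : iteratedFDeriv ℝ k (f : (Fin n → ℂ) → ℂ) x v =
      ev x ((List.ofFn v).foldr (fun a g => dirDer a g) f) := by
  induction k generalizing x with
  | zero => simp [ev_apply]
  | succ k ih =>
    have hd : DifferentiableAt ℝ (iteratedFDeriv ℝ k (f : (Fin n → ℂ) → ℂ)) x :=
      (smoothAlg.contDiff f).differentiable_iteratedFDeriv (by exact_mod_cast WithTop.coe_lt_top _) x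
    rw [hd.iteratedFDeriv_succ_apply_left', List.ofFn_succ, List.foldr_cons, ev_apply, dirDer_apply]
    simp only [ih]
    rfl

lemma derivation_sum_apply {ι : Type*} (t : Finset ι)
    (V : ι → Derivation ℂ (smoothAlg n) (smoothAlg n)) (f : smoothAlg n) :
    (∑ j ∈ t, V j) f = ∑ j ∈ t, V j f := by
  classical
  induction t using Finset.induction_on with
  | empty => simp
  | insert a t ha ih => rw [Finset.sum_insert ha, Finset.sum_insert ha, Derivation.add_apply, ih]

/-- The constant coefficient vector field with given components. -/
def constField (x : (Fin n → ℂ) × (Fin n → ℂ)) : Derivation ℂ (smoothAlg n) (smoothAlg n) :=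
  ∑ j, (x.1 j • (wirt n).D j + x.2 j • (wirt n).Db j)

lemma constField_apply (x : (Fin n → ℂ) × (Fin n → ℂ)) (f : smoothAlg n) :
    constField x f = ∑ j, (x.1 j • (wirt n).D j f + x.2 j • (wirt n).Db j f) := by
  rw [constField, derivation_sum_apply]
  rfl

lemma constField_conj (v : Fin n → ℂ) : constField (v, star v) = dirDer v := by
  ext f z
  rw [dirDer_apply, fderiv_eq_dz]
  simp only [constField_apply]
  simp [← D_apply, ← Db_apply]

lemma constField_comm (x y : (Fin n → ℂ) × (Fin n → ℂ)) (f : smoothAlg n) :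
    constField x (constField y f) = constField y (constField x f) := by
  have key : ∀ x y : (Fin n → ℂ) × (Fin n → ℂ), constField x (constField y f) = ∑ j, ∑ i,
      ((x.1 j * y.1 i) • (wirt n).D j ((wirt n).D i f) +
       (x.1 j * y.2 i) • (wirt n).D j ((wirt n).Db i f) +
       (x.2 j * y.1 i) • (wirt n).Db j ((wirt n).D i f) +
       (x.2 j * y.2 i) • (wirt n).Db j ((wirt n).Db i f)) := by
    intro x y
    simp only [constField_apply,
      map_sum, map_add, Derivation.map_smul, Finset.smul_sum, smul_add, smul_smul,
      ← Finset.sum_add_distrib]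
    rw [Finset.sum_comm]
    refine Finset.sum_congr rfl fun j _ => Finset.sum_congr rfl fun i _ => ?_
    simp only [mul_comm (y.1 i), mul_comm (y.2 i)]
    abel
  rw [key, key, Finset.sum_comm]
  refine Finset.sum_congr rfl fun j _ => Finset.sum_congr rfl fun i _ => ?_
  rw [(wirt n).D_comm i j, (wirt n).Db_comm i j, (wirt n).D_Db_comm i j, ← (wirt n).D_Db_comm j i,
    mul_comm (y.1 j), mul_comm (y.2 j), mul_comm (y.1 j), mul_comm (y.2 j)]
  abel

lemma iteratedDeriv_line (f : smoothAlg n) (q v : Fin n → ℂ) (k : ℕ) (s : ℝ) :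
    iteratedDeriv k (fun s : ℝ => (f : (Fin n → ℂ) → ℂ) (q + s • v)) s =
      ((dirDer v)^[k] f : (Fin n → ℂ) → ℂ) (q + s • v) := by
  induction k generalizing s with
  | zero => simp
  | succ k ih =>
    rw [iteratedDeriv_succ, Function.iterate_succ_apply', dirDer_apply]
    simp only [funext ih]
    have h1 : HasDerivAt (fun s : ℝ => q + s • v) v s := by
      simpa using ((hasDerivAt_id s).smul_const v).const_add q
    exact ((smoothAlg.differentiable ((dirDer v)^[k] f) _).hasFDerivAt.comp_hasDerivAt s h1).deriv

lemma iteratedFDeriv_eq_zero (f : smoothAlg n) (q : Fin n → ℂ) {m : ℕ}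
    (hf : ∀ v : Fin n → ℂ, (fun s : ℝ => (f : (Fin n → ℂ) → ℂ) (q + s • v)) =O[𝓝 0]
      fun s : ℝ => s ^ (m + 1)) (k : ℕ) (hk : k ≤ m) :
    iteratedFDeriv ℝ k (f : (Fin n → ℂ) → ℂ) q = 0 := by
  have hcomm : LeftCommutative
      (fun (x : (Fin n → ℂ) × (Fin n → ℂ)) (g : smoothAlg n) => constField x g) :=
    ⟨fun x y g => constField_comm x y g⟩
  have := polarization (M := (Fin n → ℂ) × (Fin n → ℂ)) (fun x => x.2 = star x.1)
    (by
      rintro ⟨a, b⟩ ⟨c, d⟩ h1 h2 s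
      obtain rfl : b = star a := h1
      obtain rfl : d = star c := h2
      ext
      simp)
    (by
      rintro ⟨a, b⟩
      refine ⟨((1 / 2 : ℂ) • (a + star b), star ((1 / 2 : ℂ) • (a + star b))),
        ((-I / 2) • (a - star b), star ((-I / 2) • (a - star b))), rfl, rfl, ?_⟩
      ext j
      · simp only [Prod.fst_add, Prod.smul_fst, Pi.add_apply, Pi.smul_apply, Pi.sub_apply,
          smul_eq_mul]
        linear_combination (1 / 2 * (a j - star b j)) * I_sq
      · simp only [Prod.snd_add, Prod.smul_snd, Pi.add_apply, Pi.smul_apply, Pi.sub_apply,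
          Pi.star_apply, smul_eq_mul, star_mul', star_add, star_sub, RCLike.star_def,
          map_div₀, map_neg, conj_I, map_one, map_ofNat, Complex.conj_conj]
        linear_combination (-1 / 2 * ((starRingEnd ℂ) (a j) - b j)) * I_sq)
    k (fun u => ev q (u.foldr (fun x g => constField x g) f))
    (fun u v _ huv => by rw [huv.foldr_eq])
    (fun x y u _ => by
      simp only [List.foldr_cons]
      rw [← map_add]
      congr 1
      simp only [constField_apply,
        Prod.fst_add, Prod.snd_add, Pi.add_apply, add_smul, ← Finset.sum_add_distrib]
      exact Finset.sum_congr rfl fun j _ => by abel)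
    (fun c x u _ => by
      simp only [List.foldr_cons]
      rw [← smul_eq_mul, ← map_smul]
      congr 1
      simp only [constField_apply,
        Prod.smul_fst, Prod.smul_snd, Pi.smul_apply, smul_eq_mul, Finset.smul_sum, smul_add,
        smul_smul])
    (by
      rintro ⟨v, w⟩ h
      obtain rfl : w = star v := h
      have h1 : ∀ r : ℕ, (List.replicate r (v, star v)).foldr (fun x g => constField x g) f =
          (dirDer v)^[r] f := by
        intro r
        induction r with
        | zero => rfl
        | succ r ih => rw [List.replicate_succ, List.foldr_cons, ih, constField_conj,
            Function.iterate_succ_apply']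
      rw [h1, ev_apply]
      have h2 := iteratedDeriv_line f q v k 0
      rw [zero_smul, add_zero] at h2
      rw [← h2]
      refine iteratedDeriv_eq_zero_of_isBigO ?_ (hf v) k hk
      exact (smoothAlg.contDiff f).comp (by fun_prop))
  ext v
  rw [iteratedFDeriv_apply_eq]
  have h3 := this ((List.ofFn v).map fun a => (a, star a)) (by simp)
  simp only [List.foldr_map, constField_conj] at h3
  exact h3

end smoothAlg

namespace smoothAlg

open WirtingerSystem

variable {n : ℕ}

lemma iteratedFDeriv_comp_curve_eq_zero (r : (Fin n → ℂ) → ℝ) (hr : ContDiff ℝ (⊤ : ℕ∞) r)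
    (p : Fin n → ℂ) (V : Derivation ℂ (smoothAlg n) (smoothAlg n))
    (hb : ∀ a c, (wirt n).beta (ofReal r hr) ev p (List.replicate a V) (List.replicate c V) = 0)
    (m k : ℕ) (hk : k ≤ m) : iteratedFDeriv ℝ k (fun t => r (curve p V m t)) 0 = 0 := by
  have hsm : ContDiff ℝ (⊤ : ℕ∞) fun t : ℂ => curve p V m t := by
    rw [contDiff_pi]
    intro j
    have : ContDiff ℂ (⊤ : ℕ∞) fun t : ℂ => curve p V m t j :=
      (Polynomial.differentiable _).contDiff
    exact this.restrict_scalars ℝ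
  have hg : ContDiff ℝ (⊤ : ℕ∞) fun t : ℂ => r (curve p V m t) := hr.comp hsm
  set H : smoothAlg 1 := ⟨fun z => ((r (curve p V m (z 0)) : ℝ) : ℂ),
    Complex.ofRealCLM.contDiff.comp (hg.comp (contDiff_apply ℝ ℂ (0 : Fin 1)))⟩ with hH
  have h1 := iteratedFDeriv_eq_zero H 0 (m := m) (fun v => by
    have := (hasExp_comp_curve (m := m) (q := p) (V := V) (v 0) le_rfl
      (ofReal r hr)).isBigO_of_coeff_eq_zero fun k hk =>
        coeff_pairSeries_eq_zero p (u := []) (v := []) fun a c hac => by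
          simpa using hb a c
    refine this.congr_left fun s => ?_
    simp [hH, ofReal_apply, mul_comm]) k hk
  set L : ℂ →L[ℝ] (Fin 1 → ℂ) := ContinuousLinearMap.pi fun _ => ContinuousLinearMap.id ℝ ℂ
  have h2 := L.iteratedFDeriv_comp_right (smoothAlg.contDiff H) 0
    (i := k) (by exact_mod_cast le_top)
  rw [map_zero, h1] at h2
  have h3 : ((H : (Fin 1 → ℂ) → ℂ) ∘ L) = Complex.ofRealCLM ∘ fun t => r (curve p V m t) := by
    ext t; simp [hH, L]
  rw [h3, Complex.ofRealCLM.iteratedFDeriv_comp_left hg.contDiffAt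
    (by exact_mod_cast le_top)] at h2
  ext v
  have h4 := congrArg (fun f => f v) h2
  simpa using h4

lemma deriv_curve (p : Fin n → ℂ) (V : Derivation ℂ (smoothAlg n) (smoothAlg n)) {m : ℕ}
    (hm : 1 ≤ m) (j : Fin n) : deriv (fun t => curve p V m t j) 0 = ev p (V ((wirt n).z j)) := by
  have h1 : deriv (fun t => curve p V m t j) 0 = _ := Polynomial.deriv _
  rw [h1, ← Polynomial.coeff_zero_eq_eval_zero, Polynomial.coeff_derivative,
    PowerSeries.coeff_trunc, if_pos (by omega)]
  have := coeff_flowSeries_succ (ev p) V 1 ((wirt n).z j) 0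
  rw [coeff_flowSeries_zero] at this
  simpa [mul_comm] using this

theorem not_finiteTypePt (r ρ : (Fin n → ℂ) → ℝ) (hr : ContDiff ℝ (⊤ : ℕ∞) r)
    (p : Fin n → ℂ) (hρ : ρ =ᶠ[𝓝 p] r) (V : Derivation ℂ (smoothAlg n) (smoothAlg n))
    (hb : ∀ a c, (wirt n).beta (ofReal r hr) ev p (List.replicate a V) (List.replicate c V) = 0)
    {j : Fin n} (hV : ev p (V ((wirt n).z j)) ≠ 0) : ¬ FiniteTypePt ρ p := by
  rintro ⟨M, hM⟩
  have hd := deriv_curve p V (m := M + 1) (by omega) j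
  have h1 := hM (curve p V (M + 1)) (fun i => Polynomial.differentiable _ |>.analyticAt 0) curve_zero ?_
  swap
  · intro hc
    have : (fun t => curve p V (M + 1) t j) =ᶠ[𝓝 0] fun _ => p j := by
      filter_upwards [hc] with t ht
      rw [ht]
    rw [this.deriv_eq, deriv_const] at hd
    exact hV hd.symm
  have h2 : curveOrder (curve p V (M + 1)) p ≤ 1 := by
    refine (iInf_le _ j).trans (sInf_le ⟨1, ?_, by simp⟩)
    rw [Set.mem_ofPred_eq, iteratedDeriv_one, deriv_sub_const, hd]
    exact hV
  have h3 : ((M + 1 : ℕ) : ℕ∞) ≤ orderR fun t => ρ (curve p V (M + 1) t) := by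
    refine le_sInf ?_
    rintro _ ⟨k, hk, rfl⟩
    by_contra hlt
    have hlt' : k ≤ M + 1 := by
      have : ((k : ℕ) : ℕ∞) < ((M + 1 : ℕ) : ℕ∞) := not_le.mp hlt
      have : k < M + 1 := by exact_mod_cast this
      omega
    apply hk
    have he : (fun t => ρ (curve p V (M + 1) t)) =ᶠ[𝓝 0] fun t => r (curve p V (M + 1) t) := by
      have hcont : Filter.Tendsto (curve p V (M + 1)) (𝓝 0) (𝓝 p) := by
        simpa [curve_zero] using (continuous_curve (q := p) (V := V) (m := M + 1)).tendsto 0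
      exact hcont.eventually hρ
    rw [(he.iteratedFDeriv ℝ k).eq_of_nhds]
    exact iteratedFDeriv_comp_curve_eq_zero r hr p V hb (M + 1) k hlt'
  have h4 := (h3.trans h1).trans (mul_le_mul_right h2 _)
  rw [mul_one] at h4
  have : M + 1 ≤ M := by exact_mod_cast h4
  omega

end smoothAlg

namespace smoothAlg

open WirtingerSystem

variable {n : ℕ}

lemma D_z (i j : Fin n) : (wirt n).D i ((wirt n).z j) = if i = j then 1 else 0 := by
  ext z
  rw [D_apply]
  have h1 : fderiv ℝ ((wirt n).z j : (Fin n → ℂ) → ℂ) z =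
      ContinuousLinearMap.proj (R := ℝ) (φ := fun _ : Fin n => ℂ) j :=
    (ContinuousLinearMap.proj (R := ℝ) (φ := fun _ : Fin n => ℂ) j).fderiv
  rw [dz, h1]
  by_cases h : i = j
  · subst h; simp
  · simp [h, Ne.symm h]

lemma Db_z (i j : Fin n) : (wirt n).Db i ((wirt n).z j) = 0 := by
  ext z
  rw [Db_apply]
  have h1 : fderiv ℝ ((wirt n).z j : (Fin n → ℂ) → ℂ) z =
      ContinuousLinearMap.proj (R := ℝ) (φ := fun _ : Fin n => ℂ) j :=
    (ContinuousLinearMap.proj (R := ℝ) (φ := fun _ : Fin n => ℂ) j).fderiv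
  rw [dzbar, h1]
  by_cases h : i = j
  · subst h; simp
  · simp [Ne.symm h]

/-- The `(1,0)` vector field with the given components. -/
def fieldDer (l : Fin n → smoothAlg n) : Derivation ℂ (smoothAlg n) (smoothAlg n) :=
  ∑ j, l j • (wirt n).D j

lemma fieldDer_apply (l : Fin n → smoothAlg n) (f : smoothAlg n) :
    fieldDer l f = ∑ j, l j * (wirt n).D j f := by
  rw [fieldDer, derivation_sum_apply]; rfl

lemma fieldDer_z (l : Fin n → smoothAlg n) (j : Fin n) : fieldDer l ((wirt n).z j) = l j := by
  simp [fieldDer_apply, D_z]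

lemma fieldDer_star_z (l : Fin n → smoothAlg n) (j : Fin n) :
    fieldDer l (star ((wirt n).z j)) = 0 := by
  rw [fieldDer_apply]
  refine Finset.sum_eq_zero fun i _ => ?_
  have := (wirt n).Db_star i (star ((wirt n).z j))
  rw [star_star, Db_z] at this
  rw [← star_star ((wirt n).D i _), ← this, star_zero, mul_zero]

lemma ev_fieldDer (l : Fin n → smoothAlg n) (f : smoothAlg n) (q : Fin n → ℂ) :
    ev q (fieldDer l f) = dirDeriv (fun j => ev q (l j)) (f : (Fin n → ℂ) → ℂ) q := by
  rw [fieldDer_apply, map_sum, dirDeriv]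
  simp only [map_mul]
  exact Finset.sum_congr rfl fun j _ => by rw [ev_apply q ((wirt n).D j f), D_apply]

lemma beta_one (r : (Fin n → ℂ) → ℝ) (hr : ContDiff ℝ (⊤ : ℕ∞) r) (q : Fin n → ℂ)
    (U : Derivation ℂ (smoothAlg n) (smoothAlg n)) :
    (wirt n).beta (ofReal r hr) ev q [U] [] =
      dirDeriv (fun j => ev q (U ((wirt n).z j))) (cplx r) q := by
  rw [beta, word_cons, word_nil, act_vac_eq, map_sum, AddMonoidHom.finsetSum_apply, map_sum,
    dirDeriv]
  refine Finset.sum_congr rfl fun j _ => ?_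
  rw [pair_smul_left, pair_shift_left, map_mul, vac, pair_single]
  simp [ev_apply, D_apply, coe_ofReal]

lemma beta_two (r : (Fin n → ℂ) → ℝ) (hr : ContDiff ℝ (⊤ : ℕ∞) r) (q : Fin n → ℂ)
    (U W : Derivation ℂ (smoothAlg n) (smoothAlg n)) :
    (wirt n).beta (ofReal r hr) ev q [U] [W] =
      levi r (fun j => ev q (U ((wirt n).z j))) (fun j => ev q (W ((wirt n).z j))) q := by
  rw [beta, word_cons, word_nil, word_cons, word_nil, act_vac_eq, act_vac_eq, levi_eq r hr]
  simp only [map_sum, AddMonoidHom.finsetSum_apply]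
  rw [Finset.sum_comm]
  refine Finset.sum_congr rfl fun j _ => ?_
  refine Finset.sum_congr rfl fun k _ => ?_
  rw [pair_smul_left, pair_smul_right, pair_shift_left, pair_shift_right, vac, pair_single]
  rw [← (wirt n).D_Db_comm]
  simp only [map_mul, map_star, map_one, star_one, jet_zero, ev_apply]
  simp only [RCLike.star_def]
  ring

theorem not_finiteTypePt_of_field (r ρ : (Fin n → ℂ) → ℝ) (hr : ContDiff ℝ (⊤ : ℕ∞) r)
    (p : Fin n → ℂ) (hρ : ρ =ᶠ[𝓝 p] r) (T : Set (Fin n → ℂ)) (hp : p ∈ T)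
    (hT : ∀ q ∈ T, r q = 0) (hL : ∀ q ∈ T, LeviLowerBound r q) (l : (Fin n → ℂ) → Fin n → ℂ)
    (hl : ContDiff ℝ (⊤ : ℕ∞) l)
    (htan : ∀ f : (Fin n → ℂ) → ℂ, ContDiff ℝ (⊤ : ℕ∞) f → (∀ q ∈ T, f q = 0) →
      ∀ q ∈ T, dirDeriv (l q) f q = 0)
    (hnull : ∀ q ∈ T, ∀ X, dirDeriv X (cplx r) q = 0 → levi r X (l q) q = 0)
    (hlp : l p ≠ 0) : ¬ FiniteTypePt ρ p := by
  set l' : Fin n → smoothAlg n := fun j => ⟨fun z => l z j, contDiff_pi.mp hl j⟩ with hl'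
  set L := fieldDer l' with hLdef
  have hev : ∀ q : Fin n → ℂ, (fun j => ev q (l' j)) = l q := fun q => rfl
  have hideal : ∀ f : smoothAlg n, (∀ q : T, ev (q : Fin n → ℂ) f = 0) →
      ∀ q : T, ev (q : Fin n → ℂ) (L f) = 0 := by
    intro f hf q
    rw [ev_fieldDer, hev]
    exact htan f (smoothAlg.contDiff f) (fun q hq => hf ⟨q, hq⟩) q q.2
  have hsys : CRSystem (wirt n) (ofReal r hr) (fun q : T => ev (q : Fin n → ℂ)) L := by
    refine ⟨star_ofReal r hr, ?_, fieldDer_star_z l', hideal, ?_, ?_, ?_, ?_⟩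
    · intro f
      simp only [L, fieldDer_z, fieldDer_star_z, zero_mul, add_zero]
      exact fieldDer_apply l' f
    · intro f hf q
      rw [bar_apply, map_star, hideal (star f) (fun q => by rw [map_star, hf q, star_zero]) q,
        star_zero]
    · intro q
      rw [ev_apply, ofReal_apply, hT q q.2, Complex.ofReal_zero]
    · intro q U _ h
      have h1 := beta_one r hr q U
      have h2 := beta_two r hr q U L
      simp only [L, fieldDer_z] at h2
      rw [hev] at h2
      exact h2.trans (hnull q q.2 _ (h1.symm.trans h))
    · intro q V _ _ U _ N hN h1 h2 h3
      exact pos_of_leviLowerBound r hr q (hL q q.2) V U N hN h1 h2 h3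
  obtain ⟨j, hj⟩ := Function.ne_iff.mp hlp
  have hV : L + bar L ∈ genAlg L := add_mem (self_mem_genAlg L) (bar_self_mem_genAlg L)
  refine not_finiteTypePt r ρ hr p hρ (L + bar L) (j := j) (fun a c => ?_) ?_
  · exact hsys.beta_eq_zero ⟨p, hp⟩ _ _ (fun V h => by rwa [(List.mem_replicate.mp h).2])
      (fun V h => by rwa [(List.mem_replicate.mp h).2])
  · rw [Derivation.add_apply, bar_apply, fieldDer_z, fieldDer_star_z, star_zero, add_zero]
    exact hj

end smoothAlg

lemma surjective_pi_of_linearIndependent {K E ι : Type*} [Field K] [AddCommGroup E] [Module K E]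
    [Finite ι] (f : ι → Module.Dual K E) (h : LinearIndependent K f) :
    Function.Surjective (LinearMap.pi f) := by
  have h1 : LinearIndependent K fun (i : ι) (x : E) => f i x := by
    have := h.map' (LinearMap.ltoFun K E K K) (by
      rw [LinearMap.ker_eq_bot]; exact DFunLike.coe_injective)
    exact this
  have h2 := span_flip_eq_top_iff_linearIndependent.mpr h1
  rw [← LinearMap.range_eq_top, ← top_le_iff, ← h2, Submodule.span_le]
  rintro _ ⟨x, rfl⟩
  exact ⟨x, rfl⟩

namespace smoothAlg

open WirtingerSystem

variable {n : ℕ}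

/-- The value at `q` of a smooth `(1,0)` covector field. -/
def cov (ω : Fin n → smoothAlg n) (q : Fin n → ℂ) : Module.Dual ℂ (Fin n → ℂ) :=
  ∑ j, ev q (ω j) • LinearMap.proj j

lemma cov_apply (ω : Fin n → smoothAlg n) (q X : Fin n → ℂ) :
    cov ω q X = ∑ j, ev q (ω j) * X j := by
  simp [cov]

lemma ev_algebraMap (q : Fin n → ℂ) (c : ℂ) : ev q (algebraMap ℂ (smoothAlg n) c) = c := rfl

/-- The common kernel at `q` of a family of covector fields. -/
def commonKer (A : Set (Fin n → smoothAlg n)) (q : Fin n → ℂ) : Submodule ℂ (Fin n → ℂ) :=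
  ⨅ ω ∈ A, LinearMap.ker (cov ω q)

lemma mem_commonKer {A : Set (Fin n → smoothAlg n)} {q X : Fin n → ℂ} :
    X ∈ commonKer A q ↔ ∀ ω ∈ A, cov ω q X = 0 := by
  simp [commonKer, Submodule.mem_iInf]

/-- Independent covector fields at `p` admit a smooth vector field in their common kernel. -/
lemma exists_field_in_ker {ι : Type*} [Fintype ι] (ω : ι → Fin n → smoothAlg n) (p : Fin n → ℂ)
    (hω : LinearIndependent ℂ fun i => cov (ω i) p) (X : Fin n → ℂ)
    (hX : ∀ i, cov (ω i) p X = 0) : ∃ l : Fin n → smoothAlg n,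
      (∀ q i, cov (ω i) q (fun j => ev q (l j)) = 0) ∧ (fun j => ev p (l j)) = X ∧
      ∀ᶠ q in 𝓝 p, Function.Surjective (LinearMap.pi fun i => cov (ω i) q) := by
  classical
  have hs := surjective_pi_of_linearIndependent _ hω
  choose S hS using fun k : ι => hs (Pi.single k 1)
  set M : Matrix ι ι (smoothAlg n) :=
    Matrix.of fun i k => ∑ j, ω i j * algebraMap ℂ (smoothAlg n) (S k j) with hM
  set w : ι → smoothAlg n := fun i => ∑ j, ω i j * algebraMap ℂ (smoothAlg n) (X j) with hw
  have hMev : ∀ q i k, ev q (M i k) = cov (ω i) q (S k) := by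
    intro q i k
    simp [hM, cov_apply, ev_algebraMap]
  have hwev : ∀ q i, ev q (w i) = cov (ω i) q X := by
    intro q i
    simp [hw, cov_apply, ev_algebraMap]
  have hMp : (ev p).toRingHom.mapMatrix M = 1 := by
    ext i k
    have h1 : cov (ω i) p (S k) = (Pi.single k 1 : ι → ℂ) i := congrFun (hS k) i
    change ev p (M i k) = _
    rw [hMev, h1, Matrix.one_apply, Pi.single_apply]
  have hdet : ev p M.det = 1 := by
    have := RingHom.map_det (ev p).toRingHom M
    rw [hMp, Matrix.det_one] at this
    exact this
  refine ⟨fun j => M.det * algebraMap ℂ _ (X j) -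
    ∑ k, algebraMap ℂ _ (S k j) * (M.adjugate.mulVec w) k, ?_, ?_, ?_⟩
  · intro q i
    have h1 : ∑ j, ω i j * (M.det * algebraMap ℂ _ (X j) -
        ∑ k, algebraMap ℂ _ (S k j) * (M.adjugate.mulVec w) k) = 0 := by
      have h2 : ∑ j, ω i j * ∑ k, algebraMap ℂ _ (S k j) * (M.adjugate.mulVec w) k =
          M.mulVec (M.adjugate.mulVec w) i := by
        simp only [Finset.mul_sum]
        rw [Finset.sum_comm]
        simp only [Matrix.mulVec, dotProduct, hM, Matrix.of_apply, Finset.sum_mul, mul_assoc]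
      rw [Matrix.mulVec_mulVec, Matrix.mul_adjugate, Matrix.smul_mulVec, Matrix.one_mulVec,
        Pi.smul_apply, smul_eq_mul] at h2
      simp only [mul_sub, Finset.sum_sub_distrib]
      rw [h2, hw]
      simp only [Finset.mul_sum]
      rw [sub_eq_zero]
      exact Finset.sum_congr rfl fun j _ => by ring
    have h3 := congrArg (ev q) h1
    rw [cov_apply]
    simpa only [map_sum, map_mul, map_zero] using h3
  · funext j
    have h1 : ∀ k, ev p ((M.adjugate.mulVec w) k) = 0 := by
      intro k
      simp only [Matrix.mulVec, dotProduct, map_sum, map_mul, hwev, hX, mul_zero,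
        Finset.sum_const_zero]
    simp only [map_sub, map_mul, map_sum, h1, hdet, mul_zero, Finset.sum_const_zero, sub_zero,
      one_mul, ev_algebraMap]
  · have hcont : Continuous fun q => ev q M.det := (smoothAlg.contDiff M.det).continuous
    have hne : ∀ᶠ q in 𝓝 p, ev q M.det ≠ 0 :=
      hcont.continuousAt.eventually_ne (by rw [hdet]; exact one_ne_zero)
    filter_upwards [hne] with q hq
    set A := (ev q).toRingHom.mapMatrix M with hA
    have hAdet : A.det ≠ 0 := by
      have : ev q M.det = A.det := RingHom.map_det (ev q).toRingHom M
      rwa [← this]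
    intro y
    refine ⟨∑ k, (A⁻¹.mulVec y) k • S k, ?_⟩
    ext i
    have h1 : A.mulVec (A⁻¹.mulVec y) i = y i := by
      rw [Matrix.mulVec_mulVec, Matrix.mul_nonsing_inv _ (isUnit_iff_ne_zero.mpr hAdet),
        Matrix.one_mulVec]
    rw [← h1, LinearMap.pi_apply, map_sum, Matrix.mulVec, dotProduct]
    refine Finset.sum_congr rfl fun k _ => ?_
    rw [map_smul, smul_eq_mul, mul_comm, ← hMev]
    rfl

/-- At a point where the common kernel of a sheaf of covector fields has minimal dimension,
every vector of the kernel extends to a smooth section. -/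
lemma exists_field_of_minimal (T : Set (Fin n → ℂ)) (hne : T.Nonempty)
    (A : (Fin n → ℂ) → Set (Fin n → smoothAlg n))
    (hA : ∀ q ∈ T, ∀ ω ∈ A q, ∀ᶠ q' in 𝓝 q, q' ∈ T → ω ∈ A q')
    (hX : ∀ q ∈ T, ∃ X ≠ 0, X ∈ commonKer (A q) q) :
    ∃ p ∈ T, ∃ l : Fin n → smoothAlg n, (fun j => ev p (l j)) ≠ 0 ∧
      ∀ᶠ q in 𝓝 p, q ∈ T → (fun j => ev q (l j)) ∈ commonKer (A q) q := by
  have : Nonempty T := hne.to_subtype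
  set d : T → ℕ := fun q => Module.finrank ℂ (commonKer (A q) (q : Fin n → ℂ)) with hd
  obtain ⟨⟨p, hp⟩, hmin⟩ : ∃ p : T, ∀ q, d p ≤ d q :=
    ⟨Function.argmin d, fun q => Function.argmin_le d q⟩
  obtain ⟨X, hX0, hXp⟩ := hX p hp
  obtain ⟨b, hbs, hbspan, hbli⟩ := exists_linearIndependent ℂ ((fun ω => cov ω p) '' A p)
  have : Fintype b := hbli.setFinite.fintype
  choose ω hωA hω using fun i : b => hbs i.2
  have hli : LinearIndependent ℂ fun i : b => cov (ω i) p := by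
    have : (fun i : b => cov (ω i) p) = Subtype.val := funext hω
    rwa [this]
  have hker : ∀ Y, (∀ i, cov (ω i) p Y = 0) → Y ∈ commonKer (A p) p := by
    intro Y hY
    rw [mem_commonKer]
    intro η hη
    have h1 : cov η p ∈ Submodule.span ℂ b := by
      rw [hbspan]; exact Submodule.subset_span ⟨η, hη, rfl⟩
    have h2 : Submodule.span ℂ b ≤ LinearMap.ker (Module.Dual.eval ℂ (Fin n → ℂ) Y) := by
      rw [Submodule.span_le]
      intro x hx
      have := hY ⟨x, hx⟩
      have h3 : cov (ω ⟨x, hx⟩) p = x := hω ⟨x, hx⟩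
      rw [h3] at this
      exact this
    exact h2 h1
  obtain ⟨l, hl, hlp, hsurj⟩ := exists_field_in_ker ω p hli X
    fun i => mem_commonKer.mp hXp _ (hωA i)
  refine ⟨p, hp, l, by rwa [hlp], ?_⟩
  have hev : ∀ᶠ q in 𝓝 p, ∀ i, q ∈ T → ω i ∈ A q :=
    Filter.eventually_all.mpr fun i => hA p hp _ (hωA i)
  filter_upwards [hev, hsurj] with q hq hqs hqT
  have hle : commonKer (A q) q ≤ LinearMap.ker (LinearMap.pi fun i => cov (ω i) q) := by
    intro Y hY
    rw [LinearMap.mem_ker]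
    ext i
    exact mem_commonKer.mp hY _ (hq i hqT)
  have hrank : ∀ q, Function.Surjective (LinearMap.pi fun i => cov (ω i) q) →
      Fintype.card b + Module.finrank ℂ (LinearMap.ker (LinearMap.pi fun i => cov (ω i) q)) = n := by
    intro q hs
    have := LinearMap.finrank_range_add_finrank_ker (LinearMap.pi fun i => cov (ω i) q)
    rw [LinearMap.range_eq_top.mpr hs, finrank_top] at this
    simpa using this
  have hkp : LinearMap.ker (LinearMap.pi fun i => cov (ω i) p) ≤ commonKer (A p) p := by
    intro Y hY
    exact hker Y fun i => congrFun (LinearMap.mem_ker.mp hY) i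
  have e1 := hrank q hqs
  have e2 := hrank p (surjective_pi_of_linearIndependent _ hli)
  have e3 : Module.finrank ℂ (commonKer (A p) p) ≤ Module.finrank ℂ (commonKer (A q) q) :=
    hmin ⟨q, hqT⟩
  have e4 := Submodule.finrank_mono hkp
  rw [Submodule.eq_of_le_of_finrank_le hle (by omega), LinearMap.mem_ker]
  ext i
  exact hl q i

end smoothAlg

section leviAlgebra

variable {n : ℕ} (r : (Fin n → ℂ) → ℝ) (X X' Y Y' z : Fin n → ℂ) (c : ℂ)

lemma levi_add_left : levi r (X + X') Y z = levi r X Y z + levi r X' Y z := by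
  simp only [levi, Pi.add_apply, mul_add, add_mul, Finset.sum_add_distrib]

lemma levi_add_right : levi r X (Y + Y') z = levi r X Y z + levi r X Y' z := by
  simp only [levi, Pi.add_apply, map_add, mul_add, Finset.sum_add_distrib]

lemma levi_smul_left : levi r (c • X) Y z = c * levi r X Y z := by
  simp only [levi, Pi.smul_apply, smul_eq_mul, Finset.mul_sum]
  exact Finset.sum_congr rfl fun j _ => Finset.sum_congr rfl fun k _ => by ring

lemma levi_smul_right : levi r X (c • Y) z = (starRingEnd ℂ) c * levi r X Y z := by
  simp only [levi, Pi.smul_apply, smul_eq_mul, map_mul, Finset.mul_sum]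
  exact Finset.sum_congr rfl fun j _ => Finset.sum_congr rfl fun k _ => by ring

lemma dirDeriv_add (f : (Fin n → ℂ) → ℂ) :
    dirDeriv (X + X') f z = dirDeriv X f z + dirDeriv X' f z := by
  simp only [dirDeriv, Pi.add_apply, add_mul, Finset.sum_add_distrib]

lemma dirDeriv_smul (f : (Fin n → ℂ) → ℂ) : dirDeriv (c • X) f z = c * dirDeriv X f z := by
  simp only [dirDeriv, Pi.smul_apply, smul_eq_mul, Finset.mul_sum, mul_assoc]

open smoothAlg WirtingerSystem in
lemma conj_levi (hr : ContDiff ℝ (⊤ : ℕ∞) r) :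
    (starRingEnd ℂ) (levi r X Y z) = levi r Y X z := by
  rw [levi_eq r hr, levi_eq r hr, Finset.sum_comm]
  simp only [map_sum, map_mul, Complex.conj_conj]
  refine Finset.sum_congr rfl fun j _ => Finset.sum_congr rfl fun k _ => ?_
  have h1 : star ((wirt n).D k ((wirt n).Db j (ofReal r hr))) =
      (wirt n).D j ((wirt n).Db k (ofReal r hr)) := by
    have h2 := (wirt n).Db_star j (ofReal r hr)
    rw [star_ofReal] at h2
    rw [← (wirt n).Db_star, h2, star_star]
    have h3 := (wirt n).Db_star k (ofReal r hr)
    rw [star_ofReal] at h3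
    exact ((wirt n).D_Db_comm _ _ _).symm
  have h4 : (starRingEnd ℂ) (((wirt n).D k ((wirt n).Db j (ofReal r hr)) : (Fin n → ℂ) → ℂ) z) =
      ((wirt n).D j ((wirt n).Db k (ofReal r hr)) : (Fin n → ℂ) → ℂ) z := by
    rw [← h1]; rfl
  rw [h4]; ring

lemma levi_eq_zero_of_null (hr : ContDiff ℝ (⊤ : ℕ∞) r) (hp : LeviPseudoconvexAt r z)
    (hX : dirDeriv X (cplx r) z = 0) (h0 : (levi r X X z).re = 0)
    (hY : dirDeriv Y (cplx r) z = 0) : levi r X Y z = 0 := by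
  set b := levi r X Y z with hb
  have h1 : ∀ t : ℝ, 0 ≤ (levi r Y Y z).re - 2 * t * Complex.normSq b := by
    intro t
    set s : ℂ := -(t : ℂ) * (starRingEnd ℂ) b with hs
    have h2 := hp (s • X + Y) (by rw [dirDeriv_add, dirDeriv_smul, hX, hY, mul_zero, add_zero])
    rw [levi_add_left, levi_add_right, levi_add_right, levi_smul_left, levi_smul_left,
      levi_smul_right, levi_smul_right, ← conj_levi r X Y z hr, ← hb] at h2
    have h3 : (s * ((starRingEnd ℂ) s * levi r X X z)).re = 0 := by
      rw [← mul_assoc, Complex.mul_conj, Complex.re_ofReal_mul, h0, mul_zero]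
    have h4 : (s * b).re = -t * Complex.normSq b := by
      rw [hs, mul_assoc, mul_comm ((starRingEnd ℂ) b), Complex.mul_conj]
      norm_cast
    have h5 : ((starRingEnd ℂ) s * (starRingEnd ℂ) b).re = -t * Complex.normSq b := by
      rw [← map_mul, Complex.conj_re, h4]
    simp only [Complex.add_re, h3, h4, h5] at h2
    linarith
  by_contra hne
  have hpos : 0 < Complex.normSq b := Complex.normSq_pos.mpr hne
  have := h1 (((levi r Y Y z).re + 1) / (2 * Complex.normSq b))
  have h6 : 2 * (((levi r Y Y z).re + 1) / (2 * Complex.normSq b)) * Complex.normSq b =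
      (levi r Y Y z).re + 1 := by field_simp
  linarith

end leviAlgebra

namespace smoothAlg

open WirtingerSystem

variable {n : ℕ}

/-- The covector fields annihilating the candidate null directions over `T` near `q`. -/
def nullCov (r : (Fin n → ℂ) → ℝ) (hr : ContDiff ℝ (⊤ : ℕ∞) r) (T : Set (Fin n → ℂ))
    (q : Fin n → ℂ) : Set (Fin n → smoothAlg n) :=
  {ω | ∃ f : smoothAlg n, (∀ᶠ z in 𝓝 q, z ∈ T → (f : (Fin n → ℂ) → ℂ) z = 0) ∧
    ω = fun j => (wirt n).D j f} ∪
  {ω | ∃ a b, ω = fun j =>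
    star ((wirt n).D a (ofReal r hr)) * (wirt n).D j ((wirt n).Db b (ofReal r hr)) -
    star ((wirt n).D b (ofReal r hr)) * (wirt n).D j ((wirt n).Db a (ofReal r hr))}

lemma cov_D (f : smoothAlg n) (q X : Fin n → ℂ) :
    cov (fun j => (wirt n).D j f) q X = dirDeriv X (f : (Fin n → ℂ) → ℂ) q := by
  rw [cov_apply, dirDeriv]
  exact Finset.sum_congr rfl fun j _ => by rw [ev_apply, D_apply, mul_comm]

lemma levi_single_right (r : (Fin n → ℂ) → ℝ) (hr : ContDiff ℝ (⊤ : ℕ∞) r) (X z : Fin n → ℂ)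
    (b : Fin n) : levi r X (Pi.single b 1) z =
      ∑ j, ((wirt n).D j ((wirt n).Db b (ofReal r hr)) : (Fin n → ℂ) → ℂ) z * X j := by
  rw [levi_eq r hr]
  refine Finset.sum_congr rfl fun j _ => ?_
  rw [Finset.sum_eq_single b]
  · simp
  · intro k _ hk; simp [hk]
  · simp

lemma cov_nullCov (r : (Fin n → ℂ) → ℝ) (hr : ContDiff ℝ (⊤ : ℕ∞) r) (a b : Fin n)
    (q X : Fin n → ℂ) :
    cov (fun j => star ((wirt n).D a (ofReal r hr)) * (wirt n).D j ((wirt n).Db b (ofReal r hr)) -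
      star ((wirt n).D b (ofReal r hr)) * (wirt n).D j ((wirt n).Db a (ofReal r hr))) q X =
    levi r X (dz a (cplx r) q • Pi.single b 1 + (-dz b (cplx r) q) • Pi.single a 1) q := by
  rw [levi_add_right, levi_smul_right, levi_smul_right, levi_single_right r hr,
    levi_single_right r hr, cov_apply, map_neg, Finset.mul_sum, Finset.mul_sum,
    ← Finset.sum_add_distrib]
  refine Finset.sum_congr rfl fun j _ => ?_
  rw [map_sub, map_mul, map_mul, map_star, map_star, ev_apply _ ((wirt n).D a _),
    ev_apply _ ((wirt n).D b _), D_apply, D_apply, coe_ofReal, ev_apply, ev_apply]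
  simp only [RCLike.star_def]
  ring

lemma levi_eq_zero_of_mem_commonKer {r : (Fin n → ℂ) → ℝ} (hr : ContDiff ℝ (⊤ : ℕ∞) r)
    {T : Set (Fin n → ℂ)} {q X Y : Fin n → ℂ} (hX : X ∈ commonKer (nullCov r hr T q) q)
    (hgrad : ∃ j, dz j (cplx r) q ≠ 0) (hY : dirDeriv Y (cplx r) q = 0) : levi r X Y q = 0 := by
  obtain ⟨a, ha⟩ := hgrad
  rw [mem_commonKer] at hX
  have h1 : dz a (cplx r) q • Y = ∑ b, Y b •
      (dz a (cplx r) q • Pi.single b 1 + (-dz b (cplx r) q) • Pi.single a 1 : Fin n → ℂ) := by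
    have h2 : ∑ b, Y b * dz b (cplx r) q = 0 := hY
    have h3 : ∑ b, Y b • (Pi.single b 1 : Fin n → ℂ) = Y := by
      ext j; simp [Finset.sum_apply, Pi.single_apply]
    simp only [smul_add, Finset.sum_add_distrib, smul_smul]
    rw [← Finset.sum_smul]
    simp only [mul_neg, Finset.sum_neg_distrib, h2, neg_zero, zero_smul, add_zero]
    conv_lhs => rw [← h3, Finset.smul_sum]
    exact Finset.sum_congr rfl fun b _ => by rw [smul_smul, mul_comm]
  have h4 : levi r X (dz a (cplx r) q • Y) q = 0 := by
    rw [h1]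
    have : ∀ s : Finset (Fin n), levi r X (∑ b ∈ s, Y b •
      (dz a (cplx r) q • Pi.single b 1 + (-dz b (cplx r) q) • Pi.single a 1 : Fin n → ℂ)) q = 0 := by
      intro s
      induction s using Finset.induction_on with
      | empty => simp [levi]
      | insert b s hb ih =>
        rw [Finset.sum_insert hb, levi_add_right, ih, levi_smul_right, ← cov_nullCov r hr,
          hX _ (Or.inr ⟨a, b, rfl⟩), mul_zero, add_zero]
    exact this _
  rw [levi_smul_right] at h4
  exact (mul_eq_zero.mp h4).resolve_left (by simpa using ha)

theorem exists_not_finiteTypePt (r : (Fin n → ℂ) → ℝ) (hr : ContDiff ℝ (⊤ : ℕ∞) r)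
    (T : Set (Fin n → ℂ)) (hne : T.Nonempty) (hT : ∀ q ∈ T, r q = 0)
    (hgrad : ∀ q ∈ T, ∃ j, dz j (cplx r) q ≠ 0) (hL : ∀ q ∈ T, LeviLowerBound r q)
    (hpc : ∀ q ∈ T, LeviPseudoconvexAt r q)
    (hX : ∀ q ∈ T, ∃ X ≠ 0, (levi r X X q).re = 0 ∧ ∀ f : (Fin n → ℂ) → ℝ,
      ContDiff ℝ (⊤ : ℕ∞) f → (∀ᶠ z in 𝓝 q, z ∈ T → f z = 0) → dirDeriv X (cplx f) q = 0) :
    ∃ p ∈ T, ∀ ρ : (Fin n → ℂ) → ℝ, ρ =ᶠ[𝓝 p] r → ¬ FiniteTypePt ρ p := by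
  have hA : ∀ q ∈ T, ∀ ω ∈ nullCov r hr T q, ∀ᶠ q' in 𝓝 q, q' ∈ T → ω ∈ nullCov r hr T q' := by
    rintro q hq ω (⟨f, hf, rfl⟩ | ⟨a, b, rfl⟩)
    · filter_upwards [eventually_eventually_nhds.mpr hf] with q' hq' _ using Or.inl ⟨f, hq', rfl⟩
    · exact Filter.Eventually.of_forall fun q' _ => Or.inr ⟨a, b, rfl⟩
  have hN : ∀ q ∈ T, ∃ X ≠ 0, X ∈ commonKer (nullCov r hr T q) q := by
    intro q hq
    obtain ⟨X, hX0, hXn, hXf⟩ := hX q hq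
    refine ⟨X, hX0, ?_⟩
    have hXr : dirDeriv X (cplx r) q = 0 := hXf r hr (Filter.Eventually.of_forall hT)
    rw [mem_commonKer]
    rintro ω (⟨f, hf, rfl⟩ | ⟨a, b, rfl⟩)
    · rw [cov_D]
      have hre := hXf (fun z => ((f : (Fin n → ℂ) → ℂ) z).re)
        (Complex.reCLM.contDiff.comp (smoothAlg.contDiff f)) (hf.mono fun z hz hzT => by
          rw [hz hzT, Complex.zero_re])
      have him := hXf (fun z => ((f : (Fin n → ℂ) → ℂ) z).im)
        (Complex.imCLM.contDiff.comp (smoothAlg.contDiff f)) (hf.mono fun z hz hzT => by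
          rw [hz hzT, Complex.zero_im])
      set fr : smoothAlg n := ofReal _ (Complex.reCLM.contDiff.comp (smoothAlg.contDiff f)) with hfr
      set fi : smoothAlg n := ofReal _ (Complex.imCLM.contDiff.comp (smoothAlg.contDiff f)) with hfi
      have hsum : f = fr + I • fi := by
        ext z
        change (f : (Fin n → ℂ) → ℂ) z = ((f : (Fin n → ℂ) → ℂ) z).re +
          I * ((f : (Fin n → ℂ) → ℂ) z).im
        rw [mul_comm, Complex.re_add_im]
      have h1 : cov (fun j => (wirt n).D j fr) q X = 0 := by rw [cov_D]; exact hre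
      have h2 : cov (fun j => (wirt n).D j fi) q X = 0 := by rw [cov_D]; exact him
      rw [← cov_D, hsum, cov_apply]
      rw [cov_apply] at h1 h2
      simp only [map_add, Derivation.map_smul, map_smul, add_mul, Finset.sum_add_distrib, h1,
        smul_mul_assoc, ← Finset.smul_sum, h2, smul_zero, add_zero]
    · rw [cov_nullCov]
      refine levi_eq_zero_of_null r X _ q hr (hpc q hq) hXr hXn ?_
      have hs : ∀ b, dirDeriv (Pi.single b 1) (cplx r) q = dz b (cplx r) q := by
        intro b
        rw [dirDeriv, Finset.sum_eq_single b]
        · simp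
        · intro k _ hk; simp [hk]
        · simp
      rw [dirDeriv_add, dirDeriv_smul, dirDeriv_smul, hs, hs]
      ring
  obtain ⟨p, hp, l, hlp, hl⟩ := exists_field_of_minimal T hne (nullCov r hr T) hA hN
  obtain ⟨B, hB, hBo, hpB⟩ := eventually_nhds_iff.mp hl
  refine ⟨p, hp, fun ρ hρ => ?_⟩
  refine not_finiteTypePt_of_field r ρ hr p hρ (T ∩ B) ⟨hp, hpB⟩ (fun q hq => hT q hq.1)
    (fun q hq => hL q hq.1) (fun q j => ev q (l j)) ?_ ?_ ?_ hlp
  · exact contDiff_pi.mpr fun j => smoothAlg.contDiff (l j)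
  · intro f hf hfT q hq
    have h1 := mem_commonKer.mp (hB q hq.2 hq.1) _ (Or.inl ⟨⟨f, hf⟩, ?_, rfl⟩)
    · rwa [cov_D] at h1
    · filter_upwards [hBo.mem_nhds hq.2] with z hz hzT using hfT z ⟨hzT, hz⟩
  · intro q hq X hX
    rw [← conj_levi r _ _ _ hr,
      levi_eq_zero_of_mem_commonKer hr (hB q hq.2 hq.1) (hgrad q hq.1) hX, map_zero]

end smoothAlg

section realFunctions

variable {n : ℕ} {r : (Fin n → ℂ) → ℝ}

lemma fderiv_cplx {z : Fin n → ℂ} (hr : DifferentiableAt ℝ r z) (v : Fin n → ℂ) :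
    fderiv ℝ (cplx r) z v = (fderiv ℝ r z v : ℂ) := by
  have h := (Complex.ofRealCLM.hasFDerivAt (x := r z)).comp z hr.hasFDerivAt
  have h2 : HasFDerivAt (cplx r) (Complex.ofRealCLM.comp (fderiv ℝ r z)) z := h
  rw [h2.fderiv]; rfl

lemma dzbar_cplx {z : Fin n → ℂ} (hr : DifferentiableAt ℝ r z) (j : Fin n) :
    dzbar j (cplx r) z = (starRingEnd ℂ) (dz j (cplx r) z) := by
  simp only [dz, dzbar, fderiv_cplx hr]
  rw [map_div₀, map_sub, map_mul, Complex.conj_I, Complex.conj_ofReal, Complex.conj_ofReal,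
    map_ofNat]
  ring

lemma fderiv_eq_two_re {z : Fin n → ℂ} (hr : DifferentiableAt ℝ r z) (v : Fin n → ℂ) :
    fderiv ℝ r z v = 2 * (dirDeriv v (cplx r) z).re := by
  have h1 : dirDerivBar v (cplx r) z = (starRingEnd ℂ) (dirDeriv v (cplx r) z) := by
    simp only [dirDerivBar, dirDeriv, map_sum, map_mul, dzbar_cplx hr]
  have h2 := fderiv_eq_dirDeriv (cplx r) z v
  rw [h1, fderiv_cplx hr, Complex.add_conj] at h2
  exact_mod_cast h2

lemma exists_dz_ne_zero {z : Fin n → ℂ} (hr : DifferentiableAt ℝ r z) (h : fderiv ℝ r z ≠ 0) :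
    ∃ j, dz j (cplx r) z ≠ 0 := by
  by_contra! hc
  apply h
  ext v
  rw [fderiv_eq_two_re hr, dirDeriv]
  simp [hc]

/-- Near a regular zero, the distance to the zero set is controlled by the function. -/
lemma exists_zero_near (hr : ContDiff ℝ (⊤ : ℕ∞) r) {q : Fin n → ℂ} (hq : r q = 0)
    (hg : fderiv ℝ r q ≠ 0) (t : Set (Fin n → ℂ)) (ht : t ∈ 𝓝 q) :
    ∃ C, 0 ≤ C ∧ ∀ᶠ z in 𝓝 q, ∃ z' ∈ t, r z' = 0 ∧ ‖z - z'‖ ≤ C * |r z| := by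
  obtain ⟨v, hv⟩ : ∃ v, fderiv ℝ r q v = 1 := by
    obtain ⟨w, hw⟩ : ∃ w, fderiv ℝ r q w ≠ 0 := by
      by_contra! hc
      exact hg (by ext w; simp [hc w])
    exact ⟨(fderiv ℝ r q w)⁻¹ • w, by rw [map_smul, smul_eq_mul, inv_mul_cancel₀ hw]⟩
  have hcont : Continuous fun z => fderiv ℝ r z v :=
    (hr.continuous_fderiv (by simp)).clm_apply continuous_const
  have h1 : {z | 1 / 2 < fderiv ℝ r z v} ∈ 𝓝 q :=
    hcont.continuousAt.eventually (lt_mem_nhds (by simp only [hv]; norm_num))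
  obtain ⟨ε, hε, hball⟩ := Metric.mem_nhds_iff.mp (Filter.inter_mem h1 ht)
  refine ⟨2 * ‖v‖, by positivity, ?_⟩
  have h2 : ∀ᶠ z in 𝓝 q, ‖z - q‖ + 2 * |r z| * ‖v‖ < ε := by
    have hc : Continuous fun z => ‖z - q‖ + 2 * |r z| * ‖v‖ := by
      have := hr.continuous
      fun_prop
    refine hc.continuousAt.eventually (gt_mem_nhds ?_)
    simpa [hq] using hε
  filter_upwards [h2] with z hz
  set s := 2 * |r z| with hs
  have hs0 : 0 ≤ s := by positivity
  have hmem : ∀ x ∈ Set.Icc (-s) s, z + x • v ∈ Metric.ball q ε := by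
    intro x hx
    rw [Metric.mem_ball, dist_eq_norm]
    have e1 : z + x • v - q = (z - q) + x • v := by abel
    have e2 : ‖x • v‖ ≤ s * ‖v‖ := by
      rw [norm_smul]
      exact mul_le_mul_of_nonneg_right (abs_le.mpr hx) (norm_nonneg v)
    rw [e1]
    exact (norm_add_le _ _).trans_lt (by linarith)
  have hder : ∀ x : ℝ, HasDerivAt (fun x : ℝ => r (z + x • v)) (fderiv ℝ r (z + x • v) v) x := by
    intro x
    have h3 : HasDerivAt (fun x : ℝ => z + x • v) v x := by
      simpa using ((hasDerivAt_id x).smul_const v).const_add z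
    exact ((hr.differentiable (by simp)) _).hasFDerivAt.comp_hasDerivAt x h3
  have hgrow : ∀ x ∈ Set.Icc (-s) s, ∀ y ∈ Set.Icc (-s) s, x ≤ y →
      1 / 2 * (y - x) ≤ r (z + y • v) - r (z + x • v) := by
    refine (convex_Icc (-s) s).mul_sub_le_image_sub_of_le_deriv
      (fun x _ => (hder x).continuousAt.continuousWithinAt)
      (fun x _ => (hder x).differentiableAt.differentiableWithinAt) ?_
    intro x hx
    rw [(hder x).deriv]
    exact (hball (hmem x (interior_subset hx))).1.le
  have h4 := hgrow 0 ⟨by linarith, hs0⟩ s ⟨by linarith, le_rfl⟩ hs0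
  have h5 := hgrow (-s) ⟨le_rfl, by linarith⟩ 0 ⟨by linarith, hs0⟩ (by linarith)
  simp only [zero_smul, add_zero] at h4 h5
  have hc : ContinuousOn (fun x : ℝ => r (z + x • v)) (Set.Icc (-s) s) :=
    fun x _ => (hder x).continuousAt.continuousWithinAt
  have habs := abs_le.mp (le_refl |r z|)
  obtain ⟨x, hx, hx0⟩ := intermediate_value_Icc (by linarith) hc
    (show (0 : ℝ) ∈ Set.Icc (r (z + (-s) • v)) (r (z + s • v)) from
      ⟨by linarith, by linarith⟩)
  refine ⟨z + x • v, (hball (hmem x hx)).2, hx0, ?_⟩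
  rw [sub_add_cancel_left, norm_neg, norm_smul, Real.norm_eq_abs]
  have := abs_le.mpr hx
  nlinarith [norm_nonneg v]

lemma norm_dirDeriv_le (a X : Fin n → ℂ) : ‖∑ j, X j * a j‖ ≤ n * ‖X‖ * ‖a‖ := by
  refine (norm_sum_le _ _).trans ?_
  have : ∀ j ∈ Finset.univ, ‖X j * a j‖ ≤ ‖X‖ * ‖a‖ := fun j _ => by
    rw [norm_mul]
    exact mul_le_mul (norm_le_pi_norm X j) (norm_le_pi_norm a j) (norm_nonneg _) (norm_nonneg _)
  refine (Finset.sum_le_card_nsmul _ _ _ this).trans ?_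
  simp [mul_assoc]

lemma norm_form_le (c : Fin n → Fin n → ℂ) (X Y : Fin n → ℂ) :
    ‖∑ j, ∑ k, c j k * X j * (starRingEnd ℂ) (Y k)‖ ≤ n * n * ‖c‖ * ‖X‖ * ‖Y‖ := by
  refine (norm_sum_le _ _).trans ?_
  have : ∀ j ∈ Finset.univ, ‖∑ k, c j k * X j * (starRingEnd ℂ) (Y k)‖ ≤
      n * (‖c‖ * ‖X‖ * ‖Y‖) := fun j _ => by
    refine (norm_sum_le _ _).trans ?_
    have : ∀ k ∈ Finset.univ, ‖c j k * X j * (starRingEnd ℂ) (Y k)‖ ≤ ‖c‖ * ‖X‖ * ‖Y‖ :=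
      fun k _ => by
        rw [norm_mul, norm_mul, RCLike.norm_conj]
        have h1 : ‖c j k‖ ≤ ‖c‖ := (norm_le_pi_norm (c j) k).trans (norm_le_pi_norm c j)
        have h2 := norm_le_pi_norm X j
        have h3 := norm_le_pi_norm Y k
        gcongr
    refine (Finset.sum_le_card_nsmul _ _ _ this).trans ?_
    simp
  refine (Finset.sum_le_card_nsmul _ _ _ this).trans ?_
  simp [mul_assoc]

end realFunctions

open smoothAlg WirtingerSystem in
theorem leviLowerBound_of_pseudoconvex {n : ℕ} {r : (Fin n → ℂ) → ℝ}
    (hr : ContDiff ℝ (⊤ : ℕ∞) r) {q : Fin n → ℂ} (hq : r q = 0) (hg : fderiv ℝ r q ≠ 0)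
    (hp : ∀ᶠ z in 𝓝 q, r z = 0 → LeviPseudoconvexAt r z) : LeviLowerBound r q := by
  set a : (Fin n → ℂ) → Fin n → ℂ := fun z j => dz j (cplx r) z with ha
  set c : (Fin n → ℂ) → Fin n → Fin n → ℂ := fun z j k =>
    ((wirt n).D j ((wirt n).Db k (ofReal r hr)) : (Fin n → ℂ) → ℂ) z with hc
  have hda : ∀ X z, dirDeriv X (cplx r) z = ∑ j, X j * a z j := fun X z => rfl
  have hlc : ∀ X Y z, levi r X Y z = ∑ j, ∑ k, c z j k * X j * (starRingEnd ℂ) (Y k) :=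
    fun X Y z => levi_eq r hr X Y z
  have hasm : ContDiff ℝ (⊤ : ℕ∞) a := contDiff_pi.mpr fun j => by
    have := smoothAlg.contDiff ((wirt n).D j (ofReal r hr))
    have h2 : ((wirt n).D j (ofReal r hr) : (Fin n → ℂ) → ℂ) = fun z => dz j (cplx r) z :=
      funext fun z => D_apply j _ z
    rwa [h2] at this
  have hcsm : ContDiff ℝ (⊤ : ℕ∞) c := contDiff_pi.mpr fun j => contDiff_pi.mpr fun k =>
    smoothAlg.contDiff _
  obtain ⟨K₁, t₁, ht₁, hK₁⟩ := (hasm.contDiffAt (x := q)).of_le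
    (show (1 : WithTop ℕ∞) ≤ _ by exact_mod_cast le_top) |>.exists_lipschitzOnWith
  obtain ⟨K₂, t₂, ht₂, hK₂⟩ := (hcsm.contDiffAt (x := q)).of_le
    (show (1 : WithTop ℕ∞) ≤ _ by exact_mod_cast le_top) |>.exists_lipschitzOnWith
  obtain ⟨j₀, hj₀⟩ := exists_dz_ne_zero (hr.differentiable (by simp) q) hg
  set u : Fin n → ℂ := Pi.single j₀ 1 with hu
  have hdu : ∀ z, dirDeriv u (cplx r) z = a z j₀ := by
    intro z
    rw [hda, Finset.sum_eq_single j₀]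
    · simp [hu]
    · intro k _ hk; simp [hu, hk]
    · simp
  set A := ‖a q‖ + 1 with hA
  set M := ‖c q‖ + 1 with hM
  set d := ‖a q j₀‖ / 2 with hd
  have hd0 : 0 < d := by
    have : 0 < ‖a q j₀‖ := norm_pos_iff.mpr hj₀
    positivity
  have e1 : ∀ᶠ z in 𝓝 q, ‖a z‖ < A :=
    hasm.continuous.norm.continuousAt.eventually (gt_mem_nhds (by rw [hA]; linarith))
  have e2 : ∀ᶠ z in 𝓝 q, ‖c z‖ < M :=
    hcsm.continuous.norm.continuousAt.eventually (gt_mem_nhds (by rw [hM]; linarith))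
  have e3 : ∀ᶠ z in 𝓝 q, d < ‖a z j₀‖ := by
    have hcn : Continuous fun z => ‖a z j₀‖ := (continuous_apply j₀ |>.comp hasm.continuous).norm
    refine hcn.continuousAt.eventually (lt_mem_nhds ?_)
    rw [hd]
    exact half_lt_self (norm_pos_iff.mpr hj₀)
  obtain ⟨C, hC0, hC⟩ := exists_zero_near hr hq hg _
    (Filter.inter_mem (Filter.inter_mem (e1.and e2) (e3.and hp)) (Filter.inter_mem ht₁ ht₂))
  set E : ℝ := n * n * M * ‖u‖ * (2 + n * A * ‖u‖ / d) with hE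
  have hA0 : 0 ≤ A := by positivity
  have hM0 : 0 ≤ M := by positivity
  have hE0 : 0 ≤ E := by positivity
  refine ⟨E / d + E * n * K₁ * C / d + n * n * K₂ * C, by positivity, ?_⟩
  filter_upwards [hC, ht₁, ht₂] with z ⟨z', ⟨⟨⟨h1, h2⟩, ⟨h3, h4⟩⟩, ⟨h5, h6⟩⟩, hz', hzz'⟩ hz1 hz2 X
  set δ := |r z| with hδ
  set x := ‖X‖ with hx
  set g := ‖dirDeriv X (cplx r) z‖ with hgdef
  have hx0 : 0 ≤ x := norm_nonneg X
  have hδ0 : 0 ≤ δ := abs_nonneg _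
  have hg0 : 0 ≤ g := norm_nonneg _
  have f1 : ‖a z - a z'‖ ≤ K₁ * (C * δ) :=
    (hK₁.norm_sub_le hz1 h5).trans (by gcongr)
  have f2 : ‖c z - c z'‖ ≤ K₂ * (C * δ) :=
    (hK₂.norm_sub_le hz2 h6).trans (by gcongr)
  set a' := dirDeriv X (cplx r) z' with ha'
  have f3 : ‖a'‖ ≤ g + n * x * (K₁ * (C * δ)) := by
    have : a' = dirDeriv X (cplx r) z - ∑ j, X j * (a z - a z') j := by
      rw [ha', hda, hda, ← Finset.sum_sub_distrib]
      exact Finset.sum_congr rfl fun j _ => by rw [Pi.sub_apply]; ring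
    rw [this]
    refine (norm_sub_le _ _).trans (add_le_add le_rfl ((norm_dirDeriv_le _ _).trans ?_))
    gcongr
  have f3' : ‖a'‖ ≤ n * x * A := by
    rw [ha', hda]
    exact (norm_dirDeriv_le _ _).trans (by gcongr)
  set κ := a' / a z' j₀ with hκ
  have hne : a z' j₀ ≠ 0 := norm_pos_iff.mp (hd0.trans h3)
  have f4 : ‖κ‖ ≤ ‖a'‖ / d := by
    rw [hκ, norm_div]
    gcongr
  have f5 : 0 ≤ (levi r (X + (-κ) • u) (X + (-κ) • u) z').re := by
    refine h4 hz' _ ?_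
    rw [dirDeriv_add, dirDeriv_smul, hdu, ← ha', hκ]
    field_simp
    ring
  rw [levi_add_left, levi_add_right, levi_add_right, levi_smul_left, levi_smul_left,
    levi_smul_right, levi_smul_right] at f5
  have hb : ∀ Y Z, ‖levi r Y Z z'‖ ≤ n * n * M * ‖Y‖ * ‖Z‖ := by
    intro Y Z
    rw [hlc]
    exact (norm_form_le _ _ _).trans (by gcongr)
  have g1 : |((starRingEnd ℂ) (-κ) * levi r X u z').re| ≤ ‖κ‖ * (n * n * M * x * ‖u‖) := by
    refine (Complex.abs_re_le_norm _).trans ?_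
    rw [norm_mul, RCLike.norm_conj, norm_neg]
    exact mul_le_mul_of_nonneg_left (hb _ _) (norm_nonneg _)
  have g2 : |(-κ * levi r u X z').re| ≤ ‖κ‖ * (n * n * M * ‖u‖ * x) := by
    refine (Complex.abs_re_le_norm _).trans ?_
    rw [norm_mul, norm_neg]
    exact mul_le_mul_of_nonneg_left (hb _ _) (norm_nonneg _)
  have g3 : |(-κ * ((starRingEnd ℂ) (-κ) * levi r u u z')).re| ≤
      ‖κ‖ * ((n * x * A / d) * (n * n * M * ‖u‖ * ‖u‖)) := by
    refine (Complex.abs_re_le_norm _).trans ?_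
    rw [norm_mul, norm_neg, norm_mul, RCLike.norm_conj, norm_neg]
    refine mul_le_mul_of_nonneg_left (mul_le_mul (f4.trans ?_) (hb _ _) (norm_nonneg _) ?_)
      (norm_nonneg _)
    · gcongr
    · positivity
  have g4 : |(levi r X X z).re - (levi r X X z').re| ≤ n * n * (K₂ * (C * δ)) * x * x := by
    rw [← Complex.sub_re]
    refine (Complex.abs_re_le_norm _).trans ?_
    have : levi r X X z - levi r X X z' =
        ∑ j, ∑ k, (c z - c z') j k * X j * (starRingEnd ℂ) (X k) := by
      rw [hlc, hlc, ← Finset.sum_sub_distrib]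
      refine Finset.sum_congr rfl fun j _ => ?_
      rw [← Finset.sum_sub_distrib]
      exact Finset.sum_congr rfl fun k _ => by simp only [Pi.sub_apply]; ring
    rw [this]
    exact (norm_form_le _ _ _).trans (by gcongr)
  have g5 : ‖κ‖ * (E * x) ≤ (g + n * x * (K₁ * (C * δ))) / d * (E * x) :=
    mul_le_mul_of_nonneg_right (f4.trans (by gcongr)) (by positivity)
  have g6 : ‖κ‖ * (n * n * M * x * ‖u‖) + ‖κ‖ * (n * n * M * ‖u‖ * x) +
      ‖κ‖ * ((n * x * A / d) * (n * n * M * ‖u‖ * ‖u‖)) = ‖κ‖ * (E * x) := by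
    rw [hE]; ring
  have g7 : (g + n * x * (K₁ * (C * δ))) / d * (E * x) + n * n * (K₂ * (C * δ)) * x * x =
      (E / d) * (x * g) + (E * n * K₁ * C / d + n * n * K₂ * C) * (δ * x ^ 2) := by ring
  have g8 : (E / d) * (x * g) + (E * n * K₁ * C / d + n * n * K₂ * C) * (δ * x ^ 2) ≤
      (E / d + E * n * K₁ * C / d + n * n * K₂ * C) * (δ * x ^ 2 + x * g) := by
    have p1 : 0 ≤ (E / d) * (δ * x ^ 2) := by positivity
    have p2 : 0 ≤ (E * n * K₁ * C / d + n * n * K₂ * C) * (x * g) := by positivity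
    linarith
  simp only [Complex.add_re] at f5
  have := abs_le.mp g1
  have := abs_le.mp g2
  have := abs_le.mp g3
  have := abs_le.mp g4
  linarith

section leviCalculus

variable {n : ℕ} {z : Fin n → ℂ}

lemma dz_congr {f g : (Fin n → ℂ) → ℂ} (h : f =ᶠ[𝓝 z] g) (j : Fin n) : dz j f z = dz j g z := by
  rw [dz, dz, h.fderiv_eq]

lemma dzbar_congr {f g : (Fin n → ℂ) → ℂ} (h : f =ᶠ[𝓝 z] g) (j : Fin n) :
    dzbar j f z = dzbar j g z := by
  rw [dzbar, dzbar, h.fderiv_eq]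

lemma cplx_congr {f g : (Fin n → ℂ) → ℝ} (h : f =ᶠ[𝓝 z] g) : cplx f =ᶠ[𝓝 z] cplx g :=
  h.mono fun w hw => by simp only [cplx, hw]

lemma dirDeriv_congr {f g : (Fin n → ℂ) → ℂ} (h : f =ᶠ[𝓝 z] g) (X : Fin n → ℂ) :
    dirDeriv X f z = dirDeriv X g z :=
  Finset.sum_congr rfl fun j _ => by rw [dz_congr h]

lemma levi_congr {f g : (Fin n → ℂ) → ℝ} (h : f =ᶠ[𝓝 z] g) (X Y : Fin n → ℂ) :
    levi f X Y z = levi g X Y z := by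
  refine Finset.sum_congr rfl fun j _ => Finset.sum_congr rfl fun k _ => ?_
  have : (fun w => dzbar k (cplx f) w) =ᶠ[𝓝 z] fun w => dzbar k (cplx g) w :=
    h.eventuallyEq_nhds.mono fun w hw => dzbar_congr (cplx_congr hw) k
  rw [dz_congr this]

lemma dz_mul {f g : (Fin n → ℂ) → ℂ} (hf : DifferentiableAt ℝ f z) (hg : DifferentiableAt ℝ g z)
    (j : Fin n) : dz j (fun w => f w * g w) z = f z * dz j g z + dz j f z * g z := by
  have h := hf.hasFDerivAt.mul hg.hasFDerivAt
  have h2 : fderiv ℝ (fun w => f w * g w) z = _ := h.fderiv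
  simp only [dz, h2, add_apply, smul_apply, smul_eq_mul]
  ring

lemma dz_add {f g : (Fin n → ℂ) → ℂ} (hf : DifferentiableAt ℝ f z) (hg : DifferentiableAt ℝ g z)
    (j : Fin n) : dz j (fun w => f w + g w) z = dz j f z + dz j g z := by
  have h2 : fderiv ℝ (fun w => f w + g w) z = _ := (hf.hasFDerivAt.add hg.hasFDerivAt).fderiv
  simp only [dz, h2, add_apply]
  ring

lemma dzbar_add {f g : (Fin n → ℂ) → ℂ} (hf : DifferentiableAt ℝ f z)
    (hg : DifferentiableAt ℝ g z) (j : Fin n) :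
    dzbar j (fun w => f w + g w) z = dzbar j f z + dzbar j g z := by
  have h2 : fderiv ℝ (fun w => f w + g w) z = _ := (hf.hasFDerivAt.add hg.hasFDerivAt).fderiv
  simp only [dzbar, h2, add_apply]
  ring

lemma contDiffAt_cplx {f : (Fin n → ℂ) → ℝ} {m : WithTop ℕ∞} (hf : ContDiffAt ℝ m f z) :
    ContDiffAt ℝ m (cplx f) z :=
  Complex.ofRealCLM.contDiff.contDiffAt.comp z hf

lemma fderiv_real_comp {f : (Fin n → ℂ) → ℝ} {φ : ℝ → ℝ} (hf : DifferentiableAt ℝ f z)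
    (hφ : DifferentiableAt ℝ φ (f z)) (v : Fin n → ℂ) :
    fderiv ℝ (cplx fun w => φ (f w)) z v = ((deriv φ (f z) : ℝ) : ℂ) * fderiv ℝ (cplx f) z v := by
  have h : HasFDerivAt (fun w => φ (f w)) (deriv φ (f z) • fderiv ℝ f z) z :=
    hφ.hasDerivAt.comp_hasFDerivAt z hf.hasFDerivAt
  rw [fderiv_cplx h.differentiableAt, h.fderiv, fderiv_cplx hf]
  simp

lemma dz_comp {f : (Fin n → ℂ) → ℝ} {φ : ℝ → ℝ} (hf : DifferentiableAt ℝ f z)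
    (hφ : DifferentiableAt ℝ φ (f z)) (j : Fin n) :
    dz j (cplx fun w => φ (f w)) z = ((deriv φ (f z) : ℝ) : ℂ) * dz j (cplx f) z := by
  simp only [dz, fderiv_real_comp hf hφ]
  ring

lemma dzbar_comp {f : (Fin n → ℂ) → ℝ} {φ : ℝ → ℝ} (hf : DifferentiableAt ℝ f z)
    (hφ : DifferentiableAt ℝ φ (f z)) (j : Fin n) :
    dzbar j (cplx fun w => φ (f w)) z = ((deriv φ (f z) : ℝ) : ℂ) * dzbar j (cplx f) z := by
  simp only [dzbar, fderiv_real_comp hf hφ]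
  ring

lemma dirDeriv_comp {f : (Fin n → ℂ) → ℝ} {φ : ℝ → ℝ} (hf : DifferentiableAt ℝ f z)
    (hφ : DifferentiableAt ℝ φ (f z)) (X : Fin n → ℂ) :
    dirDeriv X (cplx fun w => φ (f w)) z = ((deriv φ (f z) : ℝ) : ℂ) * dirDeriv X (cplx f) z := by
  simp only [dirDeriv, dz_comp hf hφ, Finset.mul_sum]
  exact Finset.sum_congr rfl fun j _ => by ring

lemma differentiableAt_dzbar {f : (Fin n → ℂ) → ℝ} (hf : ContDiffAt ℝ 2 f z) (k : Fin n) :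
    DifferentiableAt ℝ (fun w => dzbar k (cplx f) w) z := by
  have h : DifferentiableAt ℝ (fderiv ℝ (cplx f)) z :=
    ((contDiffAt_cplx hf).fderiv_right (m := 1) (by norm_num)).differentiableAt (by norm_num)
  simp only [dzbar]
  exact (((h.clm_apply (differentiableAt_const _)).add
    ((h.clm_apply (differentiableAt_const _)).const_mul _)).mul_const _)

lemma levi_comp {f : (Fin n → ℂ) → ℝ} {φ : ℝ → ℝ} (hf : ContDiffAt ℝ 2 f z)
    (hφ : ContDiffAt ℝ 2 φ (f z)) (X : Fin n → ℂ) :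
    (levi (fun w => φ (f w)) X X z).re = deriv φ (f z) * (levi f X X z).re +
      deriv (deriv φ) (f z) * ‖dirDeriv X (cplx f) z‖ ^ 2 := by
  have hfe : ∀ᶠ w in 𝓝 z, DifferentiableAt ℝ f w := by
    filter_upwards [hf.eventually (by simp)] with w hw using hw.differentiableAt (by norm_num)
  have hφe : ∀ᶠ t in 𝓝 (f z), DifferentiableAt ℝ φ t := by
    filter_upwards [hφ.eventually (by simp)] with w hw using hw.differentiableAt (by norm_num)
  have hd : DifferentiableAt ℝ (deriv φ) (f z) := by
    have h := (hφ.fderiv_right (m := 1) (by norm_num)).differentiableAt (by norm_num)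
    exact h.clm_apply (differentiableAt_const 1)
  have hfz := hfe.self_of_nhds
  have key : ∀ j k, dz j (fun w => dzbar k (cplx fun w => φ (f w)) w) z =
      ((deriv φ (f z) : ℝ) : ℂ) * dz j (fun w => dzbar k (cplx f) w) z +
      ((deriv (deriv φ) (f z) : ℝ) : ℂ) * dz j (cplx f) z * (starRingEnd ℂ) (dz k (cplx f) z) := by
    intro j k
    have e : (fun w => dzbar k (cplx fun w => φ (f w)) w) =ᶠ[𝓝 z]
        fun w => cplx (fun w => deriv φ (f w)) w * dzbar k (cplx f) w := by
      filter_upwards [hfe, hf.continuousAt.eventually hφe] with w h1 h2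
      exact dzbar_comp h1 h2 k
    have hdc : DifferentiableAt ℝ (cplx fun w => deriv φ (f w)) z :=
      Complex.ofRealCLM.differentiableAt.comp z (hd.comp z hfz)
    rw [dz_congr e, dz_mul hdc (differentiableAt_dzbar hf k), dz_comp hfz hd, dzbar_cplx hfz]
    rfl
  have : levi (fun w => φ (f w)) X X z = ((deriv φ (f z) : ℝ) : ℂ) * levi f X X z +
      ((deriv (deriv φ) (f z) : ℝ) : ℂ) *
        (dirDeriv X (cplx f) z * (starRingEnd ℂ) (dirDeriv X (cplx f) z)) := by
    simp only [levi, key, dirDeriv, map_sum, map_mul, Finset.sum_mul_sum]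
    simp only [Finset.mul_sum]
    rw [← Finset.sum_add_distrib]
    refine Finset.sum_congr rfl fun j _ => ?_
    rw [← Finset.sum_add_distrib]
    exact Finset.sum_congr rfl fun k _ => by ring
  rw [this, Complex.mul_conj, Complex.normSq_eq_norm_sq, Complex.add_re, Complex.re_ofReal_mul,
    ← Complex.ofReal_mul, Complex.ofReal_re]

lemma levi_add {f g : (Fin n → ℂ) → ℝ} (hf : ContDiffAt ℝ 2 f z) (hg : ContDiffAt ℝ 2 g z)
    (X Y : Fin n → ℂ) :
    levi (fun w => f w + g w) X Y z = levi f X Y z + levi g X Y z := by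
  have hfe : ∀ᶠ w in 𝓝 z, DifferentiableAt ℝ (cplx f) w := by
    filter_upwards [(contDiffAt_cplx hf).eventually (by simp)] with w hw
      using hw.differentiableAt (by norm_num)
  have hge : ∀ᶠ w in 𝓝 z, DifferentiableAt ℝ (cplx g) w := by
    filter_upwards [(contDiffAt_cplx hg).eventually (by simp)] with w hw
      using hw.differentiableAt (by norm_num)
  have key : ∀ j k, dz j (fun w => dzbar k (cplx fun w => f w + g w) w) z =
      dz j (fun w => dzbar k (cplx f) w) z + dz j (fun w => dzbar k (cplx g) w) z := by
    intro j k
    have e : (fun w => dzbar k (cplx fun w => f w + g w) w) =ᶠ[𝓝 z]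
        fun w => dzbar k (cplx f) w + dzbar k (cplx g) w := by
      filter_upwards [hfe, hge] with w h1 h2
      rw [← dzbar_add h1 h2]
      congr 1
      ext w; simp [cplx]
    rw [dz_congr e, dz_add (differentiableAt_dzbar hf k) (differentiableAt_dzbar hg k)]
  simp only [levi, key, add_mul, Finset.sum_add_distrib]

lemma dirDeriv_cplx_add {f g : (Fin n → ℂ) → ℝ} (hf : DifferentiableAt ℝ f z)
    (hg : DifferentiableAt ℝ g z) (X : Fin n → ℂ) :
    dirDeriv X (cplx fun w => f w + g w) z = dirDeriv X (cplx f) z + dirDeriv X (cplx g) z := by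
  have hf' : DifferentiableAt ℝ (cplx f) z := Complex.ofRealCLM.differentiableAt.comp z hf
  have hg' : DifferentiableAt ℝ (cplx g) z := Complex.ofRealCLM.differentiableAt.comp z hg
  have e : (cplx fun w => f w + g w) = fun w => cplx f w + cplx g w := by
    ext w; simp [cplx]
  simp only [dirDeriv, e, dz_add hf' hg', mul_add, Finset.sum_add_distrib]

lemma levi_const_mul {f : (Fin n → ℂ) → ℝ} (hf : ContDiffAt ℝ 2 f z) (c : ℝ) (X : Fin n → ℂ) :
    (levi (fun w => c * f w) X X z).re = c * (levi f X X z).re := by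
  have h := levi_comp (φ := fun t => c * t) hf (by fun_prop) X
  have h1 : deriv (fun t : ℝ => c * t) = fun _ => c := by
    ext t; simp
  simpa [h1] using h

lemma dirDeriv_const_mul {f : (Fin n → ℂ) → ℝ} (hf : DifferentiableAt ℝ f z) (c : ℝ)
    (X : Fin n → ℂ) :
    dirDeriv X (cplx fun w => c * f w) z = c * dirDeriv X (cplx f) z := by
  have h := dirDeriv_comp (φ := fun t => c * t) hf (by fun_prop) X
  have h1 : deriv (fun t : ℝ => c * t) = fun _ => c := by
    ext t; simp
  simpa [h1] using h

/-- The Levi form of `r ^ η * v ^ (-σ)`, normalised by the function itself. -/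
lemma levi_rpow_mul_rpow {r v : (Fin n → ℂ) → ℝ} (hr : ContDiffAt ℝ 2 r z)
    (hv : ContDiffAt ℝ 2 v z) (hr0 : 0 < r z) (hv0 : 0 < v z) (η σ : ℝ) (X : Fin n → ℂ) :
    (levi (fun w => Real.exp (η * Real.log (r w) + (-σ) * Real.log (v w))) X X z).re =
      Real.exp (η * Real.log (r z) + (-σ) * Real.log (v z)) *
      (η * ((levi r X X z).re / r z - ‖dirDeriv X (cplx r) z / r z‖ ^ 2)
        - σ * ((levi v X X z).re / v z - ‖dirDeriv X (cplx v) z / v z‖ ^ 2)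
        + ‖η * (dirDeriv X (cplx r) z / r z) - σ * (dirDeriv X (cplx v) z / v z)‖ ^ 2) := by
  have hlog : ∀ {f : (Fin n → ℂ) → ℝ}, ContDiffAt ℝ 2 f z → 0 < f z →
      ContDiffAt ℝ 2 (fun w => Real.log (f w)) z ∧
      (levi (fun w => Real.log (f w)) X X z).re =
        (levi f X X z).re / f z - ‖dirDeriv X (cplx f) z / f z‖ ^ 2 ∧
      dirDeriv X (cplx fun w => Real.log (f w)) z = dirDeriv X (cplx f) z / f z := by
    intro f hf hf0
    have hl : ContDiffAt ℝ 2 Real.log (f z) := Real.contDiffAt_log.mpr hf0.ne'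
    refine ⟨hl.comp z hf, ?_, ?_⟩
    · rw [levi_comp hf hl, Real.deriv_log', norm_div, Complex.norm_real, Real.norm_eq_abs,
        abs_of_pos hf0, deriv_inv]
      field_simp
      ring
    · rw [dirDeriv_comp (hf.differentiableAt (by norm_num)) (hl.differentiableAt (by norm_num)),
        Real.deriv_log]
      push_cast
      ring
  obtain ⟨r1, r2, r3⟩ := hlog hr hr0
  obtain ⟨v1, v2, v3⟩ := hlog hv hv0
  have r1' : ContDiffAt ℝ 2 (fun w => η * Real.log (r w)) z := contDiffAt_const.mul r1
  have v1' : ContDiffAt ℝ 2 (fun w => (-σ) * Real.log (v w)) z := contDiffAt_const.mul v1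
  rw [levi_comp (φ := Real.exp) (r1'.add v1') Real.contDiff_exp.contDiffAt, Real.deriv_exp,
    Real.deriv_exp, levi_add r1' v1', dirDeriv_cplx_add (r1'.differentiableAt (by norm_num))
      (v1'.differentiableAt (by norm_num)), Complex.add_re, levi_const_mul r1, levi_const_mul v1,
    dirDeriv_const_mul (r1.differentiableAt (by norm_num)),
    dirDeriv_const_mul (v1.differentiableAt (by norm_num)), r2, v2, r3, v3]
  push_cast
  rw [neg_mul (σ : ℂ), ← sub_eq_add_neg]
  ring

lemma levi_sq {f : (Fin n → ℂ) → ℝ} (hf : ContDiffAt ℝ 2 f z) (h0 : f z = 0) (X : Fin n → ℂ) :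
    (levi (fun w => f w ^ 2) X X z).re = 2 * ‖dirDeriv X (cplx f) z‖ ^ 2 := by
  have h1 : deriv (fun t : ℝ => t ^ 2) = fun t => 2 * t := by
    ext t; simp
  rw [levi_comp (φ := fun t => t ^ 2) hf (by fun_prop), h1, h0]
  simp

end leviCalculus

section positiveFunctionals

variable {N : Type*} [TopologicalSpace N] [CompactSpace N]

/-- The closed support of a positive linear functional on continuous functions. -/
def posSupport (Λ : C(N, ℝ) →ₗ[ℝ] ℝ) : Set N :=
  {x | ∀ g : C(N, ℝ), (∀ y, 0 ≤ g y) → 0 < g x → 0 < Λ g}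

lemma isClosed_posSupport (Λ : C(N, ℝ) →ₗ[ℝ] ℝ) : IsClosed (posSupport Λ) := by
  rw [← isOpen_compl_iff, isOpen_iff_mem_nhds]
  intro x hx
  simp only [posSupport, Set.mem_compl_iff, Set.mem_ofPred_eq, not_forall] at hx
  obtain ⟨g, hg, hgx, hΛ⟩ := hx
  filter_upwards [g.continuous.continuousAt.eventually (lt_mem_nhds hgx)] with y hy hc
  exact hΛ (hc g hg hy)

lemma map_eq_zero_of_eqOn_posSupport {Λ : C(N, ℝ) →ₗ[ℝ] ℝ}
    (hΛ : ∀ g : C(N, ℝ), (∀ x, 0 ≤ g x) → 0 ≤ Λ g) {g : C(N, ℝ)}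
    (hg : ∀ x ∈ posSupport Λ, g x = 0) : Λ g = 0 := by
  have h1 : 0 ≤ Λ 1 := hΛ 1 fun x => by simp
  have key : ∀ ε > 0, |Λ g| ≤ ε * Λ 1 := by
    intro ε hε
    have hcpt : IsCompact {x | ε ≤ |g x|} :=
      (isClosed_le continuous_const g.continuous.abs).isCompact
    obtain ⟨h, hh0, hhΛ, hhpos⟩ : ∃ h : C(N, ℝ), (∀ x, 0 ≤ h x) ∧ Λ h = 0 ∧
        ∀ x ∈ {x | ε ≤ |g x|}, |g x| ≤ h x := by
      refine hcpt.induction_on (p := fun s => ∃ h : C(N, ℝ), (∀ x, 0 ≤ h x) ∧ Λ h = 0 ∧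
        ∀ x ∈ s, |g x| ≤ h x) ⟨0, by simp, by simp, by simp⟩ ?_ ?_ ?_
      · rintro s t hst ⟨h, a, b, c⟩
        exact ⟨h, a, b, fun x hx => c x (hst hx)⟩
      · rintro s t ⟨h, a, b, c⟩ ⟨h', a', b', c'⟩
        refine ⟨h + h', fun x => add_nonneg (a x) (a' x), by rw [map_add, b, b', add_zero], ?_⟩
        rintro x (hx | hx)
        · exact (c x hx).trans (le_add_of_nonneg_right (a' x))
        · exact (c' x hx).trans (le_add_of_nonneg_left (a x))
      · intro x hx
        have hxs : x ∉ posSupport Λ := fun hc => by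
          have := hg x hc
          simp only [Set.mem_ofPred_eq, this, abs_zero] at hx
          linarith
        simp only [posSupport, Set.mem_ofPred_eq, not_forall] at hxs
        obtain ⟨h, hh, hhx, hhΛ⟩ := hxs
        set c := (|g x| + 1) / h x with hc
        have hc0 : 0 ≤ c := by positivity
        have hcont : Continuous fun y => c * h y - |g y| := by fun_prop
        have hlt : (0 : ℝ) < c * h x - |g x| := by
          rw [hc, div_mul_cancel₀ _ hhx.ne']; linarith
        refine ⟨_, mem_nhdsWithin_of_mem_nhds
          (hcont.continuousAt.eventually (lt_mem_nhds hlt)), c • h,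
          fun y => mul_nonneg hc0 (hh y), ?_, ?_⟩
        · rw [map_smul, le_antisymm (not_lt.mp hhΛ) (hΛ h hh), smul_zero]
        · intro y hy
          have : 0 < c * h y - |g y| := hy
          change |g y| ≤ c * h y
          linarith
    have hle : ∀ x, |g x| ≤ ε + h x := by
      intro x
      rcases le_total ε |g x| with hx | hx
      · exact (hhpos x hx).trans (by linarith)
      · linarith [hh0 x]
    have e1 := hΛ (ε • 1 + h - g) fun x => by
      have := (abs_le.mp (hle x)).2
      simp; linarith
    have e2 := hΛ (ε • 1 + h + g) fun x => by
      have := (abs_le.mp (hle x)).1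
      simp; linarith
    simp only [map_add, map_sub, map_smul, hhΛ, smul_eq_mul] at e1 e2
    exact abs_le.mpr ⟨by linarith, by linarith⟩
  by_contra hne
  have hpos : 0 < |Λ g| := abs_pos.mpr hne
  have := key (|Λ g| / (2 * (Λ 1 + 1))) (by positivity)
  have h2 : |Λ g| / (2 * (Λ 1 + 1)) * Λ 1 < |Λ g| := by
    rw [div_mul_eq_mul_div, div_lt_iff₀ (by positivity)]
    nlinarith
  linarith

end positiveFunctionals

/-- A linear subspace of `C(N) × C(G)` without strictly positive pairs is annihilated by a nonzero
pair of positive functionals. -/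
lemma exists_positive_annihilator {N G : Type*} [TopologicalSpace N] [CompactSpace N]
    [TopologicalSpace G] [CompactSpace G] (S : Submodule ℝ (C(N, ℝ) × C(G, ℝ)))
    (hS : ∀ w ∈ S, ¬ ((∀ x, 0 < w.1 x) ∧ ∀ y, 0 < w.2 y)) :
    ∃ (Λ₁ : C(N, ℝ) →ₗ[ℝ] ℝ) (Λ₂ : C(G, ℝ) →ₗ[ℝ] ℝ),
      (∀ g : C(N, ℝ), (∀ x, 0 ≤ g x) → 0 ≤ Λ₁ g) ∧ (∀ g : C(G, ℝ), (∀ x, 0 ≤ g x) → 0 ≤ Λ₂ g) ∧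
      0 < Λ₁ 1 + Λ₂ 1 ∧ ∀ w ∈ S, Λ₁ w.1 + Λ₂ w.2 = 0 := by
  set P : Set (C(N, ℝ) × C(G, ℝ)) := {w | (∀ x, 0 < w.1 x) ∧ ∀ y, 0 < w.2 y} with hP
  have hPo : IsOpen P := by
    have h1 : IsOpen {f : C(N, ℝ) | Set.MapsTo f Set.univ (Set.Ioi 0)} :=
      ContinuousMap.isOpen_setOfPred_mapsTo isCompact_univ isOpen_Ioi
    have h2 : IsOpen {f : C(G, ℝ) | Set.MapsTo f Set.univ (Set.Ioi 0)} :=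
      ContinuousMap.isOpen_setOfPred_mapsTo isCompact_univ isOpen_Ioi
    have : P = Prod.fst ⁻¹' {f : C(N, ℝ) | Set.MapsTo f Set.univ (Set.Ioi 0)} ∩
        Prod.snd ⁻¹' {f : C(G, ℝ) | Set.MapsTo f Set.univ (Set.Ioi 0)} := by
      ext w
      simp [hP, Set.MapsTo]
    rw [this]
    exact (h1.preimage continuous_fst).inter (h2.preimage continuous_snd)
  have hPc : Convex ℝ P := by
    intro w hw w' hw' a b ha hb hab
    have aux : ∀ s t : ℝ, 0 < s → 0 < t → 0 < a * s + b * t := by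
      intro s t hs ht
      rcases ha.eq_or_lt with rfl | ha'
      · have : b = 1 := by linarith
        simpa [this] using ht
      · have := mul_pos ha' hs
        have := mul_nonneg hb ht.le
        linarith
    exact ⟨fun x => aux _ _ (hw.1 x) (hw'.1 x), fun x => aux _ _ (hw.2 x) (hw'.2 x)⟩
  have hd : Disjoint P (S : Set (C(N, ℝ) × C(G, ℝ))) :=
    Set.disjoint_left.mpr fun w hw hwS => hS w hwS hw
  obtain ⟨f, u, hfu, hub⟩ := geometric_hahn_banach_open hPc hPo S.convex hd
  have hu : u ≤ 0 := by simpa using hub 0 S.zero_mem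
  have hfS : ∀ w ∈ S, f w = 0 := by
    intro w hw
    by_contra hne
    have := hub (((u - 1) / f w) • w) (S.smul_mem _ hw)
    rw [map_smul, smul_eq_mul, div_mul_cancel₀ _ hne] at this
    linarith
  have hneg : ∀ w ∈ P, f w < 0 := fun w hw => (hfu w hw).trans_le hu
  have h11 : f (1, 1) < 0 := hneg _ ⟨fun _ => by simp, fun _ => by simp⟩
  have hcl : ∀ w : C(N, ℝ) × C(G, ℝ), (∀ x, 0 ≤ w.1 x) → (∀ y, 0 ≤ w.2 y) → f w ≤ 0 := by
    intro w h1 h2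
    by_contra! hc
    have := hneg (w + (f w / (-f (1, 1))) • (1, 1)) ⟨fun x => ?_, fun x => ?_⟩
    · rw [map_add, map_smul, smul_eq_mul] at this
      have e : f w / (-f (1, 1)) * f (1, 1) = - f w := by
        have := h11.ne
        field_simp
      linarith
    · have : 0 < f w / (-f (1, 1)) := div_pos hc (by linarith)
      have := h1 x
      simp; linarith
    · have : 0 < f w / (-f (1, 1)) := div_pos hc (by linarith)
      have := h2 x
      simp; linarith
  refine ⟨-(f.toLinearMap ∘ₗ LinearMap.inl ℝ _ _), -(f.toLinearMap ∘ₗ LinearMap.inr ℝ _ _),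
    fun g hg => ?_, fun g hg => ?_, ?_, fun w hw => ?_⟩
  · have := hcl (g, 0) hg (by simp)
    simpa using this
  · have := hcl (0, g) (by simp) hg
    simpa using this
  · have e : f (1, 1) = f (1, 0) + f (0, 1) := by rw [← map_add]; simp
    simp only [LinearMap.neg_apply, LinearMap.comp_apply, LinearMap.inl_apply,
      LinearMap.inr_apply, ContinuousLinearMap.coe_coe]
    linarith
  · have e : f w = f (w.1, 0) + f (0, w.2) := by rw [← map_add]; simp
    have := hfS w hw
    simp only [LinearMap.neg_apply, LinearMap.comp_apply, LinearMap.inl_apply,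
      LinearMap.inr_apply, ContinuousLinearMap.coe_coe]
    linarith

section weights

variable {n : ℕ}

open smoothAlg WirtingerSystem in
lemma continuous_levi {v : (Fin n → ℂ) → ℝ} (hv : ContDiff ℝ (⊤ : ℕ∞) v) :
    Continuous fun w : (Fin n → ℂ) × (Fin n → ℂ) => (levi v w.2 w.2 w.1).re := by
  simp only [levi_eq v hv]
  refine Complex.continuous_re.comp (continuous_finsetSum _ fun j _ =>
    continuous_finsetSum _ fun k _ => ?_)
  have h := (smoothAlg.contDiff ((wirt n).D j ((wirt n).Db k (ofReal v hv)))).continuous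
  exact ((h.comp continuous_fst).mul ((continuous_apply j).comp continuous_snd)).mul
    (Complex.continuous_conj.comp ((continuous_apply k).comp continuous_snd))

open smoothAlg WirtingerSystem in
lemma continuous_dirDeriv {v : (Fin n → ℂ) → ℝ} (hv : ContDiff ℝ (⊤ : ℕ∞) v) :
    Continuous fun w : (Fin n → ℂ) × (Fin n → ℂ) => dirDeriv w.2 (cplx v) w.1 := by
  refine continuous_finsetSum _ fun j _ => ?_
  have h := (smoothAlg.contDiff ((wirt n).D j (ofReal v hv))).continuous
  have h2 : ((wirt n).D j (ofReal v hv) : (Fin n → ℂ) → ℂ) = fun z => dz j (cplx v) z :=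
    funext fun z => D_apply j _ z
  rw [h2] at h
  exact ((continuous_apply j).comp continuous_snd).mul (h.comp continuous_fst)

/-- A smooth cutoff, `0` near one closed set and `1` near a disjoint one. -/
lemma exists_cutoff {s t : Set (Fin n → ℂ)} (hs : IsClosed s) (ht : IsClosed t)
    (hd : Disjoint s t) : ∃ χ : (Fin n → ℂ) → ℝ, ContDiff ℝ (⊤ : ℕ∞) χ ∧
      (∀ x ∈ s, ∀ᶠ z in 𝓝 x, χ z = 0) ∧ (∀ x ∈ t, ∀ᶠ z in 𝓝 x, χ z = 1) ∧
      ∀ z, χ z ∈ Set.Icc (0 : ℝ) 1 := by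
  obtain ⟨f, h0, h1, h2⟩ := exists_contMDiffMap_zero_one_nhds_of_isClosed
    (n := (⊤ : ℕ∞)) (modelWithCornersSelf ℝ (Fin n → ℂ)) hs ht hd
  refine ⟨f, contMDiff_iff_contDiff.mp f.contMDiff, fun x hx => ?_, fun x hx => ?_, h2⟩
  · exact (Filter.eventually_of_mem h0 fun _ h => h).filter_mono (nhds_le_nhdsSet hx)
  · exact (Filter.eventually_of_mem h1 fun _ h => h).filter_mono (nhds_le_nhdsSet hx)

/-- Unit null directions of the Levi form over `G`. -/
def nullDirs (G : Set (Fin n → ℂ)) (r : (Fin n → ℂ) → ℝ) : Set ((Fin n → ℂ) × (Fin n → ℂ)) :=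
  {w | w.1 ∈ G ∧ ‖w.2‖ = 1 ∧ dirDeriv w.2 (cplx r) w.1 = 0 ∧ (levi r w.2 w.2 w.1).re = 0}

lemma isCompact_nullDirs {G : Set (Fin n → ℂ)} (hG : IsCompact G) {r : (Fin n → ℂ) → ℝ}
    (hr : ContDiff ℝ (⊤ : ℕ∞) r) : IsCompact (nullDirs G r) := by
  have h : nullDirs G r = (G ×ˢ Metric.sphere (0 : Fin n → ℂ) 1) ∩
      ({w | dirDeriv w.2 (cplx r) w.1 = 0} ∩ {w | (levi r w.2 w.2 w.1).re = 0}) := by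
    ext w
    simp [nullDirs, and_assoc]
  rw [h]
  exact (hG.prod (isCompact_sphere _ _)).inter_right
    ((isClosed_eq (continuous_dirDeriv hr) continuous_const).inter
      (isClosed_eq (continuous_levi hr) continuous_const))

lemma levi_const (c : ℝ) (X z : Fin n → ℂ) : levi (fun _ => c) X X z = 0 := by
  have h : ∀ k w, dzbar k (cplx fun _ : Fin n → ℂ => c) w = 0 := by
    intro k w
    have : (cplx fun _ : Fin n → ℂ => c) = fun _ => (c : ℂ) := rfl
    simp [dzbar, this]
  simp only [levi, h]
  simp [dz]

variable (G : Set (Fin n → ℂ)) (N : Set ((Fin n → ℂ) × (Fin n → ℂ))) (K : ℝ)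

/-- The pair `(-L_v - K v, v)` of continuous functions attached to a smooth weight. -/
def weightPair {v : (Fin n → ℂ) → ℝ} (hv : ContDiff ℝ (⊤ : ℕ∞) v) : C(N, ℝ) × C(G, ℝ) :=
  (⟨fun w => -(levi v w.1.2 w.1.2 w.1.1).re - K * v w.1.1,
    (((continuous_levi hv).comp continuous_subtype_val).neg).sub
      (continuous_const.mul (hv.continuous.comp (continuous_fst.comp continuous_subtype_val)))⟩,
   ⟨fun p => v p.1, hv.continuous.comp continuous_subtype_val⟩)

/-- The space of all pairs `(-L_v - K v, v)`. -/
def weightSpace : Submodule ℝ (C(N, ℝ) × C(G, ℝ)) where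
  carrier := {w | ∃ v, ∃ hv : ContDiff ℝ (⊤ : ℕ∞) v, w = weightPair G N K hv}
  zero_mem' := ⟨fun _ => 0, contDiff_const, by
    ext x
    · change (0 : ℝ) = -(levi (fun _ => 0) x.1.2 x.1.2 x.1.1).re - K * 0
      rw [levi_const]; simp
    · rfl⟩
  add_mem' := by
    rintro _ _ ⟨v, hv, rfl⟩ ⟨w, hw, rfl⟩
    refine ⟨fun z => v z + w z, hv.add hw, ?_⟩
    ext x
    · change -(levi v x.1.2 x.1.2 x.1.1).re - K * v x.1.1 +
        (-(levi w x.1.2 x.1.2 x.1.1).re - K * w x.1.1) =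
        -(levi (fun z => v z + w z) x.1.2 x.1.2 x.1.1).re - K * (v x.1.1 + w x.1.1)
      rw [levi_add (hv.of_le (WithTop.coe_le_coe.mpr le_top)).contDiffAt
        (hw.of_le (WithTop.coe_le_coe.mpr le_top)).contDiffAt, Complex.add_re]
      ring
    · rfl
  smul_mem' := by
    rintro c _ ⟨v, hv, rfl⟩
    refine ⟨fun z => c * v z, contDiff_const.mul hv, ?_⟩
    ext x
    · change c * (-(levi v x.1.2 x.1.2 x.1.1).re - K * v x.1.1) =
        -(levi (fun z => c * v z) x.1.2 x.1.2 x.1.1).re - K * (c * v x.1.1)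
      rw [levi_const_mul (hv.of_le (WithTop.coe_le_coe.mpr le_top)).contDiffAt]
      ring
    · rfl

end weights

theorem exists_weight {n : ℕ} {G : Set (Fin n → ℂ)} (hG : IsCompact G) {r : (Fin n → ℂ) → ℝ}
    (hr : ContDiff ℝ (⊤ : ℕ∞) r) (h0 : ∀ q ∈ G, r q = 0) (hgrad : ∀ q ∈ G, fderiv ℝ r q ≠ 0)
    (hL : ∀ q ∈ G, LeviLowerBound r q) (hpc : ∀ q ∈ G, LeviPseudoconvexAt r q)
    (hft : ∀ p ∈ G, ∃ ρ, ρ =ᶠ[𝓝 p] r ∧ FiniteTypePt ρ p) (K : ℝ) :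
    ∃ v, ContDiff ℝ (⊤ : ℕ∞) v ∧ (∀ p ∈ G, 0 < v p) ∧
      ∀ w ∈ nullDirs G r, (levi v w.2 w.2 w.1).re + K * v w.1 < 0 := by
  set N := nullDirs G r with hN
  by_contra! hcon
  have : CompactSpace N := isCompact_iff_compactSpace.mp (isCompact_nullDirs hG hr)
  have : CompactSpace G := isCompact_iff_compactSpace.mp hG
  obtain ⟨Λ₁, Λ₂, hΛ₁, hΛ₂, hpos, hann⟩ := exists_positive_annihilator (weightSpace G N K) (by
    rintro _ ⟨v, hv, rfl⟩ ⟨h1, h2⟩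
    obtain ⟨w, hw, hle⟩ := hcon v hv fun p hp => h2 ⟨p, hp⟩
    have h3 : 0 < -(levi v w.2 w.2 w.1).re - K * v w.1 := h1 ⟨w, hw⟩
    linarith)
  have hann' : ∀ {v} (hv : ContDiff ℝ (⊤ : ℕ∞) v),
      Λ₁ (weightPair G N K hv).1 + Λ₂ (weightPair G N K hv).2 = 0 :=
    fun hv => hann _ ⟨_, hv, rfl⟩
  set T : Set (Fin n → ℂ) := (fun w : N => w.1.1) '' posSupport Λ₁ with hT
  have hTc : IsCompact T :=
    (isClosed_posSupport Λ₁).isCompact.image (continuous_fst.comp continuous_subtype_val)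
  have hTG : T ⊆ G := by
    rintro _ ⟨w, -, rfl⟩
    exact w.2.1
  have hzero : ∀ {v} (hv : ContDiff ℝ (⊤ : ℕ∞) v), (∀ q ∈ T, ∀ᶠ z in 𝓝 q, v z = 0) →
      Λ₂ (weightPair G N K hv).2 = 0 := by
    intro v hv hvT
    have h1 : Λ₁ (weightPair G N K hv).1 = 0 := by
      refine map_eq_zero_of_eqOn_posSupport hΛ₁ fun w hw => ?_
      have hq := hvT w.1.1 ⟨w, hw, rfl⟩
      have h2 : levi v w.1.2 w.1.2 w.1.1 = 0 := by
        rw [levi_congr (g := fun _ => 0) hq, levi_const]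
      change -(levi v w.1.2 w.1.2 w.1.1).re - K * v w.1.1 = 0
      rw [h2, hq.self_of_nhds]; simp
    have := hann' hv
    linarith
  have hzero' : ∀ {v} (hv : ContDiff ℝ (⊤ : ℕ∞) v), (∀ z, 0 ≤ v z) → (∀ q ∈ T, v q = 0) →
      Λ₂ (weightPair G N K hv).2 ≤ 0 := by
    intro v hv hv0 hvT
    have h1 : 0 ≤ Λ₂ 1 := hΛ₂ 1 fun _ => by simp
    refine le_of_forall_pos_le_add fun δ hδ => ?_
    set ε := δ / (Λ₂ 1 + 1) with hε
    have hε0 : 0 < ε := by positivity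
    have hdis : Disjoint T {z | ε ≤ v z} := Set.disjoint_left.mpr fun q hq hc => by
      have : ε ≤ v q := hc
      rw [hvT q hq] at this
      linarith
    obtain ⟨χ, hχ, hχ0, hχ1, hχb⟩ := exists_cutoff hTc.isClosed
      (isClosed_le continuous_const hv.continuous) hdis
    obtain ⟨M, hM⟩ : ∃ M, ∀ p ∈ G, v p ≤ M := by
      obtain ⟨M, hM⟩ := hG.bddAbove_image hv.continuous.continuousOn
      exact ⟨M, fun p hp => hM ⟨p, hp, rfl⟩⟩
    have h2 := hΛ₂ (ε • 1 + (|M|) • (weightPair G N K hχ).2 - (weightPair G N K hv).2) fun p => by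
      change 0 ≤ ε * 1 + |M| * χ p.1 - v p.1
      rcases le_total ε (v p.1) with h | h
      · rw [(hχ1 p.1 h).self_of_nhds]
        have := hM p.1 p.2
        have := le_abs_self M
        linarith
      · have := mul_nonneg (abs_nonneg M) (hχb p.1).1
        linarith
    rw [map_sub, map_add, map_smul, map_smul, hzero hχ hχ0, smul_zero, smul_eq_mul] at h2
    have h3 : ε * Λ₂ 1 ≤ δ := by
      rw [hε, div_mul_eq_mul_div, div_le_iff₀ (by positivity)]
      nlinarith
    linarith
  have hTne : T.Nonempty := by
    rw [hT, Set.image_nonempty]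
    by_contra hne
    rw [Set.not_nonempty_iff_eq_empty] at hne
    have hall : ∀ g, Λ₁ g = 0 := fun g => map_eq_zero_of_eqOn_posSupport hΛ₁ (by simp [hne])
    have h1 := hann' (v := fun _ => 1) contDiff_const
    have h2 : (weightPair G N K (v := fun _ => 1) contDiff_const).2 = 1 := rfl
    rw [h2, hall] at h1
    rw [hall] at hpos
    linarith
  obtain ⟨p, hpT, hp⟩ := smoothAlg.exists_not_finiteTypePt r hr T hTne (fun q hq => h0 q (hTG hq))
    (fun q hq => exists_dz_ne_zero (hr.differentiable (by simp) q) (hgrad q (hTG hq)))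
    (fun q hq => hL q (hTG hq)) (fun q hq => hpc q (hTG hq)) (by
      rintro _ ⟨w, hw, rfl⟩
      refine ⟨w.1.2, fun h => ?_, w.2.2.2.2, fun f hf hfT => ?_⟩
      · have := w.2.2.1
        rw [h, norm_zero] at this
        exact zero_ne_one this
      obtain ⟨ε, hε, hball⟩ := Metric.eventually_nhds_iff_ball.mp hfT
      obtain ⟨χ, hχ, hχ0, hχ1, -⟩ := exists_cutoff (s := (Metric.ball w.1.1 ε)ᶜ) (t := {w.1.1})
        Metric.isOpen_ball.isClosed_compl isClosed_singleton
        (Set.disjoint_singleton_right.mpr fun h => h (Metric.mem_ball_self hε))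
      set g : (Fin n → ℂ) → ℝ := fun z => χ z * f z with hg
      have hgs : ContDiff ℝ (⊤ : ℕ∞) g := hχ.mul hf
      have hgT : ∀ q ∈ T, g q = 0 := by
        intro q hq
        by_cases h : q ∈ Metric.ball w.1.1 ε
        · simp [hg, hball q h hq]
        · simp [hg, (hχ0 q h).self_of_nhds]
      have hgf : g =ᶠ[𝓝 w.1.1] f := by
        filter_upwards [hχ1 w.1.1 rfl] with z hz
        simp [hg, hz]
      rw [← dirDeriv_congr (cplx_congr hgf)]
      have hg2 : ContDiff ℝ (⊤ : ℕ∞) fun z => g z ^ 2 := hgs.pow 2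
      have e2 := hzero' hg2 (fun z => sq_nonneg _) fun q hq => by rw [hgT q hq]; simp
      have e1 := hann' hg2
      set D : C(N, ℝ) := ⟨fun x => 2 * ‖dirDeriv x.1.2 (cplx g) x.1.1‖ ^ 2,
        continuous_const.mul (((continuous_dirDeriv hgs).comp continuous_subtype_val).norm.pow 2)⟩
        with hD
      have e3 : Λ₁ ((weightPair G N K hg2).1 + D) = 0 := by
        refine map_eq_zero_of_eqOn_posSupport hΛ₁ fun x hx => ?_
        have hx0 := hgT x.1.1 ⟨x, hx, rfl⟩
        change -(levi (fun z => g z ^ 2) x.1.2 x.1.2 x.1.1).re - K * g x.1.1 ^ 2 +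
          2 * ‖dirDeriv x.1.2 (cplx g) x.1.1‖ ^ 2 = 0
        rw [levi_sq (hgs.of_le (WithTop.coe_le_coe.mpr le_top)).contDiffAt hx0, hx0]
        ring
      rw [map_add] at e3
      by_contra hne
      have hDw : 0 < D w := by
        change 0 < 2 * ‖dirDeriv w.1.2 (cplx g) w.1.1‖ ^ 2
        have := norm_pos_iff.mpr hne
        positivity
      have := hw D (fun x => by
        change 0 ≤ 2 * ‖dirDeriv x.1.2 (cplx g) x.1.1‖ ^ 2
        positivity) hDw
      linarith)
  obtain ⟨ρ, hρ, hρf⟩ := hft p (hTG hpT)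
  exact hp ρ hρ hρf

lemma levi_bracket_lower_bound {η σ A B : ℝ} (hη : 1 < η) (hσ : σ = (η - 1) / (2 * η)) (a b : ℂ) :
    η * A + η * (η - 1) / 2 * ‖a‖ ^ 2 - σ * B ≤
      η * (A - ‖a‖ ^ 2) - σ * (B - ‖b‖ ^ 2) + ‖η * a - σ * b‖ ^ 2 := by
  have hη0 : 0 < η := by linarith
  have hσ0 : 0 < σ := by rw [hσ]; apply div_pos <;> linarith
  have h1 : η * (η - 1) / 2 = η ^ 2 * σ := by rw [hσ]; field_simp
  have h2 : |η * ‖a‖ - σ * ‖b‖| ≤ ‖η * a - σ * b‖ := by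
    have := abs_norm_sub_norm_le ((η : ℂ) * a) ((σ : ℂ) * b)
    rwa [norm_mul, norm_mul, Complex.norm_real, Complex.norm_real, Real.norm_eq_abs,
      Real.norm_eq_abs, abs_of_pos hη0, abs_of_pos hσ0] at this
  have h3 : (η * ‖a‖ - σ * ‖b‖) ^ 2 ≤ ‖η * a - σ * b‖ ^ 2 := by
    rw [← sq_abs]
    exact pow_le_pow_left₀ (abs_nonneg _) h2 2
  have h4 : 0 ≤ σ * (η * ‖a‖ - ‖b‖) ^ 2 := by positivity
  have h5 : η ^ 2 * ‖a‖ ^ 2 = η * ‖a‖ ^ 2 + 2 * (η ^ 2 * σ) * ‖a‖ ^ 2 := by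
    rw [← h1]; ring
  have h6 : 0 ≤ σ ^ 2 * ‖b‖ ^ 2 := by positivity
  rw [h1]
  linarith

/-- The three-case analysis behind strict plurisubharmonicity near a boundary point. -/
lemma eventually_bracket_pos {W : Type*} [TopologicalSpace W] {w₀ : W} {ρ l d m : W → ℝ}
    {P : W → Prop} {η σ C : ℝ} (hη : 1 < η) (hρ : ContinuousAt ρ w₀) (hl : ContinuousAt l w₀)
    (hd : ContinuousAt d w₀) (hm : ContinuousAt m w₀) (hρ0 : ρ w₀ = 0) (hd0 : ∀ w, 0 ≤ d w)
    (hL : ∀ᶠ w in 𝓝 w₀, P w → -C * (|ρ w| + d w) ≤ l w) (hnn : d w₀ = 0 → 0 ≤ l w₀)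
    (hnull : d w₀ = 0 → l w₀ = 0 → η * (C + C ^ 2 / (η - 1)) + σ * m w₀ < 0) :
    ∀ᶠ w in 𝓝 w₀, P w → 0 < ρ w →
      0 < η * (l w / ρ w) + η * (η - 1) / 2 * (d w / ρ w) ^ 2 - σ * m w := by
  have hη1 : 0 < η - 1 := by linarith
  have lower : ∀ w, -C * (|ρ w| + d w) ≤ l w → 0 < ρ w →
      -(η * (C + C ^ 2 / (η - 1))) + η * (η - 1) / 4 * (d w / ρ w) ^ 2 ≤
        η * (l w / ρ w) + η * (η - 1) / 2 * (d w / ρ w) ^ 2 := by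
    intro w hw hpos
    set x := d w / ρ w with hx
    have h1 : -C - C * x ≤ l w / ρ w := by
      rw [le_div_iff₀ hpos, sub_mul, mul_assoc C x, hx, div_mul_cancel₀ _ hpos.ne']
      rw [abs_of_pos hpos] at hw
      linarith
    have h2 : 0 ≤ C ^ 2 / (η - 1) - C * x + (η - 1) / 4 * x ^ 2 := by
      have : C ^ 2 / (η - 1) - C * x + (η - 1) / 4 * x ^ 2 =
          (C - (η - 1) / 2 * x) ^ 2 / (η - 1) := by
        field_simp; ring
      rw [this]
      positivity
    have h3 : 0 ≤ η * ((l w / ρ w - (-C - C * x)) +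
        (C ^ 2 / (η - 1) - C * x + (η - 1) / 4 * x ^ 2)) :=
      mul_nonneg (by linarith) (by linarith)
    linarith
  rcases (hd0 w₀).eq_or_lt with h | h
  · rcases (hnn h.symm).eq_or_lt with h' | h'
    · have hc : ContinuousAt (fun w => η * (C + C ^ 2 / (η - 1)) + σ * m w) w₀ := by fun_prop
      filter_upwards [hL, hc.eventually (gt_mem_nhds (hnull h.symm h'.symm))] with w h1 h2 hP hpos
      have := lower w (h1 hP) hpos
      have : 0 ≤ η * (η - 1) / 4 * (d w / ρ w) ^ 2 := by positivity
      linarith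
    · have hc : ContinuousAt (fun w => η * l w - ρ w * (σ * m w)) w₀ := by fun_prop
      have hlt : 0 < η * l w₀ - ρ w₀ * (σ * m w₀) := by
        rw [hρ0, zero_mul, sub_zero]
        exact mul_pos (by linarith) h'
      filter_upwards [hc.eventually (lt_mem_nhds hlt)] with w h1 hP hpos
      have h2 : 0 < (η * l w - ρ w * (σ * m w)) / ρ w := div_pos h1 hpos
      have h3 : (η * l w - ρ w * (σ * m w)) / ρ w = η * (l w / ρ w) - σ * m w := by
        field_simp
      have : 0 ≤ η * (η - 1) / 2 * (d w / ρ w) ^ 2 := by positivity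
      linarith
  · have hc : ContinuousAt (fun w => η * (η - 1) / 4 * d w ^ 2 -
        ρ w ^ 2 * (η * (C + C ^ 2 / (η - 1)) + σ * m w)) w₀ := by fun_prop
    have hlt : 0 < η * (η - 1) / 4 * d w₀ ^ 2 -
        ρ w₀ ^ 2 * (η * (C + C ^ 2 / (η - 1)) + σ * m w₀) := by
      rw [hρ0, zero_pow two_ne_zero, zero_mul, sub_zero]
      positivity
    filter_upwards [hL, hc.eventually (lt_mem_nhds hlt)] with w h1 h2 hP hpos
    have h3 := lower w (h1 hP) hpos
    have h4 := div_pos h2 (pow_pos hpos 2)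
    have h5 : (η * (η - 1) / 4 * d w ^ 2 -
        ρ w ^ 2 * (η * (C + C ^ 2 / (η - 1)) + σ * m w)) / ρ w ^ 2 =
        η * (η - 1) / 4 * (d w / ρ w) ^ 2 - (η * (C + C ^ 2 / (η - 1)) + σ * m w) := by
      field_simp
    linarith

/-- A Levi lower bound at every point of a compact set holds with a uniform constant. -/
lemma exists_uniform_leviLowerBound {n : ℕ} {G : Set (Fin n → ℂ)} (hG : IsCompact G)
    {r : (Fin n → ℂ) → ℝ} (hL : ∀ q ∈ G, LeviLowerBound r q) :
    ∃ C, 0 ≤ C ∧ ∀ q ∈ G, ∀ᶠ z in 𝓝 q, ∀ X,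
      -C * (|r z| * ‖X‖ ^ 2 + ‖X‖ * ‖dirDeriv X (cplx r) z‖) ≤ (levi r X X z).re := by
  obtain ⟨C, h0, U, hU, hC⟩ : ∃ C, 0 ≤ C ∧ ∃ U, G ⊆ interior U ∧ ∀ z ∈ U, ∀ X,
      -C * (|r z| * ‖X‖ ^ 2 + ‖X‖ * ‖dirDeriv X (cplx r) z‖) ≤ (levi r X X z).re := by
    refine hG.induction_on (p := fun s => ∃ C, 0 ≤ C ∧ ∃ U, s ⊆ interior U ∧ ∀ z ∈ U, ∀ X,
      -C * (|r z| * ‖X‖ ^ 2 + ‖X‖ * ‖dirDeriv X (cplx r) z‖) ≤ (levi r X X z).re)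
      ⟨0, le_rfl, ∅, by simp, by simp⟩ ?_ ?_ ?_
    · rintro s t hst ⟨C, a, U, b, c⟩
      exact ⟨C, a, U, hst.trans b, c⟩
    · rintro s t ⟨C, a, U, b, c⟩ ⟨C', a', U', b', c'⟩
      refine ⟨C + C', add_nonneg a a', U ∪ U', Set.union_subset
        (b.trans (interior_mono Set.subset_union_left))
        (b'.trans (interior_mono Set.subset_union_right)), ?_⟩
      rintro z hz X
      have hnn : 0 ≤ |r z| * ‖X‖ ^ 2 + ‖X‖ * ‖dirDeriv X (cplx r) z‖ := by positivity
      have e1 := mul_nonneg a hnn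
      have e2 := mul_nonneg a' hnn
      rcases hz with hz | hz
      · have := c z hz X
        linarith
      · have := c' z hz X
        linarith
    · intro q hq
      obtain ⟨C, hC0, hC⟩ := hL q hq
      refine ⟨_, mem_nhdsWithin_of_mem_nhds (interior_mem_nhds.mpr hC), C, hC0, _, le_rfl,
        fun z hz => hz⟩
  exact ⟨C, h0, fun q hq => Filter.eventually_of_mem (mem_interior_iff_mem_nhds.mp (hU hq)) hC⟩

/-- A weight which is suitably negative on null directions yields a strictly plurisubharmonic
function on the positive side near a boundary point. -/
lemma eventually_levi_pos {n : ℕ} {r v : (Fin n → ℂ) → ℝ} (hr : ContDiff ℝ (⊤ : ℕ∞) r)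
    (hv : ContDiff ℝ (⊤ : ℕ∞) v) {q : Fin n → ℂ} (hq : r q = 0) (hvq : 0 < v q)
    (hpc : LeviPseudoconvexAt r q) {η σ C : ℝ} (hη : 1 < η) (hσ : σ = (η - 1) / (2 * η))
    (hC : ∀ᶠ z in 𝓝 q, ∀ X,
      -C * (|r z| * ‖X‖ ^ 2 + ‖X‖ * ‖dirDeriv X (cplx r) z‖) ≤ (levi r X X z).re)
    (hw : ∀ X, ‖X‖ = 1 → dirDeriv X (cplx r) q = 0 → (levi r X X q).re = 0 →
      (levi v X X q).re + (η * (C + C ^ 2 / (η - 1)) + 1) / σ * v q < 0) :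
    ∀ᶠ z in 𝓝 q, 0 < r z → ∀ X, X ≠ 0 → 0 <
      (levi (fun w => Real.exp (η * Real.log (r w) + (-σ) * Real.log (v w))) X X z).re := by
  have hσ0 : 0 < σ := by rw [hσ]; apply div_pos <;> linarith
  have hvpos : ∀ᶠ z in 𝓝 q, 0 < v z := hv.continuous.continuousAt.eventually (lt_mem_nhds hvq)
  have key : ∀ᶠ z in 𝓝 q, ∀ Y ∈ Metric.sphere (0 : Fin n → ℂ) 1, ‖Y‖ = 1 → 0 < r z →
      0 < η * ((levi r Y Y z).re / r z) +
        η * (η - 1) / 2 * (‖dirDeriv Y (cplx r) z‖ / r z) ^ 2 -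
        σ * ((levi v Y Y z).re / v z) := by
    refine (isCompact_sphere _ _).eventually_forall_of_forall_eventually fun X hX => ?_
    have hX1 : ‖X‖ = 1 := by simpa using hX
    refine eventually_bracket_pos (w₀ := (q, X)) (ρ := fun w => r w.1)
      (l := fun w => (levi r w.2 w.2 w.1).re) (d := fun w => ‖dirDeriv w.2 (cplx r) w.1‖)
      (m := fun w => (levi v w.2 w.2 w.1).re / v w.1) (P := fun w => ‖w.2‖ = 1)
      (σ := σ) (C := C) hη (hr.continuous.comp continuous_fst).continuousAt
      (continuous_levi hr).continuousAt (continuous_dirDeriv hr).norm.continuousAt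
      ((continuous_levi hv).continuousAt.div (hv.continuous.comp continuous_fst).continuousAt
        hvq.ne') hq (fun w => norm_nonneg _) ?_ (fun h => hpc X (norm_eq_zero.mp h)) ?_
    · filter_upwards [continuous_fst.continuousAt.eventually hC] with w hw hP
      have := hw w.2
      simpa [hP] using this
    · intro h1 h2
      have h3 := hw X hX1 (norm_eq_zero.mp h1) h2
      have h4 : (levi v X X q).re / v q < -((η * (C + C ^ 2 / (η - 1)) + 1) / σ) := by
        rw [div_lt_iff₀ hvq]; linarith
      have h5 := mul_lt_mul_of_pos_left h4 hσ0
      rw [mul_neg, mul_div_cancel₀ _ hσ0.ne'] at h5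
      change η * (C + C ^ 2 / (η - 1)) + σ * ((levi v X X q).re / v q) < 0
      linarith
  filter_upwards [key, hvpos] with z hz hvz hrz X hX
  set c : ℂ := ((‖X‖ : ℝ) : ℂ) with hc
  have hX0 : 0 < ‖X‖ := norm_pos_iff.mpr hX
  have hc0 : c ≠ 0 := by rw [hc]; exact_mod_cast hX0.ne'
  set Y := c⁻¹ • X with hY
  have hXY : X = c • Y := by rw [hY, smul_smul, mul_inv_cancel₀ hc0, one_smul]
  have hY1 : ‖Y‖ = 1 := by
    rw [hY, norm_smul, norm_inv, hc, Complex.norm_real, norm_norm, inv_mul_cancel₀ hX0.ne']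
  have h1 := hz Y (by simpa using hY1) hY1 hrz
  rw [hXY, levi_smul_left, levi_smul_right, hc, Complex.conj_ofReal, Complex.re_ofReal_mul,
    Complex.re_ofReal_mul, levi_rpow_mul_rpow (hr.of_le (WithTop.coe_le_coe.mpr le_top)).contDiffAt
      (hv.of_le (WithTop.coe_le_coe.mpr le_top)).contDiffAt hrz hvz]
  refine mul_pos hX0 (mul_pos hX0 (mul_pos (Real.exp_pos _) (lt_of_lt_of_le ?_
    (levi_bracket_lower_bound hη hσ _ _))))
  rwa [norm_div, Complex.norm_real, Real.norm_eq_abs, abs_of_pos hrz]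

section definingFunctions

variable {n : ℕ} {Ω V : Set (Fin n → ℂ)} {ρ : (Fin n → ℂ) → ℝ}

lemma IsDefFn.eq_zero_of_mem_frontier (hdef : IsDefFn Ω V ρ) (hΩ : IsOpen Ω) {q : Fin n → ℂ}
    (hq : q ∈ frontier Ω) : ρ q = 0 := by
  have hqV : q ∈ V := hdef.subset hq.1
  have hcont : ContinuousAt ρ q :=
    hdef.smooth.continuousOn.continuousAt (hdef.isOpen.mem_nhds hqV)
  refine le_antisymm ?_ ?_
  · by_contra! hc
    obtain ⟨z, hz, hzΩ⟩ := mem_closure_iff_nhds.mp hq.1 _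
      (hcont.eventually (lt_mem_nhds hc))
    rw [hdef.eq] at hzΩ
    exact lt_asymm hz hzΩ.2
  · by_contra! hc
    have : q ∈ Ω := by rw [hdef.eq]; exact ⟨hqV, hc⟩
    rw [hΩ.frontier_eq] at hq
    exact hq.2 this

/-- Near the frontier, zeros of a defining function are frontier points. -/
lemma IsDefFn.mem_frontier_of_eq_zero (hdef : IsDefFn Ω V ρ) {z : Fin n → ℂ} (hzV : z ∈ V)
    (hz : ρ z = 0) (hg : fderiv ℝ ρ z ≠ 0) : z ∈ frontier Ω := by
  have hzΩ : z ∉ Ω := by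
    rw [hdef.eq]
    rintro ⟨-, h⟩
    exact h.ne hz
  refine ⟨?_, fun h => hzΩ (interior_subset h)⟩
  by_contra hc
  refine hg (IsLocalMin.fderiv_eq_zero (f := ρ) ?_)
  filter_upwards [isClosed_closure.isOpen_compl.mem_nhds hc, hdef.isOpen.mem_nhds hzV] with w hw hwV
  rw [hz]
  by_contra! hlt
  refine hw (subset_closure ?_)
  rw [hdef.eq]
  exact ⟨hwV, hlt⟩

/-- A defining function agrees near the frontier with a globally smooth function. -/
lemma IsDefFn.exists_global (hdef : IsDefFn Ω V ρ) :
    ∃ r : (Fin n → ℂ) → ℝ, ContDiff ℝ (⊤ : ℕ∞) r ∧ ∀ q ∈ frontier Ω, r =ᶠ[𝓝 q] ρ := by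
  have hsub : frontier Ω ⊆ V := frontier_subset_closure.trans hdef.subset
  obtain ⟨χ, hχ, hχ0, hχ1, -⟩ := exists_cutoff (s := Vᶜ) (t := frontier Ω)
    hdef.isOpen.isClosed_compl isClosed_frontier
    (Set.disjoint_left.mpr fun z hz hzf => hz (hsub hzf))
  refine ⟨fun z => χ z * ρ z, contDiff_iff_contDiffAt.mpr fun z => ?_, fun q hq => ?_⟩
  · by_cases hz : z ∈ V
    · exact hχ.contDiffAt.mul (hdef.smooth.contDiffAt (hdef.isOpen.mem_nhds hz))
    · refine (contDiffAt_const (c := (0 : ℝ))).congr_of_eventuallyEq ?_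
      filter_upwards [hχ0 z hz] with w hw
      simp [hw]
  · filter_upwards [hχ1 q hq] with w hw
    simp [hw]

lemma IsDefFn.mul_exp (hdef : IsDefFn Ω V ρ) (hΩ : IsOpen Ω) {g : (Fin n → ℂ) → ℝ}
    (hg : ContDiff ℝ (⊤ : ℕ∞) g) : IsDefFn Ω V fun z => ρ z * Real.exp (g z) where
  isOpen := hdef.isOpen
  subset := hdef.subset
  smooth := hdef.smooth.mul (Real.contDiff_exp.comp hg).contDiffOn
  eq := by
    conv_lhs => rw [hdef.eq]
    ext z
    simp only [Set.mem_ofPred_eq]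
    rw [mul_neg_iff]
    simp [Real.exp_pos, (Real.exp_pos (g z)).not_gt]
  grad_ne := by
    intro z hz
    have hzV := hdef.subset hz.1
    have h1 : HasFDerivAt ρ (fderiv ℝ ρ z) z :=
      ((hdef.smooth.contDiffAt (hdef.isOpen.mem_nhds hzV)).differentiableAt (by simp)).hasFDerivAt
    have h2 : HasFDerivAt (fun z => Real.exp (g z)) (fderiv ℝ (fun z => Real.exp (g z)) z) z :=
      (((Real.contDiff_exp.comp hg).differentiable (by simp)) z).hasFDerivAt
    rw [show fderiv ℝ (fun z => ρ z * Real.exp (g z)) z = _ from (h1.mul h2).fderiv,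
      hdef.eq_zero_of_mem_frontier hΩ hz, zero_smul, zero_add]
    exact smul_ne_zero (Real.exp_pos _).ne' (hdef.grad_ne z hz)

end definingFunctions

lemma one_le_steinIndex {n : ℕ} (Ω : Set (Fin n → ℂ)) : 1 ≤ steinIndex Ω := by
  refine le_iInf fun V => le_iInf fun ρ => le_iInf fun _ => le_sInf ?_
  rintro _ ⟨η, hη, rfl⟩
  rw [← ENNReal.ofReal_one]
  exact ENNReal.ofReal_le_ofReal hη.1.le

lemma steinIndex_le_of_finite_type {n : ℕ} {Ω V : Set (Fin n → ℂ)} {ρ : (Fin n → ℂ) → ℝ}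
    (hΩ : IsOpen Ω) (hbd : Bornology.IsBounded Ω)
    (hdef : IsDefFn Ω V ρ) (hpsc : ∀ q ∈ frontier Ω, LeviPseudoconvexAt ρ q)
    (hft : ∀ p ∈ frontier Ω, FiniteTypePt ρ p) {η : ℝ} (hη : 1 < η) :
    steinIndex Ω ≤ ENNReal.ofReal η := by
  have hη0 : η ≠ 0 := by linarith
  have hG : IsCompact (frontier Ω) :=
    hbd.isCompact_closure.of_isClosed_subset isClosed_frontier frontier_subset_closure
  obtain ⟨r, hr, hrρ⟩ := hdef.exists_global
  have h0 : ∀ q ∈ frontier Ω, r q = 0 := fun q hq => by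
    rw [(hrρ q hq).self_of_nhds, hdef.eq_zero_of_mem_frontier hΩ hq]
  have hgrad : ∀ q ∈ frontier Ω, fderiv ℝ r q ≠ 0 := fun q hq => by
    rw [(hrρ q hq).fderiv_eq]
    exact hdef.grad_ne q hq
  have hpc : ∀ q ∈ frontier Ω, LeviPseudoconvexAt r q := fun q hq X hX => by
    rw [levi_congr (hrρ q hq)]
    rw [dirDeriv_congr (cplx_congr (hrρ q hq))] at hX
    exact hpsc q hq X hX
  have hzero : ∀ q ∈ frontier Ω, ∀ᶠ z in 𝓝 q, r z = 0 → z ∈ frontier Ω := fun q hq => by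
    have hne : ∀ᶠ z in 𝓝 q, fderiv ℝ r z ≠ 0 :=
      (hr.continuous_fderiv (by simp)).continuousAt.eventually_ne (hgrad q hq)
    filter_upwards [(hrρ q hq).eventuallyEq_nhds, hne,
      hdef.isOpen.mem_nhds (hdef.subset hq.1)] with z h1 h2 h3 h4
    rw [h1.self_of_nhds] at h4
    rw [h1.fderiv_eq] at h2
    exact hdef.mem_frontier_of_eq_zero h3 h4 h2
  have hL : ∀ q ∈ frontier Ω, LeviLowerBound r q := fun q hq =>
    leviLowerBound_of_pseudoconvex hr (h0 q hq) (hgrad q hq)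
      ((hzero q hq).mono fun z hz h => hpc z (hz h))
  obtain ⟨C, -, hC⟩ := exists_uniform_leviLowerBound hG hL
  set σ := (η - 1) / (2 * η) with hσ
  obtain ⟨v, hv, hvpos, hvneg⟩ := exists_weight hG hr h0 hgrad hL hpc
    (fun p hp => ⟨ρ, (hrρ p hp).symm, hft p hp⟩) ((η * (C + C ^ 2 / (η - 1)) + 1) / σ)
  obtain ⟨χ, hχ, hχ0, hχ1, hχb⟩ := exists_cutoff (s := {z | v z ≤ 0}) (t := frontier Ω)
    (isClosed_le hv.continuous continuous_const) isClosed_frontier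
    (Set.disjoint_left.mpr fun z hz hzf => (hvpos z hzf).not_ge hz)
  set u : (Fin n → ℂ) → ℝ := fun z => χ z * v z + (1 - χ z) with hu
  have hus : ContDiff ℝ (⊤ : ℕ∞) u := (hχ.mul hv).add (contDiff_const.sub hχ)
  have hupos : ∀ z, 0 < u z := by
    intro z
    rcases le_or_gt (v z) 0 with h | h
    · simp [hu, (hχ0 z h).self_of_nhds]
    · have h1 := (hχb z).1
      have h2 := (hχb z).2
      simp only [hu]
      rcases h1.eq_or_lt with h3 | h3
      · rw [← h3]; simp
      · have := mul_pos h3 h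
        linarith
  have huv : ∀ q ∈ frontier Ω, u =ᶠ[𝓝 q] v := fun q hq => by
    filter_upwards [hχ1 q hq] with z hz
    simp [hu, hz]
  set g : (Fin n → ℂ) → ℝ := fun z => -(σ / η) * Real.log (u z) with hg
  have hgs : ContDiff ℝ (⊤ : ℕ∞) g := contDiff_const.mul (hus.log fun z => (hupos z).ne')
  have hdef' := hdef.mul_exp hΩ hgs
  refine iInf_le_of_le V (iInf_le_of_le _ (iInf_le_of_le hdef' (sInf_le ⟨η, ⟨hη, ?_⟩, rfl⟩)))
  have hloc : ∀ q ∈ frontier Ω, ∀ᶠ z in 𝓝 q, z ∈ (closure Ω)ᶜ → ∀ X : Fin n → ℂ, X ≠ 0 →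
      0 < (levi (fun z => (ρ z * Real.exp (g z)) ^ η) X X z).re := by
    intro q hq
    have hpos := eventually_levi_pos hr hus (h0 q hq) (hupos q) (hpc q hq) hη hσ (hC q hq)
      fun X hX h1 h2 => by
        rw [levi_congr (huv q hq), (huv q hq).self_of_nhds]
        exact hvneg (q, X) ⟨hq, hX, h1, h2⟩
    filter_upwards [hpos, hzero q hq, (hrρ q hq).eventuallyEq_nhds,
      hdef.isOpen.mem_nhds (hdef.subset hq.1)] with z h1 h2 h3 h4 h5 X hX
    have hrz : 0 < r z := by
      refine lt_of_le_of_ne ?_ fun h => h5 (h2 h.symm).1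
      by_contra! hlt
      refine h5 (subset_closure ?_)
      rw [hdef.eq]
      exact ⟨h4, by rwa [← h3.self_of_nhds]⟩
    have heq : (fun z => (ρ z * Real.exp (g z)) ^ η) =ᶠ[𝓝 z]
        fun w => Real.exp (η * Real.log (r w) + (-σ) * Real.log (u w)) := by
      filter_upwards [h3, hr.continuous.continuousAt.eventually (lt_mem_nhds hrz)] with w hw hrw
      rw [← hw, Real.rpow_def_of_pos (mul_pos hrw (Real.exp_pos _)),
        Real.log_mul hrw.ne' (Real.exp_pos _).ne', Real.log_exp]
      congr 1
      simp only [hg]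
      field_simp
    rw [levi_congr heq]
    exact h1 hrz X hX
  refine ⟨interior {z | z ∈ (closure Ω)ᶜ → ∀ X : Fin n → ℂ, X ≠ 0 →
      0 < (levi (fun z => (ρ z * Real.exp (g z)) ^ η) X X z).re}, isOpen_interior,
    fun q hq => mem_interior_iff_mem_nhds.mpr (hloc q hq), ?_⟩
  rintro z ⟨hz, hzW⟩ X hX
  exact interior_subset hzW hz X hX

/-- Corollary 6.4: if every boundary point of `Ω` is of finite
D'Angelo type, then `S(Ω) = 1`. -/
theorem steinIndex_eq_one_of_finite_type {n : ℕ} (hn : 2 ≤ n) (Ω V : Set (Fin n → ℂ))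
    (ρ : (Fin n → ℂ) → ℝ)
    (hΩ : IsOpen Ω) (hbd : Bornology.IsBounded Ω)
    (hdef : IsDefFn Ω V ρ) (hpsc : ∀ q ∈ frontier Ω, LeviPseudoconvexAt ρ q)
    (hft : ∀ p ∈ frontier Ω, FiniteTypePt ρ p) :
    steinIndex Ω = 1 := by
  refine le_antisymm (ENNReal.le_of_forall_pos_le_add fun ε hε _ => ?_) (one_le_steinIndex Ω)
  refine (steinIndex_le_of_finite_type hΩ hbd hdef hpsc hft (η := 1 + ε)
    (by simpa using hε)).trans ?_
  rw [ENNReal.ofReal_add zero_le_one ε.coe_nonneg, ENNReal.ofReal_one, ENNReal.ofReal_coe_nnreal]
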